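/- arXiv:1904.04795 — 5 statements merged into one kernel-verified Lean document; each statement's English description precedes it below -/
import Mathlib

section
/- L² a priori estimate for the elliptic problem: Let 0 < α ≤ 1 and let F ∈ L²([0,∞)×[0,π/2]) satisfy ∫₀^{π/2} F(R,θ) cos²θ sin θ dθ = 0 for every R. Suppose Ψ is C² on (0,∞)×[0,π/2], solves −α²R²∂_{RR}Ψ − α(5+α)R∂_RΨ − ∂_{θθ}Ψ + ∂_θ(tan θ · Ψ) − 6Ψ = F with boundary conditions Ψ(R,0) = Ψ(R,π/2) = 0 for all R, satisfies Ψ(R,θ) → 0 as R → ∞ and R²Ψ(R,θ) → 0 as R → 0, and is such that Ψ, ∂_θΨ, ∂_{θθ}Ψ, R∂_RΨ, R∂_{Rθ}Ψ, R²∂_{RR}Ψ and Ψ/cos θ, ∂_θ(Ψ/cos θ) all lie in L². Then ‖∂_θ(Ψ/cos θ)‖_{L²} + ‖∂_{θθ}Ψ‖_{L²} + α²‖R²∂_{RR}Ψ‖_{L²} ≤ 100‖F‖_{L²}. -/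
open Real MeasureTheory Set Filter

noncomputable section

/-- Partial derivative in the radial variable. -/
def pdR (Ψ : ℝ → ℝ → ℝ) (R θ : ℝ) : ℝ := deriv (fun s => Ψ s θ) R

/-- Partial derivative in the angular variable. -/
def pdT (Ψ : ℝ → ℝ → ℝ) (R θ : ℝ) : ℝ := deriv (fun t => Ψ R t) θ

/-- The angular interval. -/
local notation "𝕁" => Ioo (0 : ℝ) (π / 2)

lemma sin_pos_of_mem {θ : ℝ} (h : θ ∈ 𝕁) : 0 < sin θ :=
  sin_pos_of_pos_of_lt_pi h.1 (by linarith [h.2, pi_pos])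

lemma cos_pos_of_mem {θ : ℝ} (h : θ ∈ 𝕁) : 0 < cos θ :=
  cos_pos_of_mem_Ioo ⟨by linarith [h.1, pi_pos], h.2⟩

lemma abs_le_mul_sin_mul_cos {x C θ : ℝ} (h : θ ∈ 𝕁) (h₁ : |x| ≤ C * sin θ)
    (h₂ : |x| ≤ C * cos θ) : |x| ≤ 2 * C * (sin θ * cos θ) := by
  have hs := sin_pos_of_mem h
  have hc := cos_pos_of_mem h
  have hs1 := sin_le_one θ
  have hc1 := cos_le_one θ
  have hC : 0 ≤ C := by
    by_contra! hC
    nlinarith [abs_nonneg x]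
  have e : |x| = |x| * sin θ ^ 2 + |x| * cos θ ^ 2 := by
    rw [← mul_add, sin_sq_add_cos_sq, mul_one]
  have a₁ : |x| * sin θ ^ 2 ≤ C * (sin θ * cos θ) := calc
    _ ≤ C * cos θ * sin θ ^ 2 := by gcongr
    _ = C * (sin θ * cos θ) * sin θ := by ring
    _ ≤ C * (sin θ * cos θ) * 1 := by gcongr
    _ = _ := by ring
  have a₂ : |x| * cos θ ^ 2 ≤ C * (sin θ * cos θ) := calc
    _ ≤ C * sin θ * cos θ ^ 2 := by gcongr
    _ = C * (sin θ * cos θ) * cos θ := by ring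
    _ ≤ C * (sin θ * cos θ) * 1 := by gcongr
    _ = _ := by ring
  linarith

/-- If `T` vanishes at both endpoints of the angular interval and `T' ≤ φ`, then `∫ φ ≥ 0`. -/
lemma integral_nonneg_of_deriv_le {T T' φ : ℝ → ℝ} {C : ℝ}
    (hd : ∀ θ ∈ 𝕁, HasDerivAt T (T' θ) θ)
    (hb : ∀ θ ∈ 𝕁, |T θ| ≤ C * (sin θ * cos θ))
    (hle : ∀ θ ∈ 𝕁, T' θ ≤ φ θ) (hφ : IntegrableOn φ 𝕁) : 0 ≤ ∫ θ in 𝕁, φ θ := by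
  set g : ℝ → ℝ := indicator 𝕁 T with hg
  have hgb : ∀ θ, |g θ| ≤ |C * (sin θ * cos θ)| := by
    intro θ
    by_cases h : θ ∈ 𝕁
    · rw [hg, indicator_of_mem h]
      exact (hb θ h).trans (le_abs_self _)
    · rw [hg, indicator_of_notMem h, abs_zero]
      exact abs_nonneg _
  have hend : ∀ θ, sin θ * cos θ = 0 → ContinuousAt g θ := by
    intro θ h0
    have h1 : g θ = 0 := by
      have := hgb θ
      rw [h0] at this
      simpa using this
    rw [ContinuousAt, h1]
    refine squeeze_zero_norm hgb ?_
    have : Continuous fun θ => |C * (sin θ * cos θ)| := by fun_prop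
    simpa [h0] using this.tendsto θ
  have hgd : ∀ θ ∈ 𝕁, HasDerivAt g (T' θ) θ := by
    intro θ h
    refine (hd θ h).congr_of_eventuallyEq ?_
    filter_upwards [isOpen_Ioo.mem_nhds h] with t ht
    rw [hg, indicator_of_mem ht]
  have hp : (0 : ℝ) ≤ π / 2 := by positivity
  have hcont : ContinuousOn g (Icc 0 (π / 2)) := by
    intro θ h
    rcases eq_endpoints_or_mem_Ioo_of_mem_Icc h with h | h | h
    · exact (hend θ (by simp [h])).continuousWithinAt
    · exact (hend θ (by simp [h])).continuousWithinAt
    · exact (hgd θ h).continuousAt.continuousWithinAt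
  have key := intervalIntegral.sub_le_integral_of_hasDeriv_right_of_le hp hcont
    (fun θ h => (hgd θ h).hasDerivWithinAt)
    ((integrableOn_Icc_iff_integrableOn_Ioo).2 hφ) hle
  rw [intervalIntegral.integral_of_le hp, integral_Ioc_eq_integral_Ioo] at key
  simpa [hg] using key

lemma integral_eq_zero_of_deriv {T φ : ℝ → ℝ} {C : ℝ}
    (hd : ∀ θ ∈ 𝕁, HasDerivAt T (φ θ) θ)
    (hb : ∀ θ ∈ 𝕁, |T θ| ≤ C * (sin θ * cos θ)) (hφ : IntegrableOn φ 𝕁) :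
    ∫ θ in 𝕁, φ θ = 0 := by
  apply le_antisymm _ (integral_nonneg_of_deriv_le hd hb (fun _ _ => le_rfl) hφ)
  have := integral_nonneg_of_deriv_le (T := fun θ => -T θ) (φ := fun θ => -φ θ)
    (fun θ h => (hd θ h).neg) (by simpa using hb) (fun _ _ => le_rfl) hφ.neg
  rw [integral_neg] at this
  linarith

/-- Comparison of increments on the closed angular interval. -/
lemma abs_sub_le_of_deriv {g g' k k' : ℝ → ℝ}
    (hgc : ContinuousOn g (Icc 0 (π / 2))) (hkc : ContinuousOn k (Icc 0 (π / 2)))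
    (hg : ∀ θ ∈ 𝕁, HasDerivAt g (g' θ) θ) (hk : ∀ θ ∈ 𝕁, HasDerivAt k (k' θ) θ)
    (hle : ∀ θ ∈ 𝕁, |g' θ| ≤ k' θ) {x y : ℝ} (hx : x ∈ Icc 0 (π / 2))
    (hy : y ∈ Icc 0 (π / 2)) (hxy : x ≤ y) : |g y - g x| ≤ k y - k x := by
  have m₁ : MonotoneOn (fun θ => k θ - g θ) (Icc 0 (π / 2)) := by
    refine monotoneOn_of_hasDerivWithinAt_nonneg (convex_Icc _ _) (hkc.sub hgc)
      (f' := fun θ => k' θ - g' θ) ?_ ?_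
    · intro θ h
      rw [interior_Icc] at h
      exact ((hk θ h).sub (hg θ h)).hasDerivWithinAt
    · intro θ h
      rw [interior_Icc] at h
      linarith [le_abs_self (g' θ), hle θ h]
  have m₂ : MonotoneOn (fun θ => k θ + g θ) (Icc 0 (π / 2)) := by
    refine monotoneOn_of_hasDerivWithinAt_nonneg (convex_Icc _ _) (hkc.add hgc)
      (f' := fun θ => k' θ + g' θ) ?_ ?_
    · intro θ h
      rw [interior_Icc] at h
      exact ((hk θ h).add (hg θ h)).hasDerivWithinAt
    · intro θ h
      rw [interior_Icc] at h
      linarith [neg_abs_le (g' θ), hle θ h]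
  have h₁ := m₁ hx hy hxy
  have h₂ := m₂ hx hy hxy
  simp only at h₁ h₂
  rw [abs_le]
  constructor <;> linarith

/-- A `C²` function on `[0, π/2]` with Dirichlet conditions, with its first two derivatives. -/
structure AngularC2 (ψ ψ₁ ψ₂ : ℝ → ℝ) : Prop where
  cont₀ : ContinuousOn ψ (Icc 0 (π / 2))
  cont₁ : ContinuousOn ψ₁ (Icc 0 (π / 2))
  cont₂ : ContinuousOn ψ₂ (Icc 0 (π / 2))
  deriv₀ : ∀ θ ∈ 𝕁, HasDerivAt ψ (ψ₁ θ) θ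
  deriv₁ : ∀ θ ∈ 𝕁, HasDerivAt ψ₁ (ψ₂ θ) θ
  left : ψ 0 = 0
  right : ψ (π / 2) = 0

/-- The derivative of `ψ / cos`, in terms of `ψ` and `ψ' = ψ₁`. -/
def secDeriv (ψ ψ₁ : ℝ → ℝ) (θ : ℝ) : ℝ := (cos θ * ψ₁ θ + sin θ * ψ θ) / cos θ ^ 2

/-- The angular operator `-ψ'' + (tan ψ)' - 6 ψ`. -/
def angularOp (ψ ψ₁ ψ₂ : ℝ → ℝ) (θ : ℝ) : ℝ :=
  -ψ₂ θ + sin θ * secDeriv ψ ψ₁ θ - 5 * ψ θ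

namespace AngularC2

variable {ψ ψ₁ ψ₂ χ χ₁ χ₂ : ℝ → ℝ}

lemma exists_bound (h : AngularC2 ψ ψ₁ ψ₂) : ∃ C, 0 ≤ C ∧ ∀ θ ∈ 𝕁,
    |ψ θ| ≤ C * (sin θ * cos θ) ∧ |ψ₁ θ| ≤ C ∧ |ψ₂ θ| ≤ C ∧ |secDeriv ψ ψ₁ θ| ≤ C := by
  have hp : (0 : ℝ) ≤ π / 2 := by positivity
  obtain ⟨C₀, h₀⟩ := isCompact_Icc.exists_bound_of_continuousOn h.cont₀
  obtain ⟨C₁, h₁⟩ := isCompact_Icc.exists_bound_of_continuousOn h.cont₁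
  obtain ⟨C₂, h₂⟩ := isCompact_Icc.exists_bound_of_continuousOn h.cont₂
  have m0 : (0 : ℝ) ∈ Icc 0 (π / 2) := left_mem_Icc.2 hp
  have m1 : π / 2 ∈ Icc 0 (π / 2) := right_mem_Icc.2 hp
  have p₀ : 0 ≤ C₀ := (norm_nonneg _).trans (h₀ 0 m0)
  have p₁ : 0 ≤ C₁ := (norm_nonneg _).trans (h₁ 0 m0)
  have p₂ : 0 ≤ C₂ := (norm_nonneg _).trans (h₂ 0 m0)
  simp only [Real.norm_eq_abs] at h₀ h₁ h₂
  refine ⟨4 * C₁ + C₂ + C₀, by positivity, fun θ hθ => ?_⟩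
  have hθ' := Ioo_subset_Icc_self hθ
  have hs := sin_pos_of_mem hθ
  have hc := cos_pos_of_mem hθ
  have lin : ∀ x ∈ Icc 0 (π / 2), ∀ y ∈ Icc 0 (π / 2), x ≤ y →
      |ψ y - ψ x| ≤ C₁ * y - C₁ * x := fun x hx y hy hxy =>
    abs_sub_le_of_deriv h.cont₀ (by fun_prop) h.deriv₀
      (fun θ _ => by simpa using (hasDerivAt_id θ).const_mul C₁)
      (fun θ hθ => h₁ θ (Ioo_subset_Icc_self hθ)) hx hy hxy
  have pi2 : π / 2 ≤ 2 := by linarith [pi_le_four]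
  have js : θ ≤ 2 * sin θ := by
    have := mul_le_sin hθ.1.le hθ.2.le
    have e : θ = π / 2 * (2 / π * θ) := by field_simp
    calc θ = π / 2 * (2 / π * θ) := e
      _ ≤ π / 2 * sin θ := by gcongr
      _ ≤ _ := by gcongr
  have jc : π / 2 - θ ≤ 2 * cos θ := by
    have := mul_le_sin (x := π / 2 - θ) (by linarith [hθ.2]) (by linarith [hθ.1])
    rw [sin_pi_div_two_sub] at this
    have e : π / 2 - θ = π / 2 * (2 / π * (π / 2 - θ)) := by field_simp
    calc _ = π / 2 * (2 / π * (π / 2 - θ)) := e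
      _ ≤ π / 2 * cos θ := by gcongr
      _ ≤ _ := by gcongr
  have a₁ : |ψ θ| ≤ 2 * C₁ * sin θ := by
    have := lin 0 m0 θ hθ' hθ'.1
    rw [h.left, sub_zero] at this
    nlinarith
  have a₂ : |ψ θ| ≤ 2 * C₁ * cos θ := by
    have := lin θ hθ' _ m1 hθ'.2
    rw [h.right, zero_sub, abs_neg] at this
    nlinarith
  refine ⟨(abs_le_mul_sin_mul_cos hθ a₁ a₂).trans ?_, (h₁ θ hθ').trans (by linarith),
    (h₂ θ hθ').trans (by linarith), ?_⟩
  · have : 0 ≤ sin θ * cos θ := by positivity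
    nlinarith
  · have key := abs_sub_le_of_deriv (g := fun θ => cos θ * ψ₁ θ + sin θ * ψ θ)
      (k := fun θ => (C₂ + C₀) * sin θ) (g' := fun θ => cos θ * (ψ₂ θ + ψ θ))
      (k' := fun θ => (C₂ + C₀) * cos θ)
      ((continuous_cos.continuousOn.mul h.cont₁).add (continuous_sin.continuousOn.mul h.cont₀))
      (by fun_prop)
      (fun t ht => by
        refine (((hasDerivAt_cos t).mul (h.deriv₁ t ht)).add
          ((hasDerivAt_sin t).mul (h.deriv₀ t ht))).congr_deriv ?_
        ring)
      (fun t ht => (hasDerivAt_sin t).const_mul _)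
      (fun t ht => by
        have hct := cos_pos_of_mem ht
        have ht' := Ioo_subset_Icc_self ht
        rw [abs_mul, abs_of_pos hct, mul_comm]
        gcongr
        exact (abs_add_le _ _).trans (add_le_add (h₂ t ht') (h₀ t ht')))
      hθ' m1 hθ'.2
    simp only [cos_pi_div_two, sin_pi_div_two, h.right] at key
    rw [zero_mul, mul_zero, zero_add, zero_sub, abs_neg] at key
    rw [secDeriv, abs_div, abs_of_pos (pow_pos hc 2), div_le_iff₀ (pow_pos hc 2)]
    have e : cos θ ^ 2 = (1 - sin θ) * (1 + sin θ) := by rw [cos_sq']; ring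
    have s1 : 0 ≤ 1 - sin θ := by linarith [sin_le_one θ]
    have : 1 - sin θ ≤ cos θ ^ 2 := by rw [e]; nlinarith
    calc _ ≤ (C₂ + C₀) * (1 - sin θ) := by linarith
      _ ≤ (C₂ + C₀) * cos θ ^ 2 := by gcongr
      _ ≤ _ := by gcongr; linarith

end AngularC2

lemma integrableOn_of_continuousOn_of_bound {f : ℝ → ℝ} {C : ℝ} (hf : ContinuousOn f 𝕁)
    (hb : ∀ θ ∈ 𝕁, |f θ| ≤ C) : IntegrableOn f 𝕁 :=
  IntegrableOn.of_bound (by simp) (hf.aestronglyMeasurable measurableSet_Ioo) C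
    ((ae_restrict_iff' measurableSet_Ioo).2 (Eventually.of_forall hb))

lemma integrableOn_of_continuousOn_Icc {f : ℝ → ℝ} (hf : ContinuousOn f (Icc 0 (π / 2))) :
    IntegrableOn f 𝕁 :=
  (hf.integrableOn_Icc).mono_set Ioo_subset_Icc_self

namespace AngularC2

variable {ψ ψ₁ ψ₂ χ χ₁ χ₂ : ℝ → ℝ}

lemma continuousOn_secDeriv (h : AngularC2 ψ ψ₁ ψ₂) : ContinuousOn (secDeriv ψ ψ₁) 𝕁 := by
  have h0 := h.cont₀.mono Ioo_subset_Icc_self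
  have h1 := h.cont₁.mono Ioo_subset_Icc_self
  exact ((continuous_cos.continuousOn.mul h1).add (continuous_sin.continuousOn.mul h0)).div
    (by fun_prop) fun θ hθ => (pow_pos (cos_pos_of_mem hθ) 2).ne'

lemma continuousOn_angularOp (h : AngularC2 ψ ψ₁ ψ₂) : ContinuousOn (angularOp ψ ψ₁ ψ₂) 𝕁 := by
  have h0 := h.cont₀.mono Ioo_subset_Icc_self
  have h2 := h.cont₂.mono Ioo_subset_Icc_self
  have hv := h.continuousOn_secDeriv
  unfold angularOp
  fun_prop

lemma exists_bound_angularOp (h : AngularC2 ψ ψ₁ ψ₂) :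
    ∃ C, ∀ θ ∈ 𝕁, |angularOp ψ ψ₁ ψ₂ θ| ≤ C := by
  obtain ⟨C, hC, hb⟩ := h.exists_bound
  refine ⟨C + C + 5 * C, fun θ hθ => ?_⟩
  obtain ⟨b0, b1, b2, b3⟩ := hb θ hθ
  have hs := sin_pos_of_mem hθ
  have hc := cos_pos_of_mem hθ
  have hs1 := sin_le_one θ
  have hc1 := cos_le_one θ
  have b0' : |ψ θ| ≤ C := b0.trans (mul_le_of_le_one_right hC (by nlinarith))
  have b3' : |sin θ * secDeriv ψ ψ₁ θ| ≤ C := by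
    rw [abs_mul, abs_of_pos hs]
    nlinarith [abs_nonneg (secDeriv ψ ψ₁ θ)]
  rw [abs_le] at *
  unfold angularOp
  constructor <;> linarith

lemma integrableOn_angularOp_mul (h : AngularC2 ψ ψ₁ ψ₂) {g : ℝ → ℝ}
    (hg : ContinuousOn g (Icc 0 (π / 2))) :
    IntegrableOn (fun θ => angularOp ψ ψ₁ ψ₂ θ * g θ) 𝕁 := by
  obtain ⟨C, hC⟩ := h.exists_bound_angularOp
  obtain ⟨D, hD⟩ := isCompact_Icc.exists_bound_of_continuousOn hg
  refine integrableOn_of_continuousOn_of_bound (C := C * D)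
    (h.continuousOn_angularOp.mul (hg.mono Ioo_subset_Icc_self)) fun θ hθ => ?_
  rw [abs_mul]
  exact mul_le_mul (hC θ hθ) (hD θ (Ioo_subset_Icc_self hθ)) (abs_nonneg _)
    ((abs_nonneg _).trans (hC θ hθ))

lemma integral_deriv_mul_deriv (h : AngularC2 ψ ψ₁ ψ₂) (k : AngularC2 χ χ₁ χ₂) :
    ∫ θ in 𝕁, ψ₁ θ * χ₁ θ = -∫ θ in 𝕁, ψ θ * χ₂ θ := by
  obtain ⟨C, hC, hb⟩ := h.exists_bound
  obtain ⟨D, hD, hb'⟩ := k.exists_bound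
  have i₁ : IntegrableOn (fun θ => ψ₁ θ * χ₁ θ) 𝕁 :=
    integrableOn_of_continuousOn_Icc (h.cont₁.mul k.cont₁)
  have i₂ : IntegrableOn (fun θ => ψ θ * χ₂ θ) 𝕁 :=
    integrableOn_of_continuousOn_Icc (h.cont₀.mul k.cont₂)
  have := integral_eq_zero_of_deriv (T := fun θ => ψ θ * χ₁ θ) (C := C * D)
    (φ := fun θ => ψ₁ θ * χ₁ θ + ψ θ * χ₂ θ)
    (fun θ hθ => (h.deriv₀ θ hθ).mul (k.deriv₁ θ hθ))
    (fun θ hθ => by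
      rw [abs_mul]
      calc _ ≤ C * (sin θ * cos θ) * D :=
            mul_le_mul (hb θ hθ).1 (hb' θ hθ).2.1 (abs_nonneg _)
              ((abs_nonneg _).trans (hb θ hθ).1)
        _ = _ := by ring)
    (i₁.add i₂)
  rw [integral_add i₁ i₂] at this
  linarith

lemma hasDerivAt_div_cos (h : AngularC2 ψ ψ₁ ψ₂) {θ : ℝ} (hθ : θ ∈ 𝕁) :
    HasDerivAt (fun t => ψ t / cos t) (secDeriv ψ ψ₁ θ) θ := by
  refine ((h.deriv₀ θ hθ).div (hasDerivAt_cos θ) (cos_pos_of_mem hθ).ne').congr_deriv ?_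
  rw [secDeriv]
  ring

lemma hasDerivAt_tan_mul (h : AngularC2 ψ ψ₁ ψ₂) {θ : ℝ} (hθ : θ ∈ 𝕁) :
    HasDerivAt (fun t => tan t * ψ t) (ψ θ + sin θ * secDeriv ψ ψ₁ θ) θ := by
  have hc := cos_pos_of_mem hθ
  refine ((hasDerivAt_tan hc.ne').mul (h.deriv₀ θ hθ)).congr_deriv ?_
  rw [secDeriv, tan_eq_sin_div_cos]
  field_simp
  linear_combination (-ψ θ) * sin_sq_add_cos_sq θ

lemma hasDerivAt_secDeriv (h : AngularC2 ψ ψ₁ ψ₂) {θ : ℝ} (hθ : θ ∈ 𝕁) :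
    HasDerivAt (secDeriv ψ ψ₁)
      ((ψ₂ θ + ψ θ + 2 * sin θ * secDeriv ψ ψ₁ θ) / cos θ) θ := by
  have hc := cos_pos_of_mem hθ
  refine ((((hasDerivAt_cos θ).mul (h.deriv₁ θ hθ)).add
    ((hasDerivAt_sin θ).mul (h.deriv₀ θ hθ))).div ((hasDerivAt_cos θ).pow 2)
    (pow_pos hc 2).ne').congr_deriv ?_
  simp only [secDeriv, Pi.add_apply, Pi.mul_apply, Pi.pow_apply]
  field_simp
  ring

lemma integral_secondDeriv_identity (h : AngularC2 ψ ψ₁ ψ₂) :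
    ∫ θ in 𝕁, (-(angularOp ψ ψ₁ ψ₂ θ * ψ₂ θ) - ψ₂ θ ^ 2 - 3 / 2 * secDeriv ψ ψ₁ θ ^ 2
      - 1 / 2 * (ψ θ / cos θ) ^ 2 - 6 * (ψ θ * ψ₂ θ)) = 0 := by
  obtain ⟨C, hC, hb⟩ := h.exists_bound
  have hv : ∀ θ ∈ 𝕁, |ψ θ / cos θ| ≤ C * sin θ := by
    intro θ hθ
    have hc := cos_pos_of_mem hθ
    rw [abs_div, abs_of_pos hc, div_le_iff₀ hc, mul_assoc]
    exact (hb θ hθ).1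
  have cv : ContinuousOn (fun θ => ψ θ / cos θ) 𝕁 :=
    fun θ hθ => (h.hasDerivAt_div_cos hθ).continuousAt.continuousWithinAt
  refine integral_eq_zero_of_deriv (C := 3 * C ^ 2)
    (T := fun θ => -(cos θ ^ 2 * (ψ θ / cos θ * secDeriv ψ ψ₁ θ))
      - 1 / 2 * (sin θ * cos θ * secDeriv ψ ψ₁ θ ^ 2)
      + 1 / 2 * (sin θ * cos θ * (ψ θ / cos θ) ^ 2)) ?_ ?_ ?_
  · intro θ hθ
    have hc := cos_pos_of_mem hθ
    have d0 := h.hasDerivAt_div_cos hθ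
    have d1 := h.hasDerivAt_secDeriv hθ
    have dc := hasDerivAt_cos θ
    have ds := hasDerivAt_sin θ
    refine ((((dc.pow 2).mul (d0.mul d1)).neg.sub
      (((ds.mul dc).mul (d1.pow 2)).const_mul (1 / 2))).add
      (((ds.mul dc).mul (d0.pow 2)).const_mul (1 / 2))).congr_deriv ?_
    simp only [angularOp, Pi.mul_apply, Pi.pow_apply]
    have e : ψ θ = cos θ * (ψ θ / cos θ) := by field_simp
    set v := ψ θ / cos θ
    set w := secDeriv ψ ψ₁ θ
    rw [e]
    have hs : sin θ ^ 2 = 1 - cos θ ^ 2 := sin_sq θ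
    field_simp
    ring_nf
    rw [hs]
    ring
  · intro θ hθ
    have hs := sin_pos_of_mem hθ
    have hc := cos_pos_of_mem hθ
    have hs1 := sin_le_one θ
    have hc1 := cos_le_one θ
    have b0 := hv θ hθ
    have b1 := (hb θ hθ).2.2.2
    set v := ψ θ / cos θ
    set w := secDeriv ψ ψ₁ θ
    have hsc : 0 < sin θ * cos θ := mul_pos hs hc
    have b0' : |v| ≤ C := b0.trans (mul_le_of_le_one_right hC hs1)
    have t1 : |cos θ ^ 2 * (v * w)| ≤ C ^ 2 * (sin θ * cos θ) := by
      rw [abs_mul, abs_mul, abs_of_pos (pow_pos hc 2)]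
      calc _ ≤ cos θ ^ 2 * (C * sin θ * C) := by gcongr
        _ = C ^ 2 * (sin θ * cos θ) * cos θ := by ring
        _ ≤ C ^ 2 * (sin θ * cos θ) * 1 := by gcongr
        _ = _ := by ring
    have t2 : w ^ 2 ≤ C ^ 2 := sq_le_sq' (by linarith [(abs_le.1 b1).1]) (abs_le.1 b1).2
    have t3 : v ^ 2 ≤ C ^ 2 := sq_le_sq' (by linarith [(abs_le.1 b0').1]) (abs_le.1 b0').2
    have t2' := mul_le_mul_of_nonneg_left t2 hsc.le
    have t3' := mul_le_mul_of_nonneg_left t3 hsc.le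
    have t2'' : 0 ≤ sin θ * cos θ * w ^ 2 := by positivity
    have t3'' : 0 ≤ sin θ * cos θ * v ^ 2 := by positivity
    rw [abs_le] at t1 ⊢
    constructor <;> nlinarith
  · have i1 := h.integrableOn_angularOp_mul h.cont₂
    have i2 := integrableOn_of_continuousOn_Icc (h.cont₂.pow 2)
    have i5 := integrableOn_of_continuousOn_Icc (h.cont₀.mul h.cont₂)
    have i3 : IntegrableOn (fun θ => secDeriv ψ ψ₁ θ ^ 2) 𝕁 :=
      integrableOn_of_continuousOn_of_bound (C := C ^ 2) (h.continuousOn_secDeriv.pow 2)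
        fun θ hθ => by
          rw [abs_pow]
          exact pow_le_pow_left₀ (abs_nonneg _) (hb θ hθ).2.2.2 2
    have i4 : IntegrableOn (fun θ => (ψ θ / cos θ) ^ 2) 𝕁 :=
      integrableOn_of_continuousOn_of_bound (C := C ^ 2) (cv.pow 2) fun θ hθ => by
        rw [abs_pow]
        exact pow_le_pow_left₀ (abs_nonneg _)
          ((hv θ hθ).trans (mul_le_of_le_one_right hC (sin_le_one θ))) 2
    exact (((i1.neg.sub i2).sub (i3.const_mul _)).sub (i4.const_mul _)).sub (i5.const_mul _)

/-- `sin cos²` spans the kernel of the adjoint of the angular operator. -/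
lemma integral_angularOp_mul_kernel (h : AngularC2 ψ ψ₁ ψ₂) :
    ∫ θ in 𝕁, angularOp ψ ψ₁ ψ₂ θ * (sin θ * cos θ ^ 2) = 0 := by
  obtain ⟨C, hC, hb⟩ := h.exists_bound
  refine integral_eq_zero_of_deriv (C := 5 * C)
    (T := fun θ => -((cos θ * ψ₁ θ - sin θ * ψ θ) * (sin θ * cos θ))
      + cos θ * ψ θ * (cos θ ^ 2 - 2 * sin θ ^ 2)) ?_ ?_
    (h.integrableOn_angularOp_mul (by fun_prop))
  · intro θ hθ
    have hc := cos_pos_of_mem hθ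
    have d0 := h.deriv₀ θ hθ
    have d1 := h.deriv₁ θ hθ
    have dc := hasDerivAt_cos θ
    have ds := hasDerivAt_sin θ
    refine ((((dc.mul d1).sub (ds.mul d0)).mul (ds.mul dc)).neg.add
      ((dc.mul d0).mul ((dc.pow 2).sub ((ds.pow 2).const_mul 2)))).congr_deriv ?_
    simp only [angularOp, secDeriv, Pi.mul_apply, Pi.pow_apply, Pi.sub_apply]
    field_simp
    ring
  · intro θ hθ
    have hs := sin_pos_of_mem hθ
    have hc := cos_pos_of_mem hθ
    have hs1 := sin_le_one θ
    have hc1 := cos_le_one θ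
    have hsc : 0 < sin θ * cos θ := mul_pos hs hc
    obtain ⟨b0, b1, -, -⟩ := hb θ hθ
    have b0' : |ψ θ| ≤ C := b0.trans (mul_le_of_le_one_right hC (by nlinarith))
    have t1 : |cos θ * ψ₁ θ - sin θ * ψ θ| ≤ 2 * C := by
      refine (abs_sub _ _).trans ?_
      rw [abs_mul, abs_mul, abs_of_pos hs, abs_of_pos hc]
      nlinarith [abs_nonneg (ψ θ), abs_nonneg (ψ₁ θ)]
    have t2 : |cos θ * (cos θ ^ 2 - 2 * sin θ ^ 2)| ≤ 3 := by
      rw [abs_mul, abs_of_pos hc]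
      have : |cos θ ^ 2 - 2 * sin θ ^ 2| ≤ 3 := by
        rw [abs_le]; constructor <;> nlinarith
      nlinarith [abs_nonneg (cos θ ^ 2 - 2 * sin θ ^ 2)]
    calc _ ≤ |-((cos θ * ψ₁ θ - sin θ * ψ θ) * (sin θ * cos θ))|
          + |cos θ * ψ θ * (cos θ ^ 2 - 2 * sin θ ^ 2)| := abs_add_le _ _
      _ = |cos θ * ψ₁ θ - sin θ * ψ θ| * (sin θ * cos θ)
          + |ψ θ| * |cos θ * (cos θ ^ 2 - 2 * sin θ ^ 2)| := by
        rw [abs_neg, abs_mul, abs_of_pos hsc, ← abs_mul (ψ θ)]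
        ring_nf
      _ ≤ 2 * C * (sin θ * cos θ) + C * (sin θ * cos θ) * 3 := by gcongr
      _ = _ := by ring

end AngularC2

namespace AngularC2

variable {ψ ψ₁ ψ₂ : ℝ → ℝ}

/-- The primitive of `ψ sin cos²`, which vanishes at both endpoints under the orthogonality
condition. -/
lemma exists_primitive (h : AngularC2 ψ ψ₁ ψ₂)
    (horth : ∫ θ in 𝕁, ψ θ * (sin θ * cos θ ^ 2) = 0) :
    ∃ (W : ℝ → ℝ) (C : ℝ), 0 ≤ C ∧
      (∀ θ ∈ 𝕁, HasDerivAt W (ψ θ * (sin θ * cos θ ^ 2)) θ) ∧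
      ∀ θ ∈ 𝕁, |W θ| ≤ C * (sin θ ^ 3 * cos θ ^ 3) := by
  obtain ⟨C, hC, hb⟩ := h.exists_bound
  have hp : (0 : ℝ) ≤ π / 2 := by positivity
  have m0 : (0 : ℝ) ∈ Icc 0 (π / 2) := left_mem_Icc.2 hp
  have m1 : π / 2 ∈ Icc 0 (π / 2) := right_mem_Icc.2 hp
  set w : ℝ → ℝ := fun θ => ψ θ * (sin θ * cos θ ^ 2) with hw
  have cw : ContinuousOn w (Icc 0 (π / 2)) := h.cont₀.mul (by fun_prop)
  set W : ℝ → ℝ := fun θ => ∫ t in (0 : ℝ)..θ, w t with hW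
  have iw : IntegrableOn w (Icc 0 (π / 2)) := cw.integrableOn_Icc
  have W0 : W 0 = 0 := by simp [hW]
  have W1 : W (π / 2) = 0 := by
    simp only [hW]
    rw [intervalIntegral.integral_of_le hp, integral_Ioc_eq_integral_Ioo]
    exact horth
  have cW : ContinuousOn W (Icc 0 (π / 2)) := by
    have := intervalIntegral.continuousOn_primitive_interval (μ := volume) (f := w) (a := 0)
      (b := π / 2) (by rwa [uIcc_of_le hp])
    rwa [uIcc_of_le hp] at this
  have dW : ∀ θ ∈ 𝕁, HasDerivAt W (w θ) θ := by
    intro θ hθ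
    have hn : Icc 0 (π / 2) ∈ nhds θ := Icc_mem_nhds hθ.1 hθ.2
    refine intervalIntegral.integral_hasDerivAt_right ?_ ?_ (cw.continuousAt hn)
    · rw [intervalIntegrable_iff_integrableOn_Icc_of_le hθ.1.le]
      exact iw.mono_set (Icc_subset_Icc_right hθ.2.le)
    · exact (cw.mono Ioo_subset_Icc_self).stronglyMeasurableAtFilter isOpen_Ioo θ hθ
  have bw : ∀ θ ∈ 𝕁, |w θ| ≤ C * (sin θ ^ 2 * cos θ ^ 3) := by
    intro θ hθ
    have hs := sin_pos_of_mem hθ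
    have hc := cos_pos_of_mem hθ
    have hsc : 0 < sin θ * cos θ ^ 2 := by positivity
    simp only [hw]
    rw [abs_mul, abs_of_pos hsc]
    calc _ ≤ C * (sin θ * cos θ) * (sin θ * cos θ ^ 2) := by gcongr; exact (hb θ hθ).1
      _ = _ := by ring
  have b1 : ∀ θ ∈ 𝕁, |W θ| ≤ C * sin θ ^ 3 := by
    intro θ hθ
    have := abs_sub_le_of_deriv (k := fun t => C * sin t ^ 3)
      (k' := fun t => C * (3 * sin t ^ 2 * cos t)) cW (by fun_prop) dW
      (fun t _ => by
        refine (((hasDerivAt_sin t).pow 3).const_mul C).congr_deriv ?_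
        norm_num)
      (fun t ht => by
        have hs := sin_pos_of_mem ht
        have hc := cos_pos_of_mem ht
        have hc1 := cos_le_one t
        refine (bw t ht).trans ?_
        gcongr C * ?_
        calc sin t ^ 2 * cos t ^ 3 = sin t ^ 2 * cos t * cos t ^ 2 := by ring
          _ ≤ sin t ^ 2 * cos t * 3 := by gcongr; nlinarith
          _ = _ := by ring) m0 (Ioo_subset_Icc_self hθ) hθ.1.le
    simpa [W0] using this
  have b2 : ∀ θ ∈ 𝕁, |W θ| ≤ C * cos θ ^ 3 := by
    intro θ hθ
    have := abs_sub_le_of_deriv (k := fun t => -(C * cos t ^ 3))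
      (k' := fun t => C * (3 * cos t ^ 2 * sin t)) cW (by fun_prop) dW
      (fun t _ => by
        refine (((hasDerivAt_cos t).pow 3).const_mul C).neg.congr_deriv ?_
        norm_num)
      (fun t ht => by
        have hs := sin_pos_of_mem ht
        have hc := cos_pos_of_mem ht
        have hs1 := sin_le_one t
        have hc1 := cos_le_one t
        refine (bw t ht).trans ?_
        gcongr C * ?_
        calc sin t ^ 2 * cos t ^ 3 = cos t ^ 2 * sin t * (sin t * cos t) := by ring
          _ ≤ cos t ^ 2 * sin t * 3 := by gcongr; nlinarith
          _ = _ := by ring) (Ioo_subset_Icc_self hθ) m1 hθ.2.le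
    simpa [W1] using this
  refine ⟨W, 8 * C, by positivity, dW, fun θ hθ => ?_⟩
  have hs := sin_pos_of_mem hθ
  have hc := cos_pos_of_mem hθ
  have hs1 := sin_le_one θ
  have hc1 := cos_le_one θ
  have e : |W θ| = |W θ| * (sin θ ^ 2 + cos θ ^ 2) ^ 3 := by rw [sin_sq_add_cos_sq]; ring
  have s3 : sin θ ^ 3 ≤ 1 := pow_le_one₀ hs.le hs1
  have c3 : cos θ ^ 3 ≤ 1 := pow_le_one₀ hc.le hc1
  have f1 : |W θ| * sin θ ^ 3 ≤ C * (sin θ ^ 3 * cos θ ^ 3) := by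
    calc _ ≤ C * cos θ ^ 3 * sin θ ^ 3 := by gcongr; exact b2 θ hθ
      _ = _ := by ring
  have f2 : |W θ| * cos θ ^ 3 ≤ C * (sin θ ^ 3 * cos θ ^ 3) := by
    calc _ ≤ C * sin θ ^ 3 * cos θ ^ 3 := by gcongr; exact b1 θ hθ
      _ = _ := by ring
  have q : 0 ≤ C * (sin θ ^ 3 * cos θ ^ 3) := by positivity
  have g1 : |W θ| * sin θ ^ 3 * sin θ ^ 3 ≤ C * (sin θ ^ 3 * cos θ ^ 3) :=
    (mul_le_of_le_one_right (by positivity) s3).trans f1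
  have g2 : |W θ| * sin θ ^ 3 * (sin θ * cos θ ^ 2) ≤ C * (sin θ ^ 3 * cos θ ^ 3) :=
    (mul_le_of_le_one_right (by positivity) (by nlinarith)).trans f1
  have g3 : |W θ| * cos θ ^ 3 * (cos θ * sin θ ^ 2) ≤ C * (sin θ ^ 3 * cos θ ^ 3) :=
    (mul_le_of_le_one_right (by positivity) (by nlinarith)).trans f2
  have g4 : |W θ| * cos θ ^ 3 * cos θ ^ 3 ≤ C * (sin θ ^ 3 * cos θ ^ 3) :=
    (mul_le_of_le_one_right (by positivity) c3).trans f2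
  rw [e]
  linarith

/-- Spectral gap of the angular operator, in the weighted space in which it is symmetric. -/
lemma weighted_coercivity (h : AngularC2 ψ ψ₁ ψ₂)
    (horth : ∫ θ in 𝕁, ψ θ * (sin θ * cos θ ^ 2) = 0) :
    0 ≤ ∫ θ in 𝕁, (angularOp ψ ψ₁ ψ₂ θ * (cos θ * ψ θ) - 14 * (cos θ * ψ θ ^ 2)) := by
  obtain ⟨C, hC, hb⟩ := h.exists_bound
  obtain ⟨W, D, hD, dW, bW⟩ := h.exists_primitive horth
  refine integral_nonneg_of_deriv_le (C := 2 * C ^ 2 + 28 * (D * C) + 14 * (4 * D ^ 2))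
    (T := fun θ => -(cos θ * ψ θ * (ψ₁ θ - ψ θ * (cos θ ^ 2 - sin θ ^ 2) / (sin θ * cos θ)))
      - 28 * (W θ * (ψ θ / (sin θ * cos θ)))
      + 14 * ((3 * cos θ ^ 2 - 4 * sin θ ^ 2) * W θ ^ 2 / (sin θ ^ 3 * cos θ ^ 4)))
    (T' := fun θ => angularOp ψ ψ₁ ψ₂ θ * (cos θ * ψ θ) - 14 * (cos θ * ψ θ ^ 2)
      - (cos θ * (ψ₁ θ - ψ θ * (cos θ ^ 2 - sin θ ^ 2) / (sin θ * cos θ)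
          + 14 * W θ / (sin θ * cos θ ^ 2)) ^ 2
        + 14 / (sin θ ^ 2 * cos θ ^ 3) * (ψ θ * (sin θ * cos θ ^ 2)
          - (3 * cos θ / sin θ - 4 * sin θ / cos θ) * W θ) ^ 2)) ?_ ?_ ?_ ?_
  · intro θ hθ
    have hs := sin_pos_of_mem hθ
    have hc := cos_pos_of_mem hθ
    have hsn := hs.ne'
    have hcn := hc.ne'
    have d0 := h.deriv₀ θ hθ
    have d1 := h.deriv₁ θ hθ
    have dw := dW θ hθ
    have dc := hasDerivAt_cos θ
    have ds := hasDerivAt_sin θ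
    have t1 := ((dc.mul d0).mul (d1.sub ((d0.mul ((dc.pow 2).sub (ds.pow 2))).div (ds.mul dc)
      (mul_ne_zero hsn hcn)))).neg
    have t2 := (dw.mul (d0.div (ds.mul dc) (mul_ne_zero hsn hcn))).const_mul 28
    have t3 := (((((dc.pow 2).const_mul 3).sub ((ds.pow 2).const_mul 4)).mul (dw.pow 2)).div
      ((ds.pow 3).mul (dc.pow 4)) (mul_ne_zero (pow_ne_zero 3 hsn) (pow_ne_zero 4 hcn))).const_mul 14
    refine ((t1.sub t2).add t3).congr_deriv ?_
    simp only [angularOp, secDeriv, Pi.mul_apply, Pi.pow_apply, Pi.sub_apply, Pi.div_apply]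
    generalize sin θ = s at *
    generalize cos θ = c at *
    generalize W θ = w at *
    generalize ψ θ = x at *
    generalize ψ₁ θ = y at *
    generalize ψ₂ θ = z at *
    field_simp
    ring
  · intro θ hθ
    have hs := sin_pos_of_mem hθ
    have hc := cos_pos_of_mem hθ
    have hs1 := sin_le_one θ
    have hc1 := cos_le_one θ
    have hsc : 0 < sin θ * cos θ := mul_pos hs hc
    have hsc1 : sin θ * cos θ ≤ 1 := by nlinarith
    obtain ⟨b0, b1, -, -⟩ := hb θ hθ
    have bw := bW θ hθ
    have b0' : |ψ θ / (sin θ * cos θ)| ≤ C := by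
      rwa [abs_div, abs_of_pos hsc, div_le_iff₀ hsc]
    have cc : |cos θ ^ 2 - sin θ ^ 2| ≤ 1 := by
      rw [abs_le]; constructor <;> nlinarith
    have cc' : |3 * cos θ ^ 2 - 4 * sin θ ^ 2| ≤ 4 := by
      rw [abs_le]; constructor <;> nlinarith
    have t1 : |cos θ * ψ θ * (ψ₁ θ - ψ θ * (cos θ ^ 2 - sin θ ^ 2) / (sin θ * cos θ))|
        ≤ 2 * C ^ 2 * (sin θ * cos θ) := by
      have a1 : |cos θ * ψ θ| ≤ C * (sin θ * cos θ) := by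
        rw [abs_mul, abs_of_pos hc]
        nlinarith [abs_nonneg (ψ θ)]
      have a2 : |ψ₁ θ - ψ θ * (cos θ ^ 2 - sin θ ^ 2) / (sin θ * cos θ)| ≤ 2 * C := by
        refine (abs_sub _ _).trans ?_
        rw [mul_div_right_comm, abs_mul]
        nlinarith [abs_nonneg (ψ θ / (sin θ * cos θ))]
      rw [abs_mul]
      calc _ ≤ C * (sin θ * cos θ) * (2 * C) := by gcongr
        _ = _ := by ring
    have w1 : |W θ| ≤ D * (sin θ * cos θ) := by
      refine bw.trans ?_
      gcongr D * ?_
      calc sin θ ^ 3 * cos θ ^ 3 = sin θ * cos θ * (sin θ * cos θ) ^ 2 := by ring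
        _ ≤ sin θ * cos θ * 1 := by gcongr; exact pow_le_one₀ hsc.le hsc1
        _ = _ := mul_one _
    have t2 : |W θ * (ψ θ / (sin θ * cos θ))| ≤ D * C * (sin θ * cos θ) := by
      rw [abs_mul]
      calc _ ≤ D * (sin θ * cos θ) * C := by gcongr
        _ = _ := by ring
    have t3 : |(3 * cos θ ^ 2 - 4 * sin θ ^ 2) * W θ ^ 2 / (sin θ ^ 3 * cos θ ^ 4)|
        ≤ 4 * D ^ 2 * (sin θ * cos θ) := by
      have hq : 0 < sin θ ^ 3 * cos θ ^ 4 := by positivity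
      rw [abs_div, abs_of_pos hq, div_le_iff₀ hq, abs_mul, abs_pow]
      calc _ ≤ 4 * (D * (sin θ ^ 3 * cos θ ^ 3)) ^ 2 := by gcongr
        _ = 4 * D ^ 2 * (sin θ ^ 4 * cos θ ^ 5) * (sin θ ^ 2 * cos θ) := by ring
        _ ≤ 4 * D ^ 2 * (sin θ ^ 4 * cos θ ^ 5) * 1 := by gcongr; nlinarith
        _ = _ := by ring
    rw [abs_le] at t1 t2 t3 ⊢
    constructor <;> linarith [t1.1, t1.2, t2.1, t2.2, t3.1, t3.2]
  · intro θ hθ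
    have hs := sin_pos_of_mem hθ
    have hc := cos_pos_of_mem hθ
    have : 0 ≤ cos θ * (ψ₁ θ - ψ θ * (cos θ ^ 2 - sin θ ^ 2) / (sin θ * cos θ)
          + 14 * W θ / (sin θ * cos θ ^ 2)) ^ 2
        + 14 / (sin θ ^ 2 * cos θ ^ 3) * (ψ θ * (sin θ * cos θ ^ 2)
          - (3 * cos θ / sin θ - 4 * sin θ / cos θ) * W θ) ^ 2 := by positivity
    linarith
  · refine (h.integrableOn_angularOp_mul (continuous_cos.continuousOn.mul h.cont₀)).sub ?_
    exact (integrableOn_of_continuousOn_Icc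
      (continuous_cos.continuousOn.mul (h.cont₀.pow 2))).const_mul 14

end AngularC2

lemma integral_Ioi_deriv_eq_zero {f f' : ℝ → ℝ}
    (hd : ∀ R > 0, HasDerivAt f (f' R) R) (hf' : IntegrableOn f' (Ioi 0))
    (hf : IntegrableOn (fun R => f R / R) (Ioi 0)) : ∫ R in Ioi (0 : ℝ), f' R = 0 := by
  have im : exp '' univ = Ioi 0 := by rw [image_univ, range_exp]
  have de : ∀ x ∈ (univ : Set ℝ), HasDerivWithinAt exp (exp x) univ x :=
    fun x _ => (hasDerivAt_exp x).hasDerivWithinAt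
  have inj : InjOn exp univ := exp_injective.injOn
  rw [← im] at hf hf' ⊢
  rw [integrableOn_image_iff_integrableOn_abs_deriv_smul MeasurableSet.univ de inj,
    integrableOn_univ] at hf hf'
  rw [integral_image_eq_integral_abs_deriv_smul MeasurableSet.univ de inj, setIntegral_univ]
  simp only [smul_eq_mul, abs_exp] at hf hf' ⊢
  refine integral_eq_zero_of_hasDerivAt_of_integrable (f := fun s => f (exp s)) ?_ hf' ?_
  · intro s
    refine ((hd (exp s) (exp_pos s)).comp s (hasDerivAt_exp s)).congr_deriv ?_
    ring
  · refine hf.congr (Eventually.of_forall fun s => ?_)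
    simp only
    field_simp

lemma radial_moments {E E₁ E₂ : ℝ → ℝ} (h₁ : ∀ R > 0, HasDerivAt E (E₁ R) R)
    (h₂ : ∀ R > 0, HasDerivAt E₁ (E₂ R) R) (i₀ : IntegrableOn E (Ioi 0))
    (i₁ : IntegrableOn (fun R => R * E₁ R) (Ioi 0))
    (i₂ : IntegrableOn (fun R => R ^ 2 * E₂ R) (Ioi 0)) :
    ∫ R in Ioi (0 : ℝ), R * E₁ R = -∫ R in Ioi (0 : ℝ), E R ∧
      ∫ R in Ioi (0 : ℝ), R ^ 2 * E₂ R = 2 * ∫ R in Ioi (0 : ℝ), E R := by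
  have i₁' : IntegrableOn (fun R => 2 * (R * E₁ R)) (Ioi 0) := i₁.const_mul 2
  have a := integral_Ioi_deriv_eq_zero (f := fun R => R * E R) (f' := fun R => E R + R * E₁ R)
    (fun R hR => by
      refine ((hasDerivAt_id R).mul (h₁ R hR)).congr_deriv ?_
      simp)
    (i₀.add i₁) (i₀.congr_fun (fun R (hR : 0 < R) => by field_simp) measurableSet_Ioi)
  have b := integral_Ioi_deriv_eq_zero (f := fun R => R ^ 2 * E₁ R)
    (f' := fun R => 2 * (R * E₁ R) + R ^ 2 * E₂ R)
    (fun R hR => by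
      refine (((hasDerivAt_id R).pow 2).mul (h₂ R hR)).congr_deriv ?_
      simp
      ring)
    (i₁'.add i₂)
    (i₁.congr_fun (fun R (hR : 0 < R) => by field_simp) measurableSet_Ioi)
  rw [integral_add i₀ i₁] at a
  rw [integral_add i₁' i₂, integral_const_mul] at b
  constructor <;> linarith

/-- The closed strip on which the solution is `C²`. -/
local notation "𝕊" => (SProd.sprod (Ioi (0 : ℝ)) (Icc (0 : ℝ) (π / 2)) : Set (ℝ × ℝ))

lemma continuousOn_slice {k : ℝ → ℝ → ℝ} (hk : ContinuousOn (Function.uncurry k) 𝕊) {R : ℝ}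
    (hR : 0 < R) : ContinuousOn (k R) (Icc 0 (π / 2)) :=
  hk.comp (f := fun θ : ℝ => (R, θ)) (by fun_prop) fun _ hθ => ⟨hR, hθ⟩

lemma exists_local_bound {k : ℝ → ℝ → ℝ} (hk : ContinuousOn (Function.uncurry k) 𝕊) {R₀ : ℝ}
    (hR : 0 < R₀) : ∃ C, ∀ R ∈ Metric.ball R₀ (R₀ / 2), ∀ θ ∈ 𝕁, |k R θ| ≤ C := by
  obtain ⟨C, hC⟩ := (isCompact_Icc.prod isCompact_Icc).exists_bound_of_continuousOn
    (hk.mono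
      (Set.prod_mono_left fun R (h : R ∈ Icc (R₀ / 2) (2 * R₀)) => (half_pos hR).trans_le h.1))
  refine ⟨C, fun R h θ hθ => hC (R, θ) ⟨?_, Ioo_subset_Icc_self hθ⟩⟩
  rw [Real.ball_eq_Ioo] at h
  exact ⟨by linarith [h.1], by linarith [h.2]⟩

lemma hasDerivAt_integral_sub_mul {k kR j : ℝ → ℝ → ℝ}
    (hk : ContinuousOn (Function.uncurry k) 𝕊) (hkR : ContinuousOn (Function.uncurry kR) 𝕊)
    (hj : ContinuousOn (Function.uncurry j) 𝕊)
    (hd : ∀ R > 0, ∀ θ ∈ 𝕁, HasDerivAt (fun s => k s θ) (kR R θ) R) {R₀ : ℝ} (hR₀ : 0 < R₀) :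
    HasDerivAt (fun R => ∫ θ in 𝕁, (k R θ - k R₀ θ) * j R θ)
      (∫ θ in 𝕁, kR R₀ θ * j R₀ θ) R₀ := by
  obtain ⟨C, hC⟩ := exists_local_bound hkR hR₀
  obtain ⟨D, hD⟩ := exists_local_bound hj hR₀
  have hball : Metric.ball R₀ (R₀ / 2) ∈ nhdsWithin R₀ {R₀}ᶜ :=
    mem_nhdsWithin_of_mem_nhds (Metric.ball_mem_nhds _ (half_pos hR₀))
  have hpos : ∀ R ∈ Metric.ball R₀ (R₀ / 2), 0 < R := fun R h => by
    rw [Real.ball_eq_Ioo] at h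
    linarith [h.1]
  rw [hasDerivAt_iff_tendsto_slope]
  have e : slope (fun R => ∫ θ in 𝕁, (k R θ - k R₀ θ) * j R θ) R₀ =
      fun R => ∫ θ in 𝕁, (R - R₀)⁻¹ * (k R θ - k R₀ θ) * j R θ := by
    funext R
    rw [slope_def_field]
    simp only [sub_self, zero_mul, integral_zero, sub_zero, mul_assoc, integral_const_mul]
    rw [div_eq_inv_mul]
  rw [e]
  refine tendsto_integral_filter_of_dominated_convergence (fun _ => C * D) ?_ ?_ ?_ ?_
  · filter_upwards [hball] with R hR
    refine ContinuousOn.aestronglyMeasurable ?_ measurableSet_Ioo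
    have c1 := continuousOn_slice hk (hpos R hR)
    have c2 := continuousOn_slice hk hR₀
    have c3 := continuousOn_slice hj (hpos R hR)
    exact ((continuousOn_const.mul (c1.sub c2)).mul c3).mono Ioo_subset_Icc_self
  · filter_upwards [hball, self_mem_nhdsWithin] with R hR hne
    refine (ae_restrict_iff' measurableSet_Ioo).2 (Eventually.of_forall fun θ hθ => ?_)
    have hne' : R - R₀ ≠ 0 := sub_ne_zero.2 hne
    have mv := (convex_ball R₀ (R₀ / 2)).norm_image_sub_le_of_norm_hasDerivWithin_le
      (f := fun s => k s θ) (f' := fun s => kR s θ) (C := C)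
      (fun s hs => (hd s (hpos s hs) θ hθ).hasDerivWithinAt) (fun s hs => hC s hs θ hθ)
      (Metric.mem_ball_self (half_pos hR₀)) hR
    rw [Real.norm_eq_abs, Real.norm_eq_abs] at mv
    rw [Real.norm_eq_abs, abs_mul]
    refine mul_le_mul ?_ (hD R hR θ hθ) (abs_nonneg _)
      ((abs_nonneg _).trans (hC R hR θ hθ))
    rw [abs_mul, abs_inv, inv_mul_le_iff₀ (abs_pos.2 hne'), mul_comm]
    exact mv
  · exact integrable_const _
  · refine (ae_restrict_iff' measurableSet_Ioo).2 (Eventually.of_forall fun θ hθ => ?_)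
    have s := (hasDerivAt_iff_tendsto_slope.1 (hd R₀ hR₀ θ hθ))
    have cj : Tendsto (fun R => j R θ) (nhdsWithin R₀ {R₀}ᶜ) (nhds (j R₀ θ)) := by
      have : ContinuousOn (fun R => j R θ) (Ioi 0) :=
        hj.comp (f := fun R : ℝ => (R, θ)) (by fun_prop) fun R hR => ⟨hR, Ioo_subset_Icc_self hθ⟩
      exact (this.continuousAt (Ioi_mem_nhds hR₀)).tendsto.mono_left nhdsWithin_le_nhds
    refine (s.mul cj).congr fun R => ?_
    rw [slope_def_field, div_eq_inv_mul]

lemma hasDerivAt_integral {k kR : ℝ → ℝ → ℝ}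
    (hk : ContinuousOn (Function.uncurry k) 𝕊) (hkR : ContinuousOn (Function.uncurry kR) 𝕊)
    (hd : ∀ R > 0, ∀ θ ∈ 𝕁, HasDerivAt (fun s => k s θ) (kR R θ) R) {R₀ : ℝ} (hR₀ : 0 < R₀) :
    HasDerivAt (fun R => ∫ θ in 𝕁, k R θ) (∫ θ in 𝕁, kR R₀ θ) R₀ := by
  have := hasDerivAt_integral_sub_mul (j := fun _ _ => 1) hk hkR
    (by simpa [Function.uncurry_def] using continuousOn_const) hd hR₀
  simp only [mul_one] at this
  refine (this.add_const (∫ θ in 𝕁, k R₀ θ)).congr_of_eventuallyEq ?_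
  filter_upwards [Ioi_mem_nhds hR₀] with R hR
  rw [integral_sub (integrableOn_of_continuousOn_Icc (continuousOn_slice hk hR))
    (integrableOn_of_continuousOn_Icc (continuousOn_slice hk hR₀))]
  ring

/-- Lebesgue measure on the open strip. -/
local notation "ρ" => (Measure.restrict volume (SProd.sprod (Ioi (0 : ℝ)) 𝕁) : Measure (ℝ × ℝ))

lemma strip_measure_eq_prod :
    ρ = (volume.restrict (Ioi (0 : ℝ))).prod (volume.restrict 𝕁) := by
  rw [Measure.prod_restrict]
  rfl

lemma integral_strip {k : ℝ × ℝ → ℝ} (hk : Integrable k ρ) :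
    ∫ p, k p ∂ρ = ∫ R in Ioi (0 : ℝ), ∫ θ in 𝕁, k (R, θ) := by
  rw [strip_measure_eq_prod] at hk ⊢
  exact integral_prod _ hk

lemma integrable_slice_integral {k : ℝ × ℝ → ℝ} (hk : Integrable k ρ) :
    IntegrableOn (fun R => ∫ θ in 𝕁, k (R, θ)) (Ioi 0) := by
  rw [strip_measure_eq_prod] at hk
  exact hk.integral_prod_left

lemma sq_integral_le {g : ℝ → ℝ} (hg : ContinuousOn g (Icc 0 (π / 2))) :
    (∫ θ in 𝕁, g θ) ^ 2 ≤ 2 * ∫ θ in 𝕁, g θ ^ 2 := by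
  have i₁ : IntegrableOn g 𝕁 := integrableOn_of_continuousOn_Icc hg
  have i₂ : IntegrableOn (fun θ => g θ ^ 2) 𝕁 := integrableOn_of_continuousOn_Icc (hg.pow 2)
  set m := ∫ θ in 𝕁, g θ
  have h : 0 ≤ ∫ θ in 𝕁, (g θ - m / 2) ^ 2 := integral_nonneg fun _ => sq_nonneg _
  have e : ∀ θ, (g θ - m / 2) ^ 2 = g θ ^ 2 - m * g θ + m ^ 2 / 4 := fun θ => by ring
  simp only [e] at h
  have i₃ : IntegrableOn (fun θ => m * g θ) 𝕁 := i₁.const_mul m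
  have i₄ : IntegrableOn (fun _ => m ^ 2 / 4) 𝕁 := integrable_const _
  have i₅ : IntegrableOn (fun θ => g θ ^ 2 - m * g θ) 𝕁 := i₂.sub i₃
  rw [integral_add i₅ i₄, integral_sub i₂ i₃, integral_const_mul, setIntegral_const] at h
  simp only [volume_real_Ioo_of_le (by positivity : (0 : ℝ) ≤ π / 2), smul_eq_mul] at h
  have : π ≤ 4 := pi_le_four
  have hm : (π / 2 - 0) * (m ^ 2 / 4) ≤ m ^ 2 / 2 := by nlinarith [sq_nonneg m]
  change 0 ≤ _ - m * m + _ at h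
  nlinarith

/-- A function of class `C²` on the strip together with its partial derivatives, extended
continuously to the boundary, and satisfying Dirichlet conditions. -/
structure RegularPartials (f fR fT fRR fTR fTT : ℝ → ℝ → ℝ) : Prop where
  c : ContinuousOn (Function.uncurry f) 𝕊
  cR : ContinuousOn (Function.uncurry fR) 𝕊
  cT : ContinuousOn (Function.uncurry fT) 𝕊
  cRR : ContinuousOn (Function.uncurry fRR) 𝕊
  cTR : ContinuousOn (Function.uncurry fTR) 𝕊
  cTT : ContinuousOn (Function.uncurry fTT) 𝕊
  dR : ∀ R > 0, ∀ θ ∈ 𝕁, HasDerivAt (fun s => f s θ) (fR R θ) R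
  dT : ∀ R > 0, ∀ θ ∈ 𝕁, HasDerivAt (fun t => f R t) (fT R θ) θ
  dRR : ∀ R > 0, ∀ θ ∈ 𝕁, HasDerivAt (fun s => fR s θ) (fRR R θ) R
  dTR : ∀ R > 0, ∀ θ ∈ 𝕁, HasDerivAt (fun s => fT s θ) (fTR R θ) R
  dTT : ∀ R > 0, ∀ θ ∈ 𝕁, HasDerivAt (fun t => fT R t) (fTT R θ) θ
  left : ∀ R, f R 0 = 0
  right : ∀ R, f R (π / 2) = 0

/-- Square integrability of the derivatives entering the elliptic operator. -/
structure SquareIntegrable (f fR fT fRR fTR fTT : ℝ → ℝ → ℝ) : Prop where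
  m : MemLp (fun p : ℝ × ℝ => f p.1 p.2) 2 ρ
  mT : MemLp (fun p : ℝ × ℝ => fT p.1 p.2) 2 ρ
  mTT : MemLp (fun p : ℝ × ℝ => fTT p.1 p.2) 2 ρ
  mR : MemLp (fun p : ℝ × ℝ => p.1 * fR p.1 p.2) 2 ρ
  mTR : MemLp (fun p : ℝ × ℝ => p.1 * fTR p.1 p.2) 2 ρ
  mRR : MemLp (fun p : ℝ × ℝ => p.1 ^ 2 * fRR p.1 p.2) 2 ρ

/-- The operator `α² R² ∂_RR + α (5 + α) R ∂_R`. -/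
def radialOp (α : ℝ) (fR fRR : ℝ → ℝ → ℝ) (R θ : ℝ) : ℝ :=
  α ^ 2 * (R ^ 2 * fRR R θ) + α * (5 + α) * (R * fR R θ)

lemma ContinuousOn.mul_cos {k : ℝ → ℝ → ℝ} (hk : ContinuousOn (Function.uncurry k) 𝕊) :
    ContinuousOn (Function.uncurry fun R θ => cos θ * k R θ) 𝕊 := by
  have : Continuous fun p : ℝ × ℝ => cos p.2 := by fun_prop
  exact this.continuousOn.mul hk

lemma continuousOn_sq {k : ℝ → ℝ → ℝ} (hk : ContinuousOn (Function.uncurry k) 𝕊) :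
    ContinuousOn (Function.uncurry fun R θ => k R θ ^ 2) 𝕊 :=
  (hk.mul hk).congr fun p _ => sq (k p.1 p.2)

lemma MeasureTheory.MemLp.cos_mul {k : ℝ × ℝ → ℝ} (hk : MemLp k 2 ρ) :
    MemLp (fun p : ℝ × ℝ => cos p.2 * k p) 2 ρ := by
  have : Continuous fun p : ℝ × ℝ => cos p.2 := by fun_prop
  refine hk.mono (this.aestronglyMeasurable.mul hk.1) (Eventually.of_forall fun p => ?_)
  rw [norm_mul]
  exact mul_le_of_le_one_left (norm_nonneg _) (abs_cos_le_one _)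

lemma radialOp_memLp {f fR fT fRR fTR fTT : ℝ → ℝ → ℝ} (α : ℝ)
    (hm : SquareIntegrable f fR fT fRR fTR fTT) :
    MemLp (fun p : ℝ × ℝ => radialOp α fR fRR p.1 p.2) 2 ρ :=
  (hm.mRR.const_mul _).add (hm.mR.const_mul _)

namespace RegularPartials

variable {f fR fT fRR fTR fTT : ℝ → ℝ → ℝ}

lemma angular (h : RegularPartials f fR fT fRR fTR fTT) {R : ℝ} (hR : 0 < R) :
    AngularC2 (f R) (fT R) (fTT R) where
  cont₀ := continuousOn_slice h.c hR
  cont₁ := continuousOn_slice h.cT hR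
  cont₂ := continuousOn_slice h.cTT hR
  deriv₀ := h.dT R hR
  deriv₁ := h.dTT R hR
  left := h.left R
  right := h.right R

lemma integral_mixed (h : RegularPartials f fR fT fRR fTR fTT) {R S : ℝ} (hR : 0 < R)
    (hS : 0 < S) : ∫ θ in 𝕁, fTR R θ * fT S θ = -∫ θ in 𝕁, fR R θ * fTT S θ := by
  have hc : ∀ {g : ℝ → ℝ}, ContinuousOn g (Icc 0 (π / 2)) →
      ContinuousOn (fun p : ℝ × ℝ => g p.2) 𝕊 := fun hg =>
    hg.comp (f := Prod.snd) (by fun_prop) fun _ hp => hp.2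
  have c₁ := hc (continuousOn_slice h.cT hS)
  have c₂ := hc (continuousOn_slice h.cTT hS)
  have d₁ := hasDerivAt_integral (k := fun R θ => fT R θ * fT S θ)
    (kR := fun R θ => fTR R θ * fT S θ) (h.cT.mul c₁) (h.cTR.mul c₁)
    (fun r hr θ hθ => (h.dTR r hr θ hθ).mul_const _) hR
  have d₂ := hasDerivAt_integral (k := fun R θ => f R θ * fTT S θ)
    (kR := fun R θ => fR R θ * fTT S θ) (h.c.mul c₂) (h.cR.mul c₂)
    (fun r hr θ hθ => (h.dR r hr θ hθ).mul_const _) hR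
  refine d₁.unique (d₂.neg.congr_of_eventuallyEq ?_)
  filter_upwards [Ioi_mem_nhds hR] with r hr
  exact (h.angular hr).integral_deriv_mul_deriv (h.angular hS)

lemma hasDerivAt_integral_mixed (h : RegularPartials f fR fT fRR fTR fTT) {R₀ : ℝ}
    (hR₀ : 0 < R₀) : HasDerivAt (fun R => ∫ θ in 𝕁, fTR R θ * fT R θ)
      ((∫ θ in 𝕁, fTR R₀ θ ^ 2) - ∫ θ in 𝕁, fRR R₀ θ * fTT R₀ θ) R₀ := by
  have c₁ : ContinuousOn (fun p : ℝ × ℝ => fTR R₀ p.2) 𝕊 :=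
    (continuousOn_slice h.cTR hR₀).comp (f := Prod.snd) (by fun_prop) fun _ hp => hp.2
  have d₁ := hasDerivAt_integral (k := fun R θ => fTR R₀ θ * fT R θ)
    (kR := fun R θ => fTR R₀ θ * fTR R θ) (c₁.mul h.cT) (c₁.mul h.cTR)
    (fun r hr θ hθ => (h.dTR r hr θ hθ).const_mul _) hR₀
  have d₂ := hasDerivAt_integral_sub_mul h.cR h.cRR h.cTT h.dRR hR₀
  have e : ∫ θ in 𝕁, fTR R₀ θ ^ 2 = ∫ θ in 𝕁, fTR R₀ θ * fTR R₀ θ := by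
    simp only [sq]
  rw [e]
  refine (d₁.sub d₂).congr_of_eventuallyEq ?_
  filter_upwards [Ioi_mem_nhds hR₀] with r hr
  have hr : 0 < r := hr
  have i : ∀ {s t : ℝ}, 0 < s → 0 < t → IntegrableOn (fun θ => fR s θ * fTT t θ) 𝕁 :=
    fun hs ht => integrableOn_of_continuousOn_Icc
      ((continuousOn_slice h.cR hs).mul (continuousOn_slice h.cTT ht))
  simp only [Pi.sub_apply, sub_mul]
  rw [integral_sub (i hr hr) (i hR₀ hr), h.integral_mixed hR₀ hr, h.integral_mixed hr hr]
  ring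

lemma radial_energy_secondDeriv (h : RegularPartials f fR fT fRR fTR fTT)
    (hm : SquareIntegrable f fR fT fRR fTR fTT) {α : ℝ} (hα : α ∈ Ioc (0 : ℝ) 1) :
    0 ≤ ∫ p, radialOp α fR fRR p.1 p.2 * fTT p.1 p.2 ∂ρ := by
  have ia : Integrable (fun p : ℝ × ℝ => fT p.1 p.2 ^ 2) ρ := hm.mT.integrable_sq
  have ib : Integrable (fun p : ℝ × ℝ => (p.1 * fTR p.1 p.2) * fT p.1 p.2) ρ :=
    hm.mTR.integrable_mul hm.mT
  have ic : Integrable (fun p : ℝ × ℝ => (p.1 * fTR p.1 p.2) ^ 2) ρ := hm.mTR.integrable_sq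
  have id : Integrable (fun p : ℝ × ℝ => (p.1 ^ 2 * fRR p.1 p.2) * fTT p.1 p.2) ρ :=
    hm.mRR.integrable_mul hm.mTT
  have ie : Integrable (fun p : ℝ × ℝ => (p.1 * fR p.1 p.2) * fTT p.1 p.2) ρ :=
    hm.mR.integrable_mul hm.mTT
  have sa := integral_strip ia
  have sb := integral_strip ib
  have sc := integral_strip ic
  have sd := integral_strip id
  have se := integral_strip ie
  have jb := integrable_slice_integral ib
  have jc := integrable_slice_integral ic
  have jd := integrable_slice_integral id
  have eb : ∀ R, ∫ θ in 𝕁, (R * fTR R θ) * fT R θ = R * ∫ θ in 𝕁, fTR R θ * fT R θ := by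
    intro R
    simp only [mul_assoc, integral_const_mul]
  have ec : ∀ R, ∫ θ in 𝕁, (R * fTR R θ) ^ 2 = R ^ 2 * ∫ θ in 𝕁, fTR R θ ^ 2 := by
    intro R
    simp only [mul_pow, integral_const_mul]
  have ed : ∀ R, ∫ θ in 𝕁, (R ^ 2 * fRR R θ) * fTT R θ
      = R ^ 2 * ∫ θ in 𝕁, fRR R θ * fTT R θ := by
    intro R
    simp only [mul_assoc, integral_const_mul]
  have ee : ∀ R, ∫ θ in 𝕁, (R * fR R θ) * fTT R θ = R * ∫ θ in 𝕁, fR R θ * fTT R θ := by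
    intro R
    simp only [mul_assoc, integral_const_mul]
  simp only [eb, ec, ed, ee] at sb sc sd se jb jc jd
  have hbe : ∫ R in Ioi (0 : ℝ), R * ∫ θ in 𝕁, fTR R θ * fT R θ
      = -∫ R in Ioi (0 : ℝ), R * ∫ θ in 𝕁, fR R θ * fTT R θ := by
    rw [← integral_neg]
    refine setIntegral_congr_fun measurableSet_Ioi fun R hR => ?_
    rw [h.integral_mixed hR hR]
    ring
  have mom := radial_moments (E := fun R => ∫ θ in 𝕁, fT R θ ^ 2)
    (E₁ := fun R => 2 * ∫ θ in 𝕁, fTR R θ * fT R θ)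
    (E₂ := fun R => 2 * ((∫ θ in 𝕁, fTR R θ ^ 2) - ∫ θ in 𝕁, fRR R θ * fTT R θ))
    (fun R hR => by
      have := hasDerivAt_integral (k := fun R θ => fT R θ ^ 2)
        (kR := fun R θ => 2 * (fTR R θ * fT R θ)) (continuousOn_sq h.cT)
        ((h.cTR.mul h.cT).const_smul (2 : ℝ))
        (fun r hr θ hθ => by
          refine ((h.dTR r hr θ hθ).pow 2).congr_deriv ?_
          norm_num
          ring) hR
      simpa only [integral_const_mul] using this)
    (fun R hR => (h.hasDerivAt_integral_mixed hR).const_mul 2)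
    (integrable_slice_integral ia)
    ((jb.const_mul 2).congr (Eventually.of_forall fun R => by simp only; ring))
    (((jc.sub jd).const_mul 2).congr
      (Eventually.of_forall fun R => by simp only [Pi.sub_apply]; ring))
  obtain ⟨mom₁, mom₂⟩ := mom
  have r₁ : ∀ R : ℝ, R * (2 * ∫ θ in 𝕁, fTR R θ * fT R θ)
      = 2 * (R * ∫ θ in 𝕁, fTR R θ * fT R θ) := fun R => by ring
  have r₂ : ∀ R : ℝ, R ^ 2 * (2 * ((∫ θ in 𝕁, fTR R θ ^ 2) - ∫ θ in 𝕁, fRR R θ * fTT R θ))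
      = 2 * (R ^ 2 * (∫ θ in 𝕁, fTR R θ ^ 2) - R ^ 2 * ∫ θ in 𝕁, fRR R θ * fTT R θ) :=
    fun R => by ring
  simp only [r₁, r₂] at mom₁ mom₂
  rw [integral_const_mul, hbe, ← se, ← sa] at mom₁
  rw [integral_const_mul, integral_sub jc jd, ← sc, ← sd, ← sa] at mom₂
  have split : ∫ p, radialOp α fR fRR p.1 p.2 * fTT p.1 p.2 ∂ρ
      = α ^ 2 * ∫ p, (p.1 ^ 2 * fRR p.1 p.2) * fTT p.1 p.2 ∂ρ
        + α * (5 + α) * ∫ p, (p.1 * fR p.1 p.2) * fTT p.1 p.2 ∂ρ := by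
    rw [← integral_const_mul, ← integral_const_mul,
      ← integral_add (id.const_mul _) (ie.const_mul _)]
    congr 1
    funext p
    simp only [radialOp]
    ring
  have na : 0 ≤ ∫ p : ℝ × ℝ, fT p.1 p.2 ^ 2 ∂ρ := integral_nonneg fun _ => sq_nonneg _
  have nc : 0 ≤ ∫ p : ℝ × ℝ, (p.1 * fTR p.1 p.2) ^ 2 ∂ρ := integral_nonneg fun _ => sq_nonneg _
  rw [split]
  generalize (∫ p : ℝ × ℝ, fT p.1 p.2 ^ 2 ∂ρ) = a at *
  generalize (∫ p : ℝ × ℝ, (p.1 * fTR p.1 p.2) ^ 2 ∂ρ) = c at *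
  generalize (∫ p : ℝ × ℝ, (p.1 ^ 2 * fRR p.1 p.2) * fTT p.1 p.2 ∂ρ) = d at *
  generalize (∫ p : ℝ × ℝ, (p.1 * fR p.1 p.2) * fTT p.1 p.2 ∂ρ) = e at *
  obtain ⟨h0, h1⟩ := hα
  have he : e = a / 2 := by linarith
  have hd : d = c - a := by linarith
  rw [he, hd]
  have : 0 ≤ α ^ 2 * c + α * (5 - α) / 2 * a := by
    have : 0 ≤ 5 - α := by linarith
    positivity
  linarith

end RegularPartials

namespace RegularPartials

variable {f fR fT fRR fTR fTT : ℝ → ℝ → ℝ}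

lemma radial_energy_weighted (h : RegularPartials f fR fT fRR fTR fTT)
    (hm : SquareIntegrable f fR fT fRR fTR fTT) {α : ℝ} (hα : α ∈ Ioc (0 : ℝ) 1) :
    ∫ p, radialOp α fR fRR p.1 p.2 * (cos p.2 * f p.1 p.2) ∂ρ ≤ 0 := by
  have ia : Integrable (fun p : ℝ × ℝ => (cos p.2 * f p.1 p.2) * f p.1 p.2) ρ :=
    hm.m.cos_mul.integrable_mul hm.m
  have ic : Integrable (fun p : ℝ × ℝ => (cos p.2 * (p.1 * fR p.1 p.2)) * (p.1 * fR p.1 p.2)) ρ :=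
    hm.mR.cos_mul.integrable_mul hm.mR
  have id : Integrable (fun p : ℝ × ℝ => (p.1 ^ 2 * fRR p.1 p.2) * (cos p.2 * f p.1 p.2)) ρ :=
    hm.mRR.integrable_mul hm.m.cos_mul
  have ie : Integrable (fun p : ℝ × ℝ => (p.1 * fR p.1 p.2) * (cos p.2 * f p.1 p.2)) ρ :=
    hm.mR.integrable_mul hm.m.cos_mul
  have sa := integral_strip ia
  have sc := integral_strip ic
  have sd := integral_strip id
  have se := integral_strip ie
  have jc := integrable_slice_integral ic
  have jd := integrable_slice_integral id
  have je := integrable_slice_integral ie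
  have ec : ∀ R, ∫ θ in 𝕁, (cos θ * (R * fR R θ)) * (R * fR R θ)
      = R ^ 2 * ∫ θ in 𝕁, (cos θ * fR R θ) * fR R θ := by
    intro R
    rw [← integral_const_mul]
    congr 1
    funext θ
    ring
  have ed : ∀ R, ∫ θ in 𝕁, (R ^ 2 * fRR R θ) * (cos θ * f R θ)
      = R ^ 2 * ∫ θ in 𝕁, fRR R θ * (cos θ * f R θ) := by
    intro R
    simp only [mul_assoc, integral_const_mul]
  have ee : ∀ R, ∫ θ in 𝕁, (R * fR R θ) * (cos θ * f R θ)
      = R * ∫ θ in 𝕁, fR R θ * (cos θ * f R θ) := by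
    intro R
    simp only [mul_assoc, integral_const_mul]
  simp only [ec, ed, ee] at sc sd se jc jd je
  have cf := h.c.mul_cos
  have mom := radial_moments (E := fun R => ∫ θ in 𝕁, (cos θ * f R θ) * f R θ)
    (E₁ := fun R => 2 * ∫ θ in 𝕁, fR R θ * (cos θ * f R θ))
    (E₂ := fun R => 2 * ((∫ θ in 𝕁, fRR R θ * (cos θ * f R θ))
      + ∫ θ in 𝕁, (cos θ * fR R θ) * fR R θ))
    (fun R hR => by
      have := hasDerivAt_integral (k := fun R θ => (cos θ * f R θ) * f R θ)
        (kR := fun R θ => 2 * (fR R θ * (cos θ * f R θ))) (cf.mul h.c)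
        ((h.cR.mul cf).const_smul (2 : ℝ))
        (fun r hr θ hθ => by
          refine (((h.dR r hr θ hθ).const_mul (cos θ)).mul (h.dR r hr θ hθ)).congr_deriv ?_
          ring) hR
      simpa only [integral_const_mul] using this)
    (fun R hR => by
      have := (hasDerivAt_integral (k := fun R θ => fR R θ * (cos θ * f R θ))
        (kR := fun R θ => fRR R θ * (cos θ * f R θ) + (cos θ * fR R θ) * fR R θ) (h.cR.mul cf)
        ((h.cRR.mul cf).add (h.cR.mul_cos.mul h.cR))
        (fun r hr θ hθ => by
          refine ((h.dRR r hr θ hθ).mul ((h.dR r hr θ hθ).const_mul (cos θ))).congr_deriv ?_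
          ring) hR).const_mul 2
      have i₁ : IntegrableOn (fun θ => fRR R θ * (cos θ * f R θ)) 𝕁 :=
        integrableOn_of_continuousOn_Icc
          ((continuousOn_slice h.cRR hR).mul (continuousOn_slice cf hR))
      have i₂ : IntegrableOn (fun θ => (cos θ * fR R θ) * fR R θ) 𝕁 :=
        integrableOn_of_continuousOn_Icc
          ((continuousOn_slice h.cR.mul_cos hR).mul (continuousOn_slice h.cR hR))
      rwa [integral_add i₁ i₂] at this)
    (integrable_slice_integral ia)
    ((je.const_mul 2).congr (Eventually.of_forall fun R => by simp only; ring))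
    (((jd.add jc).const_mul 2).congr
      (Eventually.of_forall fun R => by simp only [Pi.add_apply]; ring))
  obtain ⟨mom₁, mom₂⟩ := mom
  have r₁ : ∀ R : ℝ, R * (2 * ∫ θ in 𝕁, fR R θ * (cos θ * f R θ))
      = 2 * (R * ∫ θ in 𝕁, fR R θ * (cos θ * f R θ)) := fun R => by ring
  have r₂ : ∀ R : ℝ, R ^ 2 * (2 * ((∫ θ in 𝕁, fRR R θ * (cos θ * f R θ))
        + ∫ θ in 𝕁, (cos θ * fR R θ) * fR R θ))
      = 2 * (R ^ 2 * (∫ θ in 𝕁, fRR R θ * (cos θ * f R θ))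
        + R ^ 2 * ∫ θ in 𝕁, (cos θ * fR R θ) * fR R θ) :=
    fun R => by ring
  simp only [r₁, r₂] at mom₁ mom₂
  rw [integral_const_mul, ← se, ← sa] at mom₁
  rw [integral_const_mul, integral_add jd jc, ← sc, ← sd, ← sa] at mom₂
  have split : ∫ p, radialOp α fR fRR p.1 p.2 * (cos p.2 * f p.1 p.2) ∂ρ
      = α ^ 2 * ∫ p, (p.1 ^ 2 * fRR p.1 p.2) * (cos p.2 * f p.1 p.2) ∂ρ
        + α * (5 + α) * ∫ p, (p.1 * fR p.1 p.2) * (cos p.2 * f p.1 p.2) ∂ρ := by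
    rw [← integral_const_mul, ← integral_const_mul,
      ← integral_add (id.const_mul _) (ie.const_mul _)]
    congr 1
    funext p
    simp only [radialOp]
    ring
  have hcos : ∀ᵐ p : ℝ × ℝ ∂ρ, 0 ≤ cos p.2 :=
    (ae_restrict_iff' (measurableSet_Ioi.prod measurableSet_Ioo)).2
      (Eventually.of_forall fun p hp => (cos_pos_of_mem hp.2).le)
  have na : 0 ≤ ∫ p : ℝ × ℝ, (cos p.2 * f p.1 p.2) * f p.1 p.2 ∂ρ := by
    refine integral_nonneg_of_ae (hcos.mono fun p hp => ?_)
    simp only [Pi.zero_apply, mul_assoc]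
    exact mul_nonneg hp (mul_self_nonneg _)
  have nc : 0 ≤ ∫ p : ℝ × ℝ, (cos p.2 * (p.1 * fR p.1 p.2)) * (p.1 * fR p.1 p.2) ∂ρ := by
    refine integral_nonneg_of_ae (hcos.mono fun p hp => ?_)
    simp only [Pi.zero_apply, mul_assoc]
    exact mul_nonneg hp ((mul_self_nonneg (p.1 * fR p.1 p.2)).trans_eq (by ring))
  rw [split]
  generalize (∫ p : ℝ × ℝ, (cos p.2 * f p.1 p.2) * f p.1 p.2 ∂ρ) = a at *
  generalize (∫ p : ℝ × ℝ, (cos p.2 * (p.1 * fR p.1 p.2)) * (p.1 * fR p.1 p.2) ∂ρ) = c at *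
  generalize (∫ p : ℝ × ℝ, (p.1 ^ 2 * fRR p.1 p.2) * (cos p.2 * f p.1 p.2) ∂ρ) = d at *
  generalize (∫ p : ℝ × ℝ, (p.1 * fR p.1 p.2) * (cos p.2 * f p.1 p.2) ∂ρ) = e at *
  obtain ⟨h0, h1⟩ := hα
  have he : e = -(a / 2) := by linarith
  have hd : d = a - c := by linarith
  rw [he, hd]
  have : 0 ≤ α ^ 2 * c + α * (5 - α) / 2 * a := by
    have : 0 ≤ 5 - α := by linarith
    positivity
  linarith

/-- The radial operator controls its second order part. -/
lemma integral_radial_second_le (h : RegularPartials f fR fT fRR fTR fTT)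
    (hm : SquareIntegrable f fR fT fRR fTR fTT) {α : ℝ} (hα : α ∈ Ioc (0 : ℝ) 1) :
    α ^ 4 * ∫ p, (p.1 ^ 2 * fRR p.1 p.2) ^ 2 ∂ρ ≤ ∫ p, radialOp α fR fRR p.1 p.2 ^ 2 ∂ρ := by
  have ix : Integrable (fun p : ℝ × ℝ => (p.1 ^ 2 * fRR p.1 p.2) ^ 2) ρ := hm.mRR.integrable_sq
  have iy : Integrable (fun p : ℝ × ℝ => (p.1 ^ 2 * fRR p.1 p.2) * (p.1 * fR p.1 p.2)) ρ :=
    hm.mRR.integrable_mul hm.mR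
  have iz : Integrable (fun p : ℝ × ℝ => (p.1 * fR p.1 p.2) ^ 2) ρ := hm.mR.integrable_sq
  have sy := integral_strip iy
  have sz := integral_strip iz
  have jy := integrable_slice_integral iy
  have jz := integrable_slice_integral iz
  have ey : ∀ R, ∫ θ in 𝕁, (R ^ 2 * fRR R θ) * (R * fR R θ)
      = R ^ 3 * ∫ θ in 𝕁, fRR R θ * fR R θ := by
    intro R
    rw [← integral_const_mul]
    congr 1
    funext θ
    ring
  have ez : ∀ R, ∫ θ in 𝕁, (R * fR R θ) ^ 2 = R ^ 2 * ∫ θ in 𝕁, fR R θ ^ 2 := by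
    intro R
    simp only [mul_pow, integral_const_mul]
  simp only [ey, ez] at sy sz jy jz
  have jz' := jz.const_mul 3
  have jy' := jy.const_mul 2
  have jzy : IntegrableOn (fun R => 3 * (R ^ 2 * ∫ θ in 𝕁, fR R θ ^ 2)
      + 2 * (R ^ 3 * ∫ θ in 𝕁, fRR R θ * fR R θ)) (Ioi 0) := jz'.add jy'
  have mom := integral_Ioi_deriv_eq_zero (f := fun R => R ^ 3 * ∫ θ in 𝕁, fR R θ ^ 2)
    (f' := fun R => 3 * (R ^ 2 * ∫ θ in 𝕁, fR R θ ^ 2)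
      + 2 * (R ^ 3 * ∫ θ in 𝕁, fRR R θ * fR R θ))
    (fun R hR => by
      have := hasDerivAt_integral (k := fun R θ => fR R θ ^ 2)
        (kR := fun R θ => 2 * (fRR R θ * fR R θ))
        (continuousOn_sq h.cR)
        ((h.cRR.mul h.cR).const_smul (2 : ℝ))
        (fun r hr θ hθ => by
          refine ((h.dRR r hr θ hθ).pow 2).congr_deriv ?_
          norm_num
          ring) hR
      rw [integral_const_mul] at this
      refine ((hasDerivAt_pow 3 R).mul this).congr_deriv ?_
      norm_num
      ring)
    jzy
    (jz.congr_fun (fun R (hR : 0 < R) => by field_simp) measurableSet_Ioi)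
  rw [integral_add jz' jy', integral_const_mul, integral_const_mul, ← sy, ← sz] at mom
  have split : ∫ p, radialOp α fR fRR p.1 p.2 ^ 2 ∂ρ
      = α ^ 4 * ∫ p, (p.1 ^ 2 * fRR p.1 p.2) ^ 2 ∂ρ
        + (2 * α ^ 3 * (5 + α) * ∫ p, (p.1 ^ 2 * fRR p.1 p.2) * (p.1 * fR p.1 p.2) ∂ρ
        + α ^ 2 * (5 + α) ^ 2 * ∫ p, (p.1 * fR p.1 p.2) ^ 2 ∂ρ) := by
    have iyz : Integrable (fun p : ℝ × ℝ =>
        2 * α ^ 3 * (5 + α) * ((p.1 ^ 2 * fRR p.1 p.2) * (p.1 * fR p.1 p.2))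
          + α ^ 2 * (5 + α) ^ 2 * (p.1 * fR p.1 p.2) ^ 2) ρ :=
      (iy.const_mul _).add (iz.const_mul _)
    rw [← integral_const_mul, ← integral_const_mul, ← integral_const_mul,
      ← integral_add (iy.const_mul _) (iz.const_mul _), ← integral_add (ix.const_mul _) iyz]
    congr 1
    funext p
    simp only [radialOp]
    ring
  have nz : 0 ≤ ∫ p : ℝ × ℝ, (p.1 * fR p.1 p.2) ^ 2 ∂ρ := integral_nonneg fun _ => sq_nonneg _
  rw [split]
  generalize (∫ p : ℝ × ℝ, (p.1 ^ 2 * fRR p.1 p.2) * (p.1 * fR p.1 p.2) ∂ρ) = y at *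
  generalize (∫ p : ℝ × ℝ, (p.1 * fR p.1 p.2) ^ 2 ∂ρ) = z at *
  obtain ⟨h0, h1⟩ := hα
  have hy : y = -(3 / 2 * z) := by linarith
  have : 0 ≤ α ^ 2 * (5 + α) * (5 - 2 * α) * z := by
    have : 0 ≤ 5 - 2 * α := by linarith
    positivity
  rw [hy]
  linarith

/-- The mean of `f` against `sin cos²` solves a homogeneous Euler equation, whose only square
integrable solution is zero. -/
lemma ae_integral_mul_kernel_eq_zero (h : RegularPartials f fR fT fRR fTR fTT)
    (hm : SquareIntegrable f fR fT fRR fTR fTT) {α : ℝ} (hα : α ∈ Ioc (0 : ℝ) 1)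
    (hX : ∀ R > 0, ∫ θ in 𝕁, radialOp α fR fRR R θ * (sin θ * cos θ ^ 2) = 0) :
    ∀ᵐ R ∂volume.restrict (Ioi (0 : ℝ)), ∫ θ in 𝕁, f R θ * (sin θ * cos θ ^ 2) = 0 := by
  set κ : ℝ → ℝ := fun θ => sin θ * cos θ ^ 2 with hκ
  have cκ : Continuous κ := by fun_prop
  have cκ' : ContinuousOn (fun p : ℝ × ℝ => κ p.2) 𝕊 :=
    (cκ.comp continuous_snd).continuousOn
  set m : ℝ → ℝ := fun R => ∫ θ in 𝕁, f R θ * κ θ with hm₀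
  set m₁ : ℝ → ℝ := fun R => ∫ θ in 𝕁, fR R θ * κ θ with hm₁
  set m₂ : ℝ → ℝ := fun R => ∫ θ in 𝕁, fRR R θ * κ θ with hm₂
  have d₀ : ∀ R > 0, HasDerivAt m (m₁ R) R := fun R hR =>
    hasDerivAt_integral (k := fun R θ => f R θ * κ θ) (kR := fun R θ => fR R θ * κ θ)
      (h.c.mul cκ') (h.cR.mul cκ') (fun r hr θ hθ => (h.dR r hr θ hθ).mul_const _) hR
  have d₁ : ∀ R > 0, HasDerivAt m₁ (m₂ R) R := fun R hR =>
    hasDerivAt_integral (k := fun R θ => fR R θ * κ θ) (kR := fun R θ => fRR R θ * κ θ)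
      (h.cR.mul cκ') (h.cRR.mul cκ') (fun r hr θ hθ => (h.dRR r hr θ hθ).mul_const _) hR
  have κ_le : ∀ θ, κ θ ^ 2 ≤ 1 := fun θ => by
    have h₁ := sin_sq_le_one θ
    have h₂ := cos_sq_le_one θ
    calc κ θ ^ 2 = sin θ ^ 2 * (cos θ ^ 2 * cos θ ^ 2) := by simp only [hκ]; ring
      _ ≤ 1 * (1 * 1) := by gcongr
      _ = 1 := by norm_num
  have bound : ∀ {g : ℝ → ℝ → ℝ}, ContinuousOn (Function.uncurry g) 𝕊 → ∀ R > 0,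
      (∫ θ in 𝕁, g R θ * κ θ) ^ 2 ≤ 2 * ∫ θ in 𝕁, g R θ ^ 2 := by
    intro g hg R hR
    have c := continuousOn_slice hg hR
    have c' := c.mul cκ.continuousOn
    refine (sq_integral_le c').trans (mul_le_mul_of_nonneg_left ?_ zero_le_two)
    refine integral_mono (integrableOn_of_continuousOn_Icc (c'.pow 2))
      (integrableOn_of_continuousOn_Icc (c.pow 2)) fun θ => ?_
    simp only [Pi.mul_apply, mul_pow]
    exact mul_le_of_le_one_right (sq_nonneg _) (κ_le θ)
  have cm : ContinuousOn m (Ioi 0) := fun R hR => (d₀ R hR).continuousAt.continuousWithinAt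
  have cm₁ : ContinuousOn m₁ (Ioi 0) := fun R hR => (d₁ R hR).continuousAt.continuousWithinAt
  have L₀ : MemLp m 2 (volume.restrict (Ioi 0)) := by
    refine (memLp_two_iff_integrable_sq (cm.aestronglyMeasurable measurableSet_Ioi)).2 ?_
    refine ((integrable_slice_integral hm.m.integrable_sq).const_mul 2).mono'
      ((cm.aestronglyMeasurable measurableSet_Ioi).pow 2) ?_
    refine (ae_restrict_iff' measurableSet_Ioi).2 (Eventually.of_forall fun R hR => ?_)
    rw [Real.norm_of_nonneg (sq_nonneg _)]
    exact bound h.c R hR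
  have L₁ : MemLp (fun R => R * m₁ R) 2 (volume.restrict (Ioi 0)) := by
    have c : ContinuousOn (fun R => R * m₁ R) (Ioi 0) := continuousOn_id.mul cm₁
    refine (memLp_two_iff_integrable_sq (c.aestronglyMeasurable measurableSet_Ioi)).2 ?_
    refine ((integrable_slice_integral hm.mR.integrable_sq).const_mul 2).mono'
      ((c.aestronglyMeasurable measurableSet_Ioi).pow 2) ?_
    refine (ae_restrict_iff' measurableSet_Ioi).2 (Eventually.of_forall fun R hR => ?_)
    rw [Real.norm_of_nonneg (sq_nonneg _)]
    simp only [mul_pow, integral_const_mul]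
    have := mul_le_mul_of_nonneg_left (bound h.cR R hR) (sq_nonneg R)
    linarith
  have hα0 : α ≠ 0 := hα.1.ne'
  have ode : ∀ R > 0, R ^ 2 * m₂ R = -((5 + α) / α * (R * m₁ R)) := by
    intro R hR
    have i₁ : IntegrableOn (fun θ => fR R θ * κ θ) 𝕁 :=
      integrableOn_of_continuousOn_Icc ((continuousOn_slice h.cR hR).mul cκ.continuousOn)
    have i₂ : IntegrableOn (fun θ => fRR R θ * κ θ) 𝕁 :=
      integrableOn_of_continuousOn_Icc ((continuousOn_slice h.cRR hR).mul cκ.continuousOn)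
    have e : ∫ θ in 𝕁, radialOp α fR fRR R θ * κ θ
        = α ^ 2 * R ^ 2 * m₂ R + α * (5 + α) * R * m₁ R := by
      rw [hm₁, hm₂]
      simp only
      rw [← integral_const_mul, ← integral_const_mul,
        ← integral_add (i₂.const_mul _) (i₁.const_mul _)]
      congr 1
      funext θ
      simp only [radialOp]
      ring
    have := hX R hR
    rw [e] at this
    have : α * (α * (R ^ 2 * m₂ R) + (5 + α) * (R * m₁ R)) = 0 := by linarith
    have := (mul_eq_zero.1 this).resolve_left hα0
    rw [div_mul_eq_mul_div, ← neg_div, eq_div_iff hα0]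
    linarith
  have q₀ : IntegrableOn (fun R => m R ^ 2) (Ioi 0) := L₀.integrable_sq
  have q₁ : IntegrableOn (fun R => m R * (R * m₁ R)) (Ioi 0) := L₀.integrable_mul L₁
  have q₂ : IntegrableOn (fun R => (R * m₁ R) ^ 2) (Ioi 0) := L₁.integrable_sq
  have e₂ : EqOn (fun R => 2 * (R * m₁ R) ^ 2 + -(2 * ((5 + α) / α)) * (m R * (R * m₁ R)))
      (fun R => R ^ 2 * (2 * (m₁ R * m₁ R + m R * m₂ R))) (Ioi 0) := fun R hR => by
    have : R ^ 2 * (2 * (m₁ R * m₁ R + m R * m₂ R))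
      = 2 * (R * m₁ R) ^ 2 + 2 * m R * (R ^ 2 * m₂ R) := by ring
    simp only [this, ode R hR]
    ring
  have e₁ : ∀ R, R * (2 * (m R * m₁ R)) = 2 * (m R * (R * m₁ R)) := fun R => by ring
  have q₂' := q₂.const_mul 2
  have q₁' := q₁.const_mul (-(2 * ((5 + α) / α)))
  have q₂₁ : IntegrableOn (fun R => 2 * (R * m₁ R) ^ 2
      + -(2 * ((5 + α) / α)) * (m R * (R * m₁ R))) (Ioi 0) := q₂'.add q₁'
  have mom := radial_moments (E := fun R => m R ^ 2) (E₁ := fun R => 2 * (m R * m₁ R))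
    (E₂ := fun R => 2 * (m₁ R * m₁ R + m R * m₂ R))
    (fun R hR => by
      refine ((d₀ R hR).pow 2).congr_deriv ?_
      norm_num
      ring)
    (fun R hR => ((d₀ R hR).mul (d₁ R hR)).const_mul 2) q₀
    ((q₁.const_mul 2).congr (Eventually.of_forall fun R => (e₁ R).symm))
    (q₂₁.congr_fun e₂ measurableSet_Ioi)
  obtain ⟨mom₁, mom₂⟩ := mom
  simp only [e₁] at mom₁
  rw [integral_const_mul] at mom₁
  rw [← setIntegral_congr_fun measurableSet_Ioi e₂, integral_add q₂' q₁', integral_const_mul,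
    integral_const_mul] at mom₂
  have nc : 0 ≤ ∫ R in Ioi (0 : ℝ), (R * m₁ R) ^ 2 := integral_nonneg fun _ => sq_nonneg _
  have na : 0 ≤ ∫ R in Ioi (0 : ℝ), m R ^ 2 := integral_nonneg fun _ => sq_nonneg _
  have zero : ∫ R in Ioi (0 : ℝ), m R ^ 2 = 0 := by
    refine le_antisymm ?_ na
    have hk : 2 < (5 + α) / α := by
      rw [lt_div_iff₀ hα.1]
      linarith [hα.2]
    have : ((5 + α) / α - 2) * ∫ R in Ioi (0 : ℝ), m R ^ 2 ≤ 0 := by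
      linear_combination 2 * nc + mom₂ + ((5 + α) / α) * mom₁
    nlinarith
  have := (integral_eq_zero_iff_of_nonneg (fun R => sq_nonneg (m R)) q₀).1 zero
  filter_upwards [this] with R hR
  exact pow_eq_zero_iff two_ne_zero |>.1 hR

end RegularPartials

lemma uniqueDiffOn_strip : UniqueDiffOn ℝ 𝕊 :=
  (uniqueDiffOn_Ioi 0).prod (uniqueDiffOn_Icc (by positivity))

lemma exists_partials {k : ℝ → ℝ → ℝ} {n : ℕ}
    (hk : ContDiffOn ℝ (n + 1) (Function.uncurry k) 𝕊) :
    ∃ kR kT : ℝ → ℝ → ℝ, ContDiffOn ℝ n (Function.uncurry kR) 𝕊 ∧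
      ContDiffOn ℝ n (Function.uncurry kT) 𝕊 ∧
      (∀ R > 0, ∀ θ ∈ 𝕁, HasDerivAt (fun s => k s θ) (kR R θ) R) ∧
      (∀ R > 0, ∀ θ ∈ 𝕁, HasDerivAt (fun t => k R t) (kT R θ) θ) := by
  have hD : ContDiffOn ℝ n (fderivWithin ℝ (Function.uncurry k) 𝕊) 𝕊 :=
    hk.fderivWithin uniqueDiffOn_strip le_rfl
  have main : ∀ R > 0, ∀ θ ∈ 𝕁, HasFDerivAt (Function.uncurry k)
      (fderivWithin ℝ (Function.uncurry k) 𝕊 (R, θ)) (R, θ) := fun R hR θ hθ =>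
    ((hk.differentiableOn (by simp)) (R, θ)
      ⟨hR, Ioo_subset_Icc_self hθ⟩).hasFDerivWithinAt.hasFDerivAt
      (prod_mem_nhds (Ioi_mem_nhds hR) (Icc_mem_nhds hθ.1 hθ.2))
  refine ⟨fun R θ => fderivWithin ℝ (Function.uncurry k) 𝕊 (R, θ) (1, 0),
    fun R θ => fderivWithin ℝ (Function.uncurry k) 𝕊 (R, θ) (0, 1),
    hD.clm_apply contDiffOn_const, hD.clm_apply contDiffOn_const,
    fun R hR θ hθ => ?_, fun R hR θ hθ => ?_⟩
  · exact (main R hR θ hθ).comp_hasDerivAt (f := fun s => (s, θ)) R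
      ((hasDerivAt_id R).prodMk (hasDerivAt_const R θ))
  · exact (main R hR θ hθ).comp_hasDerivAt (f := fun t => (R, t)) θ
      ((hasDerivAt_const θ R).prodMk (hasDerivAt_id θ))

lemma exists_regularPartials {f : ℝ → ℝ → ℝ} (hf : ContDiffOn ℝ 2 (Function.uncurry f) 𝕊)
    (hbc : ∀ R, f R 0 = 0 ∧ f R (π / 2) = 0) :
    ∃ fR fT fRR fTR fTT, RegularPartials f fR fT fRR fTR fTT := by
  obtain ⟨fR, fT, cR, cT, dR, dT⟩ := exists_partials (n := 1) (by simpa [one_add_one_eq_two] using hf)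
  obtain ⟨fRR, _, cRR, _, dRR, _⟩ := exists_partials (n := 0) (by simpa using cR)
  obtain ⟨fTR, fTT, cTR, cTT, dTR, dTT⟩ := exists_partials (n := 0) (by simpa using cT)
  exact ⟨fR, fT, fRR, fTR, fTT, hf.continuousOn, cR.continuousOn, cT.continuousOn,
    cRR.continuousOn, cTR.continuousOn, cTT.continuousOn, dR, dT, dRR, dTR, dTT,
    fun R => (hbc R).1, fun R => (hbc R).2⟩

lemma memLp_of_integrableOn_sq {G k : ℝ → ℝ → ℝ}
    (hG : IntegrableOn (fun p : ℝ × ℝ => G p.1 p.2 ^ 2) 𝕊)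
    (hk : ContinuousOn (fun p : ℝ × ℝ => k p.1 p.2) (SProd.sprod (Ioi (0 : ℝ)) 𝕁))
    (h : ∀ R > 0, ∀ θ ∈ 𝕁, G R θ = k R θ) : MemLp (fun p : ℝ × ℝ => k p.1 p.2) 2 ρ := by
  have ms : MeasurableSet (SProd.sprod (Ioi (0 : ℝ)) 𝕁) := measurableSet_Ioi.prod measurableSet_Ioo
  refine (memLp_two_iff_integrable_sq (hk.aestronglyMeasurable ms)).2 ?_
  refine (hG.mono_set (Set.prod_mono_right Ioo_subset_Icc_self)).congr_fun (fun p hp => ?_) ms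
  simp only [h p.1 hp.1 p.2 hp.2]

namespace RegularPartials

variable {f fR fT fRR fTR fTT : ℝ → ℝ → ℝ}

lemma pdR_eq (h : RegularPartials f fR fT fRR fTR fTT) {R θ : ℝ} (hR : 0 < R) (hθ : θ ∈ 𝕁) :
    pdR f R θ = fR R θ := (h.dR R hR θ hθ).deriv

lemma pdT_eq (h : RegularPartials f fR fT fRR fTR fTT) {R θ : ℝ} (hR : 0 < R) (hθ : θ ∈ 𝕁) :
    pdT f R θ = fT R θ := (h.dT R hR θ hθ).deriv

lemma pdR_pdR_eq (h : RegularPartials f fR fT fRR fTR fTT) {R θ : ℝ} (hR : 0 < R)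
    (hθ : θ ∈ 𝕁) : pdR (pdR f) R θ = fRR R θ := by
  refine ((h.dRR R hR θ hθ).congr_of_eventuallyEq ?_).deriv
  filter_upwards [Ioi_mem_nhds hR] with r hr using h.pdR_eq hr hθ

lemma pdR_pdT_eq (h : RegularPartials f fR fT fRR fTR fTT) {R θ : ℝ} (hR : 0 < R)
    (hθ : θ ∈ 𝕁) : pdR (pdT f) R θ = fTR R θ := by
  refine ((h.dTR R hR θ hθ).congr_of_eventuallyEq ?_).deriv
  filter_upwards [Ioi_mem_nhds hR] with r hr using h.pdT_eq hr hθ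

lemma pdT_pdT_eq (h : RegularPartials f fR fT fRR fTR fTT) {R θ : ℝ} (hR : 0 < R)
    (hθ : θ ∈ 𝕁) : pdT (pdT f) R θ = fTT R θ := by
  refine ((h.dTT R hR θ hθ).congr_of_eventuallyEq ?_).deriv
  filter_upwards [Ioo_mem_nhds hθ.1 hθ.2] with t ht using h.pdT_eq hR ht

lemma pdT_div_cos_eq (h : RegularPartials f fR fT fRR fTR fTT) {R θ : ℝ} (hR : 0 < R)
    (hθ : θ ∈ 𝕁) : pdT (fun s t => f s t / cos t) R θ = secDeriv (f R) (fT R) θ :=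
  ((h.angular hR).hasDerivAt_div_cos hθ).deriv

lemma pdT_tan_mul_eq (h : RegularPartials f fR fT fRR fTR fTT) {R θ : ℝ} (hR : 0 < R)
    (hθ : θ ∈ 𝕁) :
    pdT (fun s t => tan t * f s t) R θ = f R θ + sin θ * secDeriv (f R) (fT R) θ :=
  ((h.angular hR).hasDerivAt_tan_mul hθ).deriv

lemma continuousOn_div_cos (h : RegularPartials f fR fT fRR fTR fTT) :
    ContinuousOn (fun p : ℝ × ℝ => f p.1 p.2 / cos p.2) (SProd.sprod (Ioi (0 : ℝ)) 𝕁) := by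
  have c : Continuous fun p : ℝ × ℝ => cos p.2 := by fun_prop
  exact (h.c.mono (Set.prod_mono_right Ioo_subset_Icc_self)).div c.continuousOn
    fun p hp => (cos_pos_of_mem hp.2).ne'

lemma continuousOn_secDeriv (h : RegularPartials f fR fT fRR fTR fTT) :
    ContinuousOn (fun p : ℝ × ℝ => secDeriv (f p.1) (fT p.1) p.2)
      (SProd.sprod (Ioi (0 : ℝ)) 𝕁) := by
  have c : Continuous fun p : ℝ × ℝ => cos p.2 := by fun_prop
  have s : Continuous fun p : ℝ × ℝ => sin p.2 := by fun_prop
  have sub : SProd.sprod (Ioi (0 : ℝ)) 𝕁 ⊆ 𝕊 := Set.prod_mono_right Ioo_subset_Icc_self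
  exact ((c.continuousOn.mul (h.cT.mono sub)).add (s.continuousOn.mul (h.c.mono sub))).div
    (c.continuousOn.pow 2) fun p hp => pow_ne_zero 2 (cos_pos_of_mem hp.2).ne'

end RegularPartials

/-- The full elliptic operator. -/
def ellipticOp (α : ℝ) (f fR fT fRR fTT : ℝ → ℝ → ℝ) (R θ : ℝ) : ℝ :=
  angularOp (f R) (fT R) (fTT R) θ - radialOp α fR fRR R θ

lemma MeasureTheory.MemLp.sin_mul {k : ℝ × ℝ → ℝ} (hk : MemLp k 2 ρ) :
    MemLp (fun p : ℝ × ℝ => sin p.2 * k p) 2 ρ := by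
  have : Continuous fun p : ℝ × ℝ => sin p.2 := by fun_prop
  refine hk.mono (this.aestronglyMeasurable.mul hk.1) (Eventually.of_forall fun p => ?_)
  rw [norm_mul]
  exact mul_le_of_le_one_left (norm_nonneg _) (abs_sin_le_one _)

lemma ae_mem_strip : ∀ᵐ p : ℝ × ℝ ∂ρ, p ∈ SProd.sprod (Ioi (0 : ℝ)) 𝕁 :=
  ae_restrict_mem (measurableSet_Ioi.prod measurableSet_Ioo)

namespace RegularPartials

variable {f fR fT fRR fTR fTT : ℝ → ℝ → ℝ} {α : ℝ}

lemma angularOp_memLp (hm : SquareIntegrable f fR fT fRR fTR fTT)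
    (mV : MemLp (fun p : ℝ × ℝ => secDeriv (f p.1) (fT p.1) p.2) 2 ρ) :
    MemLp (fun p : ℝ × ℝ => angularOp (f p.1) (fT p.1) (fTT p.1) p.2) 2 ρ :=
  (hm.mTT.neg.add mV.sin_mul).sub (hm.m.const_mul 5)

lemma ellipticOp_memLp (hm : SquareIntegrable f fR fT fRR fTR fTT)
    (mV : MemLp (fun p : ℝ × ℝ => secDeriv (f p.1) (fT p.1) p.2) 2 ρ) :
    MemLp (fun p : ℝ × ℝ => ellipticOp α f fR fT fRR fTT p.1 p.2) 2 ρ :=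
  (angularOp_memLp hm mV).sub (radialOp_memLp α hm)

lemma angular_energy_le (h : RegularPartials f fR fT fRR fTR fTT)
    (hm : SquareIntegrable f fR fT fRR fTR fTT) (hα : α ∈ Ioc (0 : ℝ) 1)
    (mv : MemLp (fun p : ℝ × ℝ => f p.1 p.2 / cos p.2) 2 ρ)
    (mV : MemLp (fun p : ℝ × ℝ => secDeriv (f p.1) (fT p.1) p.2) 2 ρ) :
    1 / 2 * (∫ p, fTT p.1 p.2 ^ 2 ∂ρ) + 3 / 2 * (∫ p, secDeriv (f p.1) (fT p.1) p.2 ^ 2 ∂ρ)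
        + 1 / 2 * (∫ p, (f p.1 p.2 / cos p.2) ^ 2 ∂ρ)
      ≤ (∫ p, ellipticOp α f fR fT fRR fTT p.1 p.2 ^ 2 ∂ρ) + 36 * ∫ p, f p.1 p.2 ^ 2 ∂ρ := by
  have mL := angularOp_memLp hm mV
  have ig := (ellipticOp_memLp (α := α) hm mV).integrable_sq
  have iX := (radialOp_memLp α hm).integrable_mul hm.mTT
  have iL := mL.integrable_mul hm.mTT
  have ib := hm.mTT.integrable_sq
  have iV := mV.integrable_sq
  have iv := mv.integrable_sq
  have ifb := hm.m.integrable_mul hm.mTT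
  have iff := hm.m.integrable_sq
  have ik : Integrable (fun p : ℝ × ℝ => -(angularOp (f p.1) (fT p.1) (fTT p.1) p.2 * fTT p.1 p.2)
      - fTT p.1 p.2 ^ 2 - 3 / 2 * secDeriv (f p.1) (fT p.1) p.2 ^ 2
      - 1 / 2 * (f p.1 p.2 / cos p.2) ^ 2 - 6 * (f p.1 p.2 * fTT p.1 p.2)) ρ :=
    (((iL.neg.sub ib).sub (iV.const_mul _)).sub (iv.const_mul _)).sub (ifb.const_mul _)
  have zero := integral_strip ik
  rw [setIntegral_congr_fun (g := fun _ => (0 : ℝ)) measurableSet_Ioi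
    (fun R hR => (h.angular hR).integral_secondDeriv_identity), integral_zero] at zero
  have X := h.radial_energy_secondDeriv hm hα
  have ibV : Integrable (fun p : ℝ × ℝ => 1 / 2 * fTT p.1 p.2 ^ 2
      + 3 / 2 * secDeriv (f p.1) (fT p.1) p.2 ^ 2) ρ := (ib.const_mul _).add (iV.const_mul _)
  have iu : Integrable (fun p : ℝ × ℝ => 1 / 2 * fTT p.1 p.2 ^ 2
      + 3 / 2 * secDeriv (f p.1) (fT p.1) p.2 ^ 2 + 1 / 2 * (f p.1 p.2 / cos p.2) ^ 2) ρ :=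
    ibV.add (iv.const_mul _)
  have iw : Integrable (fun p : ℝ × ℝ => ellipticOp α f fR fT fRR fTT p.1 p.2 ^ 2
      + 36 * f p.1 p.2 ^ 2) ρ := ig.add (iff.const_mul _)
  have mono := integral_mono (ik.add iX) (iw.sub iu) fun p => by
    simp only [Pi.add_apply, Pi.sub_apply, Pi.mul_apply, ellipticOp]
    nlinarith [sq_nonneg (angularOp (f p.1) (fT p.1) (fTT p.1) p.2 - radialOp α fR fRR p.1 p.2
      + 1 / 2 * fTT p.1 p.2), sq_nonneg (6 * f p.1 p.2 + 1 / 2 * fTT p.1 p.2)]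
  rw [integral_add' ik iX, integral_sub' iw iu, zero, integral_add ig (iff.const_mul _),
    integral_const_mul, integral_add ibV (iv.const_mul _),
    integral_add (ib.const_mul _) (iV.const_mul _), integral_const_mul, integral_const_mul,
    integral_const_mul] at mono
  simp only [Pi.mul_apply] at mono
  linarith

lemma ae_orthogonal (h : RegularPartials f fR fT fRR fTR fTT)
    (hm : SquareIntegrable f fR fT fRR fTR fTT) (hα : α ∈ Ioc (0 : ℝ) 1)
    (hg : ∀ R > 0, ∫ θ in 𝕁, ellipticOp α f fR fT fRR fTT R θ * (sin θ * cos θ ^ 2) = 0) :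
    ∀ᵐ R ∂volume.restrict (Ioi (0 : ℝ)), ∫ θ in 𝕁, f R θ * (sin θ * cos θ ^ 2) = 0 := by
  refine h.ae_integral_mul_kernel_eq_zero hm hα fun R hR => ?_
  have cκ : ContinuousOn (fun θ => sin θ * cos θ ^ 2) (Icc 0 (π / 2)) := by fun_prop
  have i₁ := (h.angular hR).integrableOn_angularOp_mul cκ
  have cX : ContinuousOn (radialOp α fR fRR R) (Icc 0 (π / 2)) :=
    (((continuousOn_slice h.cRR hR).const_smul (R ^ 2)).const_smul (α ^ 2)).add
      (((continuousOn_slice h.cR hR).const_smul R).const_smul (α * (5 + α)))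
  have i₂ : IntegrableOn (fun θ => radialOp α fR fRR R θ * (sin θ * cos θ ^ 2)) 𝕁 :=
    integrableOn_of_continuousOn_Icc (cX.mul cκ)
  have := hg R hR
  simp only [ellipticOp, sub_mul] at this
  rw [integral_sub i₁ i₂, (h.angular hR).integral_angularOp_mul_kernel] at this
  linarith

lemma weighted_energy_le (h : RegularPartials f fR fT fRR fTR fTT)
    (hm : SquareIntegrable f fR fT fRR fTR fTT) (hα : α ∈ Ioc (0 : ℝ) 1)
    (mV : MemLp (fun p : ℝ × ℝ => secDeriv (f p.1) (fT p.1) p.2) 2 ρ)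
    (hg : ∀ R > 0, ∫ θ in 𝕁, ellipticOp α f fR fT fRR fTT R θ * (sin θ * cos θ ^ 2) = 0) :
    196 * (∫ p, cos p.2 * f p.1 p.2 ^ 2 ∂ρ)
      ≤ ∫ p, ellipticOp α f fR fT fRR fTT p.1 p.2 ^ 2 ∂ρ := by
  have iw : Integrable (fun p : ℝ × ℝ => cos p.2 * f p.1 p.2 ^ 2) ρ :=
    (hm.m.cos_mul.integrable_mul hm.m).congr
      (Eventually.of_forall fun p => by simp only [Pi.mul_apply]; ring)
  have ig := (ellipticOp_memLp (α := α) hm mV).integrable_sq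
  have iX := (radialOp_memLp α hm).integrable_mul hm.m.cos_mul
  have iL := (angularOp_memLp hm mV).integrable_mul hm.m.cos_mul
  have ik : Integrable (fun p : ℝ × ℝ => angularOp (f p.1) (fT p.1) (fTT p.1) p.2
      * (cos p.2 * f p.1 p.2) - 14 * (cos p.2 * f p.1 p.2 ^ 2)) ρ := iL.sub (iw.const_mul _)
  have pos : 0 ≤ ∫ p : ℝ × ℝ, (angularOp (f p.1) (fT p.1) (fTT p.1) p.2
      * (cos p.2 * f p.1 p.2) - 14 * (cos p.2 * f p.1 p.2 ^ 2)) ∂ρ := by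
    rw [integral_strip ik]
    refine integral_nonneg_of_ae ?_
    filter_upwards [h.ae_orthogonal hm hα hg, ae_restrict_mem measurableSet_Ioi] with R hR hR₀
    exact (h.angular hR₀).weighted_coercivity hR
  have X := h.radial_energy_weighted hm hα
  have mono := integral_mono_ae (ik.sub iX) ((ig.const_mul (1 / 28)).sub (iw.const_mul 7))
    (ae_mem_strip.mono fun p hp => by
      have hc := (cos_pos_of_mem hp.2).le
      have hc' := cos_le_one p.2
      simp only [Pi.sub_apply, Pi.mul_apply, ellipticOp]
      generalize angularOp (f p.1) (fT p.1) (fTT p.1) p.2 = L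
      generalize radialOp α fR fRR p.1 p.2 = Y
      have h₁ := mul_nonneg hc (sq_nonneg (L - Y - 14 * f p.1 p.2))
      have h₂ := mul_nonneg (sub_nonneg.2 hc') (sq_nonneg (L - Y))
      linarith)
  rw [integral_sub' ik iX, integral_sub' (ig.const_mul _) (iw.const_mul _), integral_const_mul,
    integral_const_mul] at mono
  simp only [Pi.mul_apply] at mono
  linarith

lemma integral_sq_le_of_weight (hm : SquareIntegrable f fR fT fRR fTR fTT)
    (mv : MemLp (fun p : ℝ × ℝ => f p.1 p.2 / cos p.2) 2 ρ) :
    ∫ p, f p.1 p.2 ^ 2 ∂ρ ≤ 1 / 144 * (∫ p, (f p.1 p.2 / cos p.2) ^ 2 ∂ρ)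
      + 36 * ∫ p, cos p.2 * f p.1 p.2 ^ 2 ∂ρ := by
  have iw : Integrable (fun p : ℝ × ℝ => cos p.2 * f p.1 p.2 ^ 2) ρ :=
    (hm.m.cos_mul.integrable_mul hm.m).congr
      (Eventually.of_forall fun p => by simp only [Pi.mul_apply]; ring)
  rw [← integral_const_mul, ← integral_const_mul,
    ← integral_add (mv.integrable_sq.const_mul _) (iw.const_mul _)]
  refine integral_mono_ae hm.m.integrable_sq
    ((mv.integrable_sq.const_mul _).add (iw.const_mul _)) (ae_mem_strip.mono fun p hp => ?_)
  have hc := cos_pos_of_mem hp.2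
  obtain ⟨v, hv⟩ : ∃ v, v = f p.1 p.2 / cos p.2 := ⟨_, rfl⟩
  have hf : f p.1 p.2 = cos p.2 * v := by
    rw [hv]
    field_simp
  simp only [← hv]
  rw [hf]
  have : cos p.2 ^ 2 ≤ 1 / 144 + 36 * cos p.2 ^ 3 := by
    nlinarith [mul_nonneg hc.le (sq_nonneg (cos p.2 - 1 / 54)), sq_nonneg (cos p.2 - 1 / 54)]
  nlinarith [mul_le_mul_of_nonneg_right this (sq_nonneg v)]

lemma integral_radialOp_sq_le (hm : SquareIntegrable f fR fT fRR fTR fTT)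
    (mV : MemLp (fun p : ℝ × ℝ => secDeriv (f p.1) (fT p.1) p.2) 2 ρ) :
    ∫ p, radialOp α fR fRR p.1 p.2 ^ 2 ∂ρ ≤
      4 * (∫ p, ellipticOp α f fR fT fRR fTT p.1 p.2 ^ 2 ∂ρ) + 4 * (∫ p, fTT p.1 p.2 ^ 2 ∂ρ)
        + 4 * (∫ p, secDeriv (f p.1) (fT p.1) p.2 ^ 2 ∂ρ) + 100 * ∫ p, f p.1 p.2 ^ 2 ∂ρ := by
  have ig := (ellipticOp_memLp (α := α) hm mV).integrable_sq.const_mul 4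
  have ib := hm.mTT.integrable_sq.const_mul 4
  have iV := mV.integrable_sq.const_mul 4
  have iff := hm.m.integrable_sq.const_mul 100
  have igb : Integrable (fun p : ℝ × ℝ => 4 * ellipticOp α f fR fT fRR fTT p.1 p.2 ^ 2
      + 4 * fTT p.1 p.2 ^ 2) ρ := ig.add ib
  have igbV : Integrable (fun p : ℝ × ℝ => 4 * ellipticOp α f fR fT fRR fTT p.1 p.2 ^ 2
      + 4 * fTT p.1 p.2 ^ 2 + 4 * secDeriv (f p.1) (fT p.1) p.2 ^ 2) ρ := igb.add iV
  rw [← integral_const_mul, ← integral_const_mul, ← integral_const_mul, ← integral_const_mul,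
    ← integral_add ig ib, ← integral_add igb iV, ← integral_add igbV iff]
  refine integral_mono (radialOp_memLp α hm).integrable_sq (igbV.add iff) fun p => ?_
  simp only [ellipticOp]
  have hs := sin_sq_le_one p.2
  have hL : angularOp (f p.1) (fT p.1) (fTT p.1) p.2
    = -fTT p.1 p.2 + sin p.2 * secDeriv (f p.1) (fT p.1) p.2 - 5 * f p.1 p.2 := rfl
  rw [hL]
  generalize secDeriv (f p.1) (fT p.1) p.2 = V
  generalize radialOp α fR fRR p.1 p.2 = X
  generalize fTT p.1 p.2 = b
  generalize f p.1 p.2 = u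
  have hV : (sin p.2 * V) ^ 2 ≤ V ^ 2 := by
    rw [mul_pow]
    exact mul_le_of_le_one_left (sq_nonneg _) hs
  generalize sin p.2 * V = w at *
  obtain ⟨g, hg⟩ : ∃ g, g = -b + w - 5 * u - X := ⟨_, rfl⟩
  rw [← hg, show X = -g - b + w - 5 * u by rw [hg]; ring]
  nlinarith [sq_nonneg (g - b), sq_nonneg (g + w), sq_nonneg (g - 5 * u), sq_nonneg (b + w),
    sq_nonneg (b - 5 * u), sq_nonneg (w + 5 * u)]

lemma sqrt_estimate (h : RegularPartials f fR fT fRR fTR fTT)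
    (hm : SquareIntegrable f fR fT fRR fTR fTT) (hα : α ∈ Ioc (0 : ℝ) 1)
    (mv : MemLp (fun p : ℝ × ℝ => f p.1 p.2 / cos p.2) 2 ρ)
    (mV : MemLp (fun p : ℝ × ℝ => secDeriv (f p.1) (fT p.1) p.2) 2 ρ)
    (hg : ∀ R > 0, ∫ θ in 𝕁, ellipticOp α f fR fT fRR fTT R θ * (sin θ * cos θ ^ 2) = 0) :
    √(∫ p, secDeriv (f p.1) (fT p.1) p.2 ^ 2 ∂ρ) + √(∫ p, fTT p.1 p.2 ^ 2 ∂ρ)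
        + α ^ 2 * √(∫ p, (p.1 ^ 2 * fRR p.1 p.2) ^ 2 ∂ρ)
      ≤ 100 * √(∫ p, ellipticOp α f fR fT fRR fTT p.1 p.2 ^ 2 ∂ρ) := by
  have h₁ := h.angular_energy_le hm hα mv mV
  have h₂ := h.weighted_energy_le hm hα mV hg
  have h₃ := integral_sq_le_of_weight hm mv
  have h₄ := integral_radialOp_sq_le (α := α) hm mV
  have h₅ := h.integral_radial_second_le hm hα
  have n₁ : 0 ≤ ∫ p, ellipticOp α f fR fT fRR fTT p.1 p.2 ^ 2 ∂ρ :=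
    integral_nonneg fun _ => sq_nonneg _
  have n₂ : 0 ≤ ∫ p, fTT p.1 p.2 ^ 2 ∂ρ := integral_nonneg fun _ => sq_nonneg _
  have n₃ : 0 ≤ ∫ p, secDeriv (f p.1) (fT p.1) p.2 ^ 2 ∂ρ := integral_nonneg fun _ => sq_nonneg _
  have n₄ : 0 ≤ ∫ p : ℝ × ℝ, (f p.1 p.2 / cos p.2) ^ 2 ∂ρ := integral_nonneg fun _ => sq_nonneg _
  generalize (∫ p, ellipticOp α f fR fT fRR fTT p.1 p.2 ^ 2 ∂ρ) = N at *
  generalize (∫ p, fTT p.1 p.2 ^ 2 ∂ρ) = B at *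
  generalize (∫ p, secDeriv (f p.1) (fT p.1) p.2 ^ 2 ∂ρ) = A at *
  generalize (∫ p : ℝ × ℝ, (p.1 ^ 2 * fRR p.1 p.2) ^ 2 ∂ρ) = C at *
  have hA : A ≤ 5 ^ 2 * N := by linarith
  have hB : B ≤ 6 ^ 2 * N := by linarith
  have hC : (α ^ 2) ^ 2 * C ≤ 16 ^ 2 * N := by
    have e : (α ^ 2) ^ 2 = α ^ 4 := by ring
    rw [e]
    linarith
  have key : ∀ {c x : ℝ}, 0 ≤ c → x ≤ c ^ 2 * N → √x ≤ c * √N := fun hc hx =>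
    (sqrt_le_sqrt hx).trans_eq (by rw [sqrt_mul (sq_nonneg _), sqrt_sq hc])
  have kA := key (by norm_num) hA
  have kB := key (by norm_num) hB
  have kC := key (by norm_num) hC
  rw [sqrt_mul (sq_nonneg _), sqrt_sq (sq_nonneg _)] at kC
  linarith [sqrt_nonneg N]

end RegularPartials

lemma iterated_integral_sq_eq {G k : ℝ → ℝ → ℝ}
    (hk : MemLp (fun p : ℝ × ℝ => k p.1 p.2) 2 ρ) (hG : ∀ R > 0, ∀ θ ∈ 𝕁, G R θ = k R θ) :
    ∫ R in Ioi (0 : ℝ), ∫ θ in Icc 0 (π / 2), G R θ ^ 2 = ∫ p, k p.1 p.2 ^ 2 ∂ρ := by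
  rw [integral_strip hk.integrable_sq]
  refine setIntegral_congr_fun measurableSet_Ioi fun R hR => ?_
  simp only [integral_Icc_eq_integral_Ioo]
  exact setIntegral_congr_fun measurableSet_Ioo fun θ hθ => by simp only [hG R hR θ hθ]

lemma RegularPartials.squareIntegrable {Ψ fR fT fRR fTR fTT : ℝ → ℝ → ℝ}
    (h : RegularPartials Ψ fR fT fRR fTR fTT)
    (i : IntegrableOn (fun p : ℝ × ℝ => Ψ p.1 p.2 ^ 2) 𝕊)
    (iT : IntegrableOn (fun p : ℝ × ℝ => pdT Ψ p.1 p.2 ^ 2) 𝕊)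
    (iTT : IntegrableOn (fun p : ℝ × ℝ => pdT (pdT Ψ) p.1 p.2 ^ 2) 𝕊)
    (iR : IntegrableOn (fun p : ℝ × ℝ => (p.1 * pdR Ψ p.1 p.2) ^ 2) 𝕊)
    (iTR : IntegrableOn (fun p : ℝ × ℝ => (p.1 * pdR (pdT Ψ) p.1 p.2) ^ 2) 𝕊)
    (iRR : IntegrableOn (fun p : ℝ × ℝ => (p.1 ^ 2 * pdR (pdR Ψ) p.1 p.2) ^ 2) 𝕊) :
    SquareIntegrable Ψ fR fT fRR fTR fTT := by
  have sub : SProd.sprod (Ioi (0 : ℝ)) 𝕁 ⊆ 𝕊 := Set.prod_mono_right Ioo_subset_Icc_self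
  have cp : Continuous fun p : ℝ × ℝ => p.1 := continuous_fst
  exact
    { m := memLp_of_integrableOn_sq i (h.c.mono sub) fun _ _ _ _ => rfl
      mT := memLp_of_integrableOn_sq iT (h.cT.mono sub) fun R hR θ hθ => h.pdT_eq hR hθ
      mTT := memLp_of_integrableOn_sq iTT (h.cTT.mono sub) fun R hR θ hθ => h.pdT_pdT_eq hR hθ
      mR := memLp_of_integrableOn_sq (G := fun R θ => R * pdR Ψ R θ)
        (k := fun R θ => R * fR R θ) iR (cp.continuousOn.mul (h.cR.mono sub))
        fun R hR θ hθ => by rw [h.pdR_eq hR hθ]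
      mTR := memLp_of_integrableOn_sq (G := fun R θ => R * pdR (pdT Ψ) R θ)
        (k := fun R θ => R * fTR R θ) iTR (cp.continuousOn.mul (h.cTR.mono sub))
        fun R hR θ hθ => by rw [h.pdR_pdT_eq hR hθ]
      mRR := memLp_of_integrableOn_sq (G := fun R θ => R ^ 2 * pdR (pdR Ψ) R θ)
        (k := fun R θ => R ^ 2 * fRR R θ) iRR ((cp.pow 2).continuousOn.mul (h.cRR.mono sub))
        fun R hR θ hθ => by rw [h.pdR_pdR_eq hR hθ] }

/-- L² a priori estimate for the elliptic problem
`−α²R²∂_{RR}Ψ − α(5+α)R∂_RΨ − ∂_{θθ}Ψ + ∂_θ(tan θ · Ψ) − 6Ψ = F`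
under the orthogonality condition `∫_0^{π/2} F(R,θ) cos²θ sin θ dθ = 0`:
`‖∂_θ(Ψ/cos θ)‖ + ‖∂_{θθ}Ψ‖ + α²‖R²∂_{RR}Ψ‖ ≤ 100‖F‖` in `L²(dR dθ)`. -/
theorem elliptic_L2_estimate (α : ℝ) (hα : α ∈ Ioc (0 : ℝ) 1) (F Ψ : ℝ → ℝ → ℝ)
    (hF2 : IntegrableOn (fun p : ℝ × ℝ => F p.1 p.2 ^ 2) (Ioi 0 ×ˢ Icc 0 (π / 2)))
    (hFmean : ∀ R : ℝ, ∫ θ in Icc 0 (π / 2), F R θ * Real.cos θ ^ 2 * Real.sin θ = 0)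
    (hΨreg : ContDiffOn ℝ 2 (Function.uncurry Ψ) (Ioi 0 ×ˢ Icc 0 (π / 2)))
    (hPDE : ∀ R ∈ Ioi (0 : ℝ), ∀ θ ∈ Ioo (0 : ℝ) (π / 2),
      -α ^ 2 * R ^ 2 * pdR (pdR Ψ) R θ - α * (5 + α) * R * pdR Ψ R θ -
          pdT (pdT Ψ) R θ + pdT (fun s t => Real.tan t * Ψ s t) R θ - 6 * Ψ R θ =
        F R θ)
    (hbc : ∀ R : ℝ, Ψ R 0 = 0 ∧ Ψ R (π / 2) = 0)
    (hdecay : ∀ θ ∈ Icc (0 : ℝ) (π / 2),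
      Tendsto (fun R => Ψ R θ) atTop (nhds 0))
    (hzero : ∀ θ ∈ Icc (0 : ℝ) (π / 2),
      Tendsto (fun R => R ^ 2 * Ψ R θ) (nhdsWithin 0 (Ioi 0)) (nhds 0))
    (hL2 : ∀ G ∈ ([Ψ, pdT Ψ, pdT (pdT Ψ), fun R θ => R * pdR Ψ R θ,
        fun R θ => R * pdR (pdT Ψ) R θ, fun R θ => R ^ 2 * pdR (pdR Ψ) R θ,
        fun R θ => Ψ R θ / Real.cos θ,
        pdT (fun s t => Ψ s t / Real.cos t)] : List (ℝ → ℝ → ℝ)),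
      IntegrableOn (fun p : ℝ × ℝ => G p.1 p.2 ^ 2) (Ioi 0 ×ˢ Icc 0 (π / 2))) :
    Real.sqrt (∫ R in Ioi (0 : ℝ), ∫ θ in Icc 0 (π / 2),
          (pdT (fun s t => Ψ s t / Real.cos t) R θ) ^ 2) +
      Real.sqrt (∫ R in Ioi (0 : ℝ), ∫ θ in Icc 0 (π / 2), (pdT (pdT Ψ) R θ) ^ 2) +
      α ^ 2 * Real.sqrt (∫ R in Ioi (0 : ℝ), ∫ θ in Icc 0 (π / 2),
          (R ^ 2 * pdR (pdR Ψ) R θ) ^ 2) ≤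
    100 * Real.sqrt (∫ R in Ioi (0 : ℝ), ∫ θ in Icc 0 (π / 2), F R θ ^ 2) := by
  obtain ⟨fR, fT, fRR, fTR, fTT, h⟩ := exists_regularPartials hΨreg hbc
  simp only [List.forall_mem_cons] at hL2
  obtain ⟨i, iT, iTT, iR, iTR, iRR, iv, iV, -⟩ := hL2
  have hm : SquareIntegrable Ψ fR fT fRR fTR fTT := h.squareIntegrable i iT iTT iR iTR iRR
  have mv : MemLp (fun p : ℝ × ℝ => Ψ p.1 p.2 / cos p.2) 2 ρ :=
    memLp_of_integrableOn_sq (G := fun R θ => Ψ R θ / cos θ) (k := fun R θ => Ψ R θ / cos θ)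
      iv h.continuousOn_div_cos fun _ _ _ _ => rfl
  have mV : MemLp (fun p : ℝ × ℝ => secDeriv (Ψ p.1) (fT p.1) p.2) 2 ρ :=
    memLp_of_integrableOn_sq (k := fun R θ => secDeriv (Ψ R) (fT R) θ)
      iV h.continuousOn_secDeriv fun R hR θ hθ => h.pdT_div_cos_eq hR hθ
  have hFeq : ∀ R > 0, ∀ θ ∈ 𝕁, F R θ = ellipticOp α Ψ fR fT fRR fTT R θ := by
    intro R hR θ hθ
    rw [← hPDE R hR θ hθ, h.pdR_pdR_eq hR hθ, h.pdR_eq hR hθ, h.pdT_pdT_eq hR hθ,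
      h.pdT_tan_mul_eq hR hθ]
    simp only [ellipticOp, angularOp, radialOp]
    ring
  have hg : ∀ R > 0,
      ∫ θ in 𝕁, ellipticOp α Ψ fR fT fRR fTT R θ * (sin θ * cos θ ^ 2) = 0 := by
    intro R hR
    have mean := hFmean R
    rw [integral_Icc_eq_integral_Ioo] at mean
    refine (setIntegral_congr_fun measurableSet_Ioo fun θ hθ => ?_).trans mean
    simp only [hFeq R hR θ hθ]
    ring
  have eV := iterated_integral_sq_eq mV fun R hR θ hθ => h.pdT_div_cos_eq hR hθ
  have eTT := iterated_integral_sq_eq hm.mTT fun R hR θ hθ => h.pdT_pdT_eq hR hθ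
  have eRR := iterated_integral_sq_eq (G := fun R θ => R ^ 2 * pdR (pdR Ψ) R θ)
    (k := fun R θ => R ^ 2 * fRR R θ) hm.mRR fun R hR θ hθ => by rw [h.pdR_pdR_eq hR hθ]
  have eF := iterated_integral_sq_eq (RegularPartials.ellipticOp_memLp (α := α) hm mV) hFeq
  rw [eV, eTT, eRR, eF]
  exact h.sqrt_estimate hm hα mv mV hg
end
end

section
/- Hardy-type inequality with sin²(2θ) weight: if f ∈ H¹([0,π/2]) (f absolutely continuous with f' ∈ L²) and f(0) = f(π/2) = 0, then ∫₀^{π/2} f(θ)²/sin²(2θ) dθ ≤ 10 ∫₀^{π/2} f'(θ)² dθ. -/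
open Real MeasureTheory Set

noncomputable section

open Filter Topology

/-- Cauchy–Schwarz against the constant function `1`. -/
lemma sq_intervalIntegral_le {g : ℝ → ℝ} {a b : ℝ} (hab : a < b)
    (hg : IntervalIntegrable g volume a b)
    (hg2 : IntervalIntegrable (fun x => g x ^ 2) volume a b) :
    (∫ x in a..b, g x) ^ 2 ≤ (b - a) * ∫ x in a..b, g x ^ 2 := by
  have hpos : 0 < b - a := sub_pos.2 hab
  set I := ∫ x in a..b, g x with hI
  have h : 0 ≤ ∫ x in a..b, (g x ^ 2 - 2 * (I / (b - a)) * g x + (I / (b - a)) ^ 2) :=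
    intervalIntegral.integral_nonneg hab.le fun x _ => by
      nlinarith [sq_nonneg (g x - I / (b - a))]
  rw [intervalIntegral.integral_add (hg2.sub (hg.const_mul _)) (by simp),
    intervalIntegral.integral_sub hg2 (hg.const_mul _), intervalIntegral.integral_const_mul,
    intervalIntegral.integral_const, smul_eq_mul, ← hI] at h
  have h' := mul_nonneg hpos.le h
  have e : (b - a) * ((∫ x in a..b, g x ^ 2) - 2 * (I / (b - a)) * I
      + (b - a) * (I / (b - a)) ^ 2) = (b - a) * (∫ x in a..b, g x ^ 2) - I ^ 2 := by
    field_simp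
    ring
  linarith

lemma mul_cos_le_sin {y : ℝ} (h0 : 0 < y) (h1 : y < π / 2) : y * cos y ≤ sin y := by
  have hc : 0 < cos y := cos_pos_of_mem_Ioo ⟨by linarith, h1⟩
  have h := (lt_tan h0 h1).le
  rwa [tan_eq_sin_div_cos, le_div_iff₀ hc] at h

lemma hasDerivAt_cot_two_mul {x : ℝ} (hs : sin (2 * x) ≠ 0) :
    HasDerivAt (fun x => cos (2 * x) / sin (2 * x)) (-2 / sin (2 * x) ^ 2) x := by
  have h2 : HasDerivAt (fun x : ℝ => 2 * x) 2 x := by simpa using (hasDerivAt_id x).const_mul 2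
  refine (h2.cos.div h2.sin hs).congr_deriv ?_
  congr 1
  linear_combination -2 * sin_sq_add_cos_sq (2 * x)

/-- Integrating `g² ≥ (F² cot 2θ)' + F² / sin² 2θ` over a compact subinterval. -/
lemma intervalIntegral_sq_div_sin_sq_le {g : ℝ → ℝ} {a b : ℝ} (ha : 0 < a) (hab : a ≤ b)
    (hb : b < π / 2) (hg : IntervalIntegrable g volume 0 (π / 2))
    (hg2 : IntervalIntegrable (fun x => g x ^ 2) volume 0 (π / 2)) :
    ∫ x in a..b, (∫ t in (0 : ℝ)..x, g t) ^ 2 / sin (2 * x) ^ 2 ≤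
      (∫ x in a..b, g x ^ 2) - (∫ t in (0 : ℝ)..b, g t) ^ 2 * (cos (2 * b) / sin (2 * b))
        + (∫ t in (0 : ℝ)..a, g t) ^ 2 * (cos (2 * a) / sin (2 * a)) := by
  have hpi := pi_pos
  set F : ℝ → ℝ := fun x => ∫ t in (0 : ℝ)..x, g t
  set Q : ℝ → ℝ := fun x => cos (2 * x) / sin (2 * x)
  have hsub : uIcc a b ⊆ uIcc 0 (π / 2) := by
    rw [uIcc_of_le hab, uIcc_of_le (by linarith)]
    exact Icc_subset_Icc ha.le hb.le
  have hs : ∀ x ∈ uIcc a b, 0 < sin (2 * x) := fun x hx => by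
    rw [uIcc_of_le hab] at hx
    exact sin_pos_of_pos_of_lt_pi (by linarith [hx.1]) (by linarith [hx.2])
  have hF : AbsolutelyContinuousOnInterval F a b :=
    (hg.absolutelyContinuousOnInterval_intervalIntegral left_mem_uIcc).mono hsub
  have hP : AbsolutelyContinuousOnInterval (F * F) a b := hF.mul hF
  have hQ : AbsolutelyContinuousOnInterval Q a b := by
    refine ContDiffOn.absolutelyContinuousOnInterval (ContDiffOn.div ?_ ?_ fun x hx => (hs x hx).ne')
    · exact (contDiff_cos.comp (contDiff_const.mul contDiff_id)).contDiffOn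
    · exact (contDiff_sin.comp (contDiff_const.mul contDiff_id)).contDiffOn
  have hd : IntervalIntegrable (fun x => deriv (F * F) x * Q x + (F * F) x * deriv Q x)
      volume a b :=
    (hP.intervalIntegrable_deriv.mul_continuousOn hQ.continuousOn).add
      (hQ.intervalIntegrable_deriv.continuousOn_mul hP.continuousOn)
  have hg2' := hg2.mono_set hsub
  have hL : IntervalIntegrable (fun x => F x ^ 2 / sin (2 * x) ^ 2) volume a b := by
    refine ContinuousOn.intervalIntegrable ((hF.continuousOn.pow 2).div ?_ fun x hx => ?_)
    · fun_prop
    · exact pow_ne_zero 2 (hs x hx).ne'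
  have key : ∫ x in a..b, F x ^ 2 / sin (2 * x) ^ 2 ≤
      ∫ x in a..b, (g x ^ 2 - (deriv (F * F) x * Q x + (F * F) x * deriv Q x)) := by
    refine intervalIntegral.integral_mono_ae_restrict hab hL (hg2'.sub hd) ?_
    rw [Filter.EventuallyLE, ae_restrict_iff' measurableSet_Icc]
    filter_upwards [hg.ae_hasDerivAt_integral] with x hx hxab
    have hxu : x ∈ uIcc a b := by rwa [uIcc_of_le hab]
    have hFx : HasDerivAt F (g x) x := hx (hsub hxu) 0 left_mem_uIcc
    have hs' := hs x hxu
    rw [(hFx.mul hFx).deriv, (hasDerivAt_cot_two_mul hs'.ne').deriv]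
    simp only [Pi.mul_apply, Q]
    have e : g x ^ 2 - ((g x * F x + F x * g x) * (cos (2 * x) / sin (2 * x))
        + F x * F x * (-2 / sin (2 * x) ^ 2)) - F x ^ 2 / sin (2 * x) ^ 2
        = (g x - F x * (cos (2 * x) / sin (2 * x))) ^ 2 + F x ^ 2 := by
      field_simp
      linear_combination -(F x ^ 2) * sin_sq_add_cos_sq (2 * x)
    nlinarith [sq_nonneg (g x - F x * (cos (2 * x) / sin (2 * x))), sq_nonneg (F x)]
  rw [intervalIntegral.integral_sub hg2' hd, hP.integral_deriv_mul_eq_sub hQ] at key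
  simp only [Pi.mul_apply] at key
  linarith

lemma sq_mul_cot_two_mul_le {a F G : ℝ} (ha : 0 < a) (ha' : a < π / 4) (hG : 0 ≤ G)
    (hF : F ^ 2 ≤ a * G) : F ^ 2 * (cos (2 * a) / sin (2 * a)) ≤ G := by
  have hs : 0 < sin (2 * a) := sin_pos_of_pos_of_lt_pi (by linarith) (by linarith [pi_pos])
  have hc : 0 < cos (2 * a) := cos_pos_of_mem_Ioo ⟨by linarith [pi_pos], by linarith⟩
  rw [← mul_div_assoc, div_le_iff₀ hs]
  have h := mul_cos_le_sin (y := 2 * a) (by linarith) (by linarith)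
  nlinarith [mul_le_mul_of_nonneg_right hF hc.le, mul_le_mul_of_nonneg_left h hG,
    mul_nonneg hG hs.le]

lemma intervalIntegral_sq_div_sin_sq_le_integral_sq {g : ℝ → ℝ} {a : ℝ} (ha : 0 < a)
    (ha' : a < π / 4) (hg : IntervalIntegrable g volume 0 (π / 2))
    (hg2 : IntervalIntegrable (fun x => g x ^ 2) volume 0 (π / 2))
    (h0 : ∫ t in (0 : ℝ)..(π / 2), g t = 0) :
    ∫ x in a..(π / 2 - a), (∫ t in (0 : ℝ)..x, g t) ^ 2 / sin (2 * x) ^ 2 ≤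
      ∫ x in (0 : ℝ)..(π / 2), g x ^ 2 := by
  have hpi := pi_pos
  set b := π / 2 - a with hb
  have hsub {c d : ℝ} (hc : 0 ≤ c) (hcd : c ≤ d) (hd : d ≤ π / 2) :
      uIcc c d ⊆ uIcc 0 (π / 2) := by
    rw [uIcc_of_le hcd, uIcc_of_le (by linarith)]
    exact Icc_subset_Icc hc hd
  have s1 := hsub (c := 0) (d := a) le_rfl ha.le (by linarith)
  have s2 := hsub (c := a) (d := b) ha.le (by linarith) (by linarith)
  have s3 := hsub (c := b) (d := π / 2) (by linarith) (by linarith) le_rfl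
  have hnn {c d : ℝ} (hcd : c ≤ d) : 0 ≤ ∫ x in c..d, g x ^ 2 :=
    intervalIntegral.integral_nonneg hcd fun x _ => sq_nonneg _
  have hmain := intervalIntegral_sq_div_sin_sq_le ha (by linarith) (by linarith : b < π / 2) hg hg2
  have hcs1 := sq_intervalIntegral_le ha (hg.mono_set s1) (hg2.mono_set s1)
  have hcs3 := sq_intervalIntegral_le (by linarith : b < π / 2) (hg.mono_set s3) (hg2.mono_set s3)
  have hsplit : (∫ t in (0 : ℝ)..b, g t) + ∫ t in b..(π / 2), g t = 0 := by
    rw [intervalIntegral.integral_add_adjacent_intervals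
      (hg.mono_set (hsub le_rfl (by linarith) (by linarith))) (hg.mono_set s3), h0]
  have hsq : (∫ t in b..(π / 2), g t) ^ 2 = (∫ t in (0 : ℝ)..b, g t) ^ 2 := by
    rw [eq_neg_of_add_eq_zero_right hsplit, neg_sq]
  have hadd : (∫ x in (0 : ℝ)..a, g x ^ 2) + (∫ x in a..b, g x ^ 2)
      + (∫ x in b..(π / 2), g x ^ 2) = ∫ x in (0 : ℝ)..(π / 2), g x ^ 2 := by
    rw [intervalIntegral.integral_add_adjacent_intervals (hg2.mono_set s1) (hg2.mono_set s2),
      intervalIntegral.integral_add_adjacent_intervals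
        (hg2.mono_set (hsub le_rfl (by linarith) (by linarith))) (hg2.mono_set s3)]
  have b1 := sq_mul_cot_two_mul_le ha ha' (hnn ha.le) (by simpa using hcs1)
  have b3 := sq_mul_cot_two_mul_le ha ha' (hnn (by linarith : b ≤ π / 2))
    (F := ∫ t in (0 : ℝ)..b, g t) (by rw [← hsq]; convert hcs3 using 2; rw [hb]; ring)
  have hcot : cos (2 * b) / sin (2 * b) = -(cos (2 * a) / sin (2 * a)) := by
    rw [show 2 * b = π - 2 * a by rw [hb]; ring, cos_pi_sub, sin_pi_sub, neg_div]
  rw [hcot] at hmain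
  linarith

/-- Hardy-type inequality with `sin²(2θ)` weight: if `f` is absolutely continuous on
`[0,π/2]` with derivative `g ∈ L²` and `f(0) = f(π/2) = 0`, then
`∫_0^{π/2} f(θ)²/sin²(2θ) dθ ≤ 10 ∫_0^{π/2} f'(θ)² dθ`. -/
theorem hardy_sin_sq (f g : ℝ → ℝ)
    (hgm : Measurable g)
    (hg1 : IntegrableOn g (Icc 0 (π / 2)))
    (hg2 : IntegrableOn (fun θ => g θ ^ 2) (Icc 0 (π / 2)))
    (hf : ∀ x ∈ Icc (0 : ℝ) (π / 2), f x = f 0 + ∫ t in (0 : ℝ)..x, g t)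
    (h0 : f 0 = 0) (h1 : f (π / 2) = 0) :
    ∫ θ in Icc 0 (π / 2), f θ ^ 2 / Real.sin (2 * θ) ^ 2 ≤
      10 * ∫ θ in Icc 0 (π / 2), g θ ^ 2 := by
  have hpi := pi_pos
  have hle : (0 : ℝ) ≤ π / 2 := by positivity
  have hnn : 0 ≤ ∫ θ in Icc 0 (π / 2), g θ ^ 2 := integral_nonneg fun θ => sq_nonneg _
  by_cases hint : IntegrableOn (fun θ => f θ ^ 2 / Real.sin (2 * θ) ^ 2) (Icc 0 (π / 2))
  swap
  · rw [integral_undef hint]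
    positivity
  have hg : IntervalIntegrable g volume 0 (π / 2) :=
    (intervalIntegrable_iff_integrableOn_Icc_of_le hle).2 hg1
  have hg' : IntervalIntegrable (fun x => g x ^ 2) volume 0 (π / 2) :=
    (intervalIntegrable_iff_integrableOn_Icc_of_le hle).2 hg2
  have hzero : ∫ t in (0 : ℝ)..(π / 2), g t = 0 := by
    have h := hf (π / 2) (right_mem_Icc.2 hle)
    rw [h0, h1] at h
    linarith
  have hG : ∫ x in (0 : ℝ)..(π / 2), g x ^ 2 = ∫ θ in Icc 0 (π / 2), g θ ^ 2 := by
    rw [intervalIntegral.integral_of_le hle, integral_Icc_eq_integral_Ioc]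
  have hbound : ∀ᶠ a in 𝓝[>] (0 : ℝ), ∫ x in Icc a (π / 2 - a),
      f x ^ 2 / Real.sin (2 * x) ^ 2 ∂(volume.restrict (Icc 0 (π / 2))) ≤
        ∫ θ in Icc 0 (π / 2), g θ ^ 2 := by
    filter_upwards [Ioo_mem_nhdsGT (by positivity : 0 < π / 4)] with a ha
    have hsub : Icc a (π / 2 - a) ⊆ Icc 0 (π / 2) :=
      Icc_subset_Icc ha.1.le (by linarith [ha.1])
    rw [Measure.restrict_restrict measurableSet_Icc, inter_eq_left.2 hsub, ← hG]
    refine le_trans (le_of_eq ?_)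
      (intervalIntegral_sq_div_sin_sq_le_integral_sq ha.1 ha.2 hg hg' hzero)
    rw [intervalIntegral.integral_of_le (by linarith [ha.2]), ← integral_Icc_eq_integral_Ioc]
    refine setIntegral_congr_fun measurableSet_Icc fun x hx => ?_
    simp only [hf x (hsub hx), h0, zero_add]
  have ht : Tendsto (fun a : ℝ => a) (𝓝[>] 0) (𝓝 0) := nhdsWithin_le_nhds
  have ht' : Tendsto (fun a : ℝ => π / 2 - a) (𝓝[>] 0) (𝓝 (π / 2)) := by
    simpa using ht.const_sub (π / 2)
  have hlim := (aecover_Icc_of_Icc (μ := volume) ht ht').integral_tendsto_of_countably_generated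
    hint
  linarith [le_of_tendsto hlim hbound]
end
end

section
/- Second-order Hardy-type inequality: if f ∈ H²([0,π/2]) (f ∈ C¹ with f'' ∈ L² in the weak sense) and f(0) = f(π/2) = 0, then ∫₀^{π/2} (d/dθ (f(θ)/sin(2θ)))² dθ ≤ 10 ∫₀^{π/2} f''(θ)² dθ. -/
open Real MeasureTheory Set

noncomputable section

/-- Fundamental theorem of calculus for absolutely continuous functions, with an explicit
almost everywhere derivative. -/
lemma intervalIntegrable_and_integral_eq_sub_of_ae_hasDerivAt {F k : ℝ → ℝ} {a b : ℝ}
    (hF : AbsolutelyContinuousOnInterval F a b)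
    (hk : ∀ᵐ x, x ∈ uIcc a b → HasDerivAt F (k x) x) :
    IntervalIntegrable k volume a b ∧ ∫ x in a..b, k x = F b - F a := by
  have hae : ∀ᵐ x, x ∈ uIoc a b → deriv F x = k x := by
    filter_upwards [hk] with x hx hm using (hx (uIoc_subset_uIcc hm)).deriv
  refine ⟨hF.intervalIntegrable_deriv.congr_ae
    ((ae_restrict_iff' measurableSet_uIoc).2 hae), ?_⟩
  rw [← hF.integral_deriv_eq_sub]
  exact (intervalIntegral.integral_congr_ae hae).symm

lemma sq_integral_abs_le {w : ℝ → ℝ} {a : ℝ} (ha : 0 < a)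
    (hw : IntervalIntegrable w volume 0 a)
    (hw2 : IntervalIntegrable (fun x => w x ^ 2) volume 0 a) :
    (∫ t in (0 : ℝ)..a, |w t|) ^ 2 ≤ a * ∫ t in (0 : ℝ)..a, w t ^ 2 := by
  set A := ∫ t in (0 : ℝ)..a, |w t| with hA
  have h : 0 ≤ ∫ t in (0 : ℝ)..a, (w t ^ 2 - 2 * (A / a) * |w t| + (A / a) ^ 2) := by
    refine intervalIntegral.integral_nonneg ha.le fun t _ => ?_
    nlinarith [sq_nonneg (|w t| - A / a), sq_abs (w t)]
  have hi : IntervalIntegrable (fun t => 2 * (A / a) * |w t|) volume 0 a := hw.abs.const_mul _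
  rw [intervalIntegral.integral_add (hw2.sub hi) (by simp),
    intervalIntegral.integral_sub hw2 hi, intervalIntegral.integral_const_mul,
    intervalIntegral.integral_const, ← hA] at h
  have e : a * (∫ t in (0 : ℝ)..a, w t ^ 2) - A ^ 2 =
      a * ((∫ t in (0 : ℝ)..a, w t ^ 2) - 2 * (A / a) * A + (a - 0) • (A / a) ^ 2) := by
    simp only [smul_eq_mul]
    field_simp
    ring
  have := mul_nonneg ha.le h
  linarith

lemma sin_two_mul_pos {x : ℝ} (h0 : 0 < x) (h1 : x < π / 2) : 0 < sin (2 * x) :=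
  sin_pos_of_pos_of_lt_pi (by linarith) (by linarith)

lemma hasDerivAt_sin_two_mul (x : ℝ) :
    HasDerivAt (fun y => sin (2 * y)) (2 * cos (2 * x)) x := by
  simpa [mul_comm] using ((hasDerivAt_id x).const_mul 2).sin

lemma hasDerivAt_cos_two_mul (x : ℝ) :
    HasDerivAt (fun y => cos (2 * y)) (-2 * sin (2 * x)) x := by
  simpa [mul_comm] using ((hasDerivAt_id x).const_mul 2).cos

/-- The boundary term at `a` in the weighted Hardy inequality. -/
lemma boundary_term_le {w : ℝ → ℝ} {a : ℝ} (h0 : 0 < a) (h1 : a ≤ π / 4)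
    (hw : IntervalIntegrable w volume 0 a)
    (hw2 : IntervalIntegrable (fun x => w x ^ 2) volume 0 a) :
    cos (2 * a) / sin (2 * a) ^ 3 * (∫ t in (0 : ℝ)..a, sin (2 * t) * w t) ^ 2 ≤
      ∫ t in (0 : ℝ)..a, w t ^ 2 := by
  have hs : 0 < sin (2 * a) := sin_two_mul_pos h0 (by linarith [pi_pos])
  have hu : |∫ t in (0 : ℝ)..a, sin (2 * t) * w t| ≤ sin (2 * a) * ∫ t in (0 : ℝ)..a, |w t| := by
    rw [← intervalIntegral.integral_const_mul, ← Real.norm_eq_abs]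
    refine intervalIntegral.norm_integral_le_of_norm_le h0.le (ae_of_all _ fun t ht => ?_)
      (hw.abs.const_mul _)
    have ht0 : 0 ≤ sin (2 * t) :=
      sin_nonneg_of_nonneg_of_le_pi (by linarith [ht.1]) (by linarith [ht.2, pi_pos])
    have hts : sin (2 * t) ≤ sin (2 * a) :=
      sin_le_sin_of_le_of_le_pi_div_two (by linarith [ht.1, pi_pos]) (by linarith)
        (by linarith [ht.2])
    rw [Real.norm_eq_abs, abs_mul, abs_of_nonneg ht0]
    gcongr
  have hW : 0 ≤ ∫ t in (0 : ℝ)..a, w t ^ 2 :=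
    intervalIntegral.integral_nonneg h0.le fun t _ => sq_nonneg _
  have hA : 0 ≤ ∫ t in (0 : ℝ)..a, |w t| :=
    intervalIntegral.integral_nonneg h0.le fun t _ => abs_nonneg _
  have hu2 := pow_le_pow_left₀ (abs_nonneg _) hu 2
  rw [sq_abs, mul_pow] at hu2
  have hjordan : a ≤ sin (2 * a) := by
    have h := mul_le_sin (x := 2 * a) (by linarith) (by linarith)
    have h2 : a ≤ 2 / π * (2 * a) := by
      rw [div_mul_eq_mul_div, le_div_iff₀ pi_pos]
      nlinarith [pi_le_four]
    linarith
  have hcs := sq_integral_abs_le h0 hw hw2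
  rw [div_mul_eq_mul_div, div_le_iff₀ (by positivity)]
  calc cos (2 * a) * (∫ t in (0 : ℝ)..a, sin (2 * t) * w t) ^ 2
      ≤ 1 * (sin (2 * a) ^ 2 * (∫ t in (0 : ℝ)..a, |w t|) ^ 2) := by
        gcongr
        exact cos_le_one _
    _ ≤ sin (2 * a) ^ 2 * (a * ∫ t in (0 : ℝ)..a, w t ^ 2) := by
        rw [one_mul]
        gcongr
    _ ≤ sin (2 * a) ^ 2 * (sin (2 * a) * ∫ t in (0 : ℝ)..a, w t ^ 2) := by gcongr
    _ = (∫ t in (0 : ℝ)..a, w t ^ 2) * sin (2 * a) ^ 3 := by ring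

lemma weighted_hardy_pointwise {s c u w : ℝ} (hs : 0 < s) (h : s ^ 2 + c ^ 2 = 1) :
    2 * (u / s ^ 2) ^ 2 ≤ w ^ 2 -
      ((-2 * s * s ^ 3 - c * (3 * s ^ 2 * (2 * c))) / (s ^ 3) ^ 2 * u ^ 2 +
        c / s ^ 3 * (2 * u * (s * w))) := by
  have e : w ^ 2 - ((-2 * s * s ^ 3 - c * (3 * s ^ 2 * (2 * c))) / (s ^ 3) ^ 2 * u ^ 2 +
        c / s ^ 3 * (2 * u * (s * w))) =
      (w - c * (u / s ^ 2)) ^ 2 + (2 * (s ^ 2 + c ^ 2) + 3 * c ^ 2) * (u / s ^ 2) ^ 2 := by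
    field_simp
    ring
  rw [e, h]
  nlinarith [sq_nonneg (w - c * (u / s ^ 2)), sq_nonneg (c * (u / s ^ 2))]

/-- Weighted Hardy inequality on `[a, π/4]` for `u = ∫ sin (2t) w`. -/
lemma weighted_hardy_of_pos {w : ℝ → ℝ} {a : ℝ} (h0 : 0 < a) (h1 : a ≤ π / 4)
    (hw : IntervalIntegrable w volume 0 (π / 4))
    (hw2 : IntervalIntegrable (fun x => w x ^ 2) volume 0 (π / 4))
    (hv : IntervalIntegrable
      (fun x => ((∫ t in (0 : ℝ)..x, sin (2 * t) * w t) / sin (2 * x) ^ 2) ^ 2)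
      volume 0 (π / 4)) :
    2 * ∫ x in a..(π / 4), ((∫ t in (0 : ℝ)..x, sin (2 * t) * w t) / sin (2 * x) ^ 2) ^ 2 ≤
      ∫ x in (0 : ℝ)..(π / 4), w x ^ 2 := by
  set u : ℝ → ℝ := fun x => ∫ t in (0 : ℝ)..x, sin (2 * t) * w t with hu_def
  have hπ := pi_pos
  have hsub : uIcc a (π / 4) ⊆ uIcc 0 (π / 4) := by
    rw [uIcc_of_le h1, uIcc_of_le (by linarith)]
    exact Icc_subset_Icc_left h0.le
  have hsub' : uIcc 0 a ⊆ uIcc 0 (π / 4) := by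
    rw [uIcc_of_le h0.le, uIcc_of_le (by linarith)]
    exact Icc_subset_Icc_right h1
  have hsw : IntervalIntegrable (fun t => sin (2 * t) * w t) volume 0 (π / 4) :=
    hw.continuousOn_mul (by fun_prop)
  have hspos : ∀ x ∈ uIcc a (π / 4), 0 < sin (2 * x) := fun x hx => by
    rw [uIcc_of_le h1] at hx
    exact sin_two_mul_pos (by linarith [hx.1]) (by linarith [hx.2])
  have huac : AbsolutelyContinuousOnInterval u a (π / 4) :=
    (hsw.absolutelyContinuousOnInterval_intervalIntegral left_mem_uIcc).mono hsub
  have hcs : AbsolutelyContinuousOnInterval (fun x => cos (2 * x) / sin (2 * x) ^ 3) a (π / 4) := by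
    apply ContDiffOn.absolutelyContinuousOnInterval
    exact ContDiffOn.div (by fun_prop) (by fun_prop) fun x hx => (pow_pos (hspos x hx) 3).ne'
  have hFac := hcs.mul (huac.mul huac)
  obtain ⟨hki, hk⟩ := intervalIntegrable_and_integral_eq_sub_of_ae_hasDerivAt
    (F := fun x => cos (2 * x) / sin (2 * x) ^ 3 * u x ^ 2)
    (k := fun x => (-2 * sin (2 * x) * sin (2 * x) ^ 3
      - cos (2 * x) * (3 * sin (2 * x) ^ 2 * (2 * cos (2 * x)))) / (sin (2 * x) ^ 3) ^ 2 * u x ^ 2 +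
        cos (2 * x) / sin (2 * x) ^ 3 * (2 * u x * (sin (2 * x) * w x)))
    (by convert hFac using 1; ext x; simp [pow_two])
    (by
      filter_upwards [hsw.ae_hasDerivAt_integral] with x hx hm
      have hdu : HasDerivAt u (sin (2 * x) * w x) x := hx (hsub hm) 0 left_mem_uIcc
      have h3 := ((hasDerivAt_cos_two_mul x).fun_div ((hasDerivAt_sin_two_mul x).fun_pow 3)
        (pow_pos (hspos x hm) 3).ne').fun_mul (hdu.fun_pow 2)
      simpa using h3)
  have hwa := hw2.mono_set hsub
  have hle := intervalIntegral.integral_mono_on h1 ((hv.mono_set hsub).const_mul 2)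
    (hwa.sub hki) fun x hx =>
      weighted_hardy_pointwise (u := u x) (w := w x) (hspos x (by rwa [uIcc_of_le h1]))
        (sin_sq_add_cos_sq (2 * x))
  rw [intervalIntegral.integral_const_mul, intervalIntegral.integral_sub hwa hki, hk] at hle
  have hb := boundary_term_le h0 h1 (hw.mono_set hsub') (hw2.mono_set hsub')
  have hadd := intervalIntegral.integral_add_adjacent_intervals (hw2.mono_set hsub') hwa
  have hc : cos (2 * (π / 4)) = 0 := by
    rw [show 2 * (π / 4) = π / 2 by ring, cos_pi_div_two]
  rw [hc, zero_div, zero_mul] at hle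
  change cos (2 * a) / sin (2 * a) ^ 3 * u a ^ 2 ≤ _ at hb
  linarith

/-- Weighted Hardy inequality on `[0, π/4]` for `u = ∫ sin (2t) w`. -/
lemma weighted_hardy {w : ℝ → ℝ}
    (hw : IntervalIntegrable w volume 0 (π / 4))
    (hw2 : IntervalIntegrable (fun x => w x ^ 2) volume 0 (π / 4))
    (hv : IntervalIntegrable
      (fun x => ((∫ t in (0 : ℝ)..x, sin (2 * t) * w t) / sin (2 * x) ^ 2) ^ 2)
      volume 0 (π / 4)) :
    2 * ∫ x in (0 : ℝ)..(π / 4),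
        ((∫ t in (0 : ℝ)..x, sin (2 * t) * w t) / sin (2 * x) ^ 2) ^ 2 ≤
      ∫ x in (0 : ℝ)..(π / 4), w x ^ 2 := by
  have hπ : 0 < π / 4 := by linarith [pi_pos]
  have hcont := intervalIntegral.continuousOn_primitive_interval_left
    ((intervalIntegrable_iff' (by simp)).1 hv) 0 left_mem_uIcc
  rw [uIcc_of_le hπ.le] at hcont
  have ht := ((hcont.mono (Ioc_subset_Icc_self)).tendsto.const_mul 2)
  rw [nhdsWithin_Ioc_eq_nhdsGT hπ] at ht
  refine le_of_tendsto ht ?_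
  filter_upwards [Ioc_mem_nhdsGT hπ] with a ha
  exact weighted_hardy_of_pos ha.1 ha.2 hw hw2 hv

/-- The two halves of the weighted Hardy inequality, glued by the reflection `x ↦ π/2 - x`. -/
lemma weighted_hardy_pi_div_two {w : ℝ → ℝ}
    (hw : IntervalIntegrable w volume 0 (π / 2))
    (hw2 : IntervalIntegrable (fun x => w x ^ 2) volume 0 (π / 2))
    (hzero : ∫ t in (0 : ℝ)..(π / 2), sin (2 * t) * w t = 0)
    (hv : IntervalIntegrable
      (fun x => ((∫ t in (0 : ℝ)..x, sin (2 * t) * w t) / sin (2 * x) ^ 2) ^ 2)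
      volume 0 (π / 2)) :
    2 * ∫ x in (0 : ℝ)..(π / 2),
        ((∫ t in (0 : ℝ)..x, sin (2 * t) * w t) / sin (2 * x) ^ 2) ^ 2 ≤
      ∫ x in (0 : ℝ)..(π / 2), w x ^ 2 := by
  have hπ := pi_pos
  have hl : uIcc 0 (π / 4) ⊆ uIcc 0 (π / 2) := by
    rw [uIcc_of_le (by linarith), uIcc_of_le (by linarith)]
    exact Icc_subset_Icc_right (by linarith)
  have hr : uIcc (π / 4) (π / 2) ⊆ uIcc 0 (π / 2) := by
    rw [uIcc_of_le (by linarith), uIcc_of_le (by linarith)]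
    exact Icc_subset_Icc_left (by linarith)
  have hsin : ∀ x, sin (2 * (π / 2 - x)) = sin (2 * x) := fun x => by
    rw [← sin_pi_sub]
    ring_nf
  have hhalf : π / 2 - π / 4 = π / 4 := by ring
  have hreflect : ∀ {k : ℝ → ℝ}, IntervalIntegrable k volume 0 (π / 2) →
      IntervalIntegrable (fun x => k (π / 2 - x)) volume 0 (π / 4) := fun {k} hk => by
    have h := ((hk.mono_set hr).comp_sub_left (π / 2)).symm
    rwa [sub_self, hhalf] at h
  have hreflect_integral : ∀ k : ℝ → ℝ,
      ∫ x in (0 : ℝ)..(π / 4), k (π / 2 - x) = ∫ x in (π / 4)..(π / 2), k x := fun k => by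
    rw [intervalIntegral.integral_comp_sub_left, hhalf, sub_zero]
  have hsw : IntervalIntegrable (fun t => sin (2 * t) * w t) volume 0 (π / 2) :=
    hw.continuousOn_mul (by fun_prop)
  have hu : ∀ x ∈ uIcc 0 (π / 4), (∫ t in (0 : ℝ)..x, sin (2 * t) * -w (π / 2 - t)) =
      ∫ t in (0 : ℝ)..(π / 2 - x), sin (2 * t) * w t := fun x hx => by
    rw [uIcc_of_le (by linarith)] at hx
    have h1 : (∫ t in (0 : ℝ)..x, sin (2 * t) * -w (π / 2 - t)) =
        -∫ t in (π / 2 - x)..(π / 2), sin (2 * t) * w t := by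
      rw [← intervalIntegral.integral_neg]
      have h := intervalIntegral.integral_comp_sub_left (a := 0) (b := x)
        (fun t => -(sin (2 * t) * w t)) (π / 2)
      rw [sub_zero] at h
      rw [← h]
      simp only [hsin, mul_neg]
    have hm : π / 2 - x ∈ uIcc 0 (π / 2) := by
      rw [uIcc_of_le (by linarith)]
      constructor <;> linarith [hx.1, hx.2]
    have h2 := intervalIntegral.integral_add_adjacent_intervals
      (hsw.mono_set (uIcc_subset_uIcc_left hm)) (hsw.mono_set (uIcc_subset_uIcc_right hm))
    linarith
  have hv_eq : EqOn
      (fun x => ((∫ t in (0 : ℝ)..(π / 2 - x), sin (2 * t) * w t)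
        / sin (2 * (π / 2 - x)) ^ 2) ^ 2)
      (fun x => ((∫ t in (0 : ℝ)..x, sin (2 * t) * -w (π / 2 - t)) / sin (2 * x) ^ 2) ^ 2)
      (uIcc 0 (π / 4)) := fun x hx => by
    simp only [hu x hx, hsin]
  have h1 := weighted_hardy (hw.mono_set hl) (hw2.mono_set hl) (hv.mono_set hl)
  have h2 := weighted_hardy (w := fun t => -w (π / 2 - t)) (hreflect hw).neg
    (by simpa only [neg_sq] using hreflect hw2)
    ((hreflect hv).congr (hv_eq.mono uIoc_subset_uIcc))
  rw [← intervalIntegral.integral_congr hv_eq, hreflect_integral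
    (fun x => ((∫ t in (0 : ℝ)..x, sin (2 * t) * w t) / sin (2 * x) ^ 2) ^ 2)] at h2
  simp only [neg_sq] at h2
  rw [hreflect_integral (fun x => w x ^ 2)] at h2
  rw [← intervalIntegral.integral_add_adjacent_intervals (hv.mono_set hl) (hv.mono_set hr),
    ← intervalIntegral.integral_add_adjacent_intervals (hw2.mono_set hl) (hw2.mono_set hr)]
  linarith

lemma absolutelyContinuousOnInterval_const_add_integral {g : ℝ → ℝ} (hg : Integrable g)
    (p a b : ℝ) :
    AbsolutelyContinuousOnInterval (fun x => p + ∫ t in (0 : ℝ)..x, g t) a b := by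
  have h1 : AbsolutelyContinuousOnInterval (fun x => p + ∫ t in a..x, g t) a b :=
    (contDiff_const (c := p)).contDiffOn.absolutelyContinuousOnInterval.add
      (hg.intervalIntegrable.absolutelyContinuousOnInterval_intervalIntegral left_mem_uIcc)
  have h2 := (contDiff_const (c := ∫ t in (0 : ℝ)..a, g t)
    (n := 1)).contDiffOn.absolutelyContinuousOnInterval.add h1
  have e : (fun x => p + ∫ t in (0 : ℝ)..x, g t) =
      (fun _ => ∫ t in (0 : ℝ)..a, g t) + fun x => p + ∫ t in a..x, g t := by
    funext x
    rw [Pi.add_apply, ← intervalIntegral.integral_add_adjacent_intervals (a := 0) (b := a) (c := x)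
      hg.intervalIntegrable hg.intervalIntegrable]
    ring
  rwa [e]

lemma contDiffOn_tan_sub : ContDiffOn ℝ 1 (fun x => tan (x - π / 4)) (uIcc 0 (π / 2)) := by
  intro x hx
  rw [uIcc_of_le (by linarith [pi_pos])] at hx
  have hc : cos (x - π / 4) ≠ 0 :=
    (cos_pos_of_mem_Ioo ⟨by linarith [hx.1, pi_pos], by linarith [hx.2, pi_pos]⟩).ne'
  exact (ContDiffAt.comp (g := tan) x (contDiffAt_tan.2 hc)
    (contDiffAt_id.sub contDiffAt_const)).contDiffWithinAt

/-- The energy estimate `∫ (f'' + 4 f)² ≤ 9 ∫ f''²` under Dirichlet conditions. -/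
lemma integral_sq_add_four_mul_le {g P Q : ℝ → ℝ}
    (hgi : IntervalIntegrable g volume 0 (π / 2))
    (hg2 : IntervalIntegrable (fun x => g x ^ 2) volume 0 (π / 2))
    (hP : AbsolutelyContinuousOnInterval P 0 (π / 2))
    (hPd : ∀ᵐ x, x ∈ uIcc 0 (π / 2) → HasDerivAt P (g x) x)
    (hQd : ∀ x, HasDerivAt Q (P x) x) (hQac : AbsolutelyContinuousOnInterval Q 0 (π / 2))
    (hQ0 : Q 0 = 0) (hQ1 : Q (π / 2) = 0) :
    IntervalIntegrable (fun x => (g x + 4 * Q x) ^ 2) volume 0 (π / 2) ∧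
      ∫ x in (0 : ℝ)..(π / 2), (g x + 4 * Q x) ^ 2 ≤ 9 * ∫ x in (0 : ℝ)..(π / 2), g x ^ 2 := by
  have hπ := pi_pos
  have hQc : Continuous Q := continuous_iff_continuousAt.2 fun x => (hQd x).continuousAt
  have hi : IntervalIntegrable (fun x => (g x + 4 * Q x) ^ 2) volume 0 (π / 2) := by
    have h := (hg2.add ((hgi.mul_continuousOn (g := Q) hQc.continuousOn).const_mul 8)).add
      (ContinuousOn.intervalIntegrable (u := fun x => 16 * Q x ^ 2) (by fun_prop))
    exact h.congr fun x _ => by ring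
  refine ⟨hi, ?_⟩
  have hac := (hP.mul hQac).add
    (contDiffOn_tan_sub.absolutelyContinuousOnInterval.mul (hQac.mul hQac))
  obtain ⟨hki, hk⟩ := intervalIntegrable_and_integral_eq_sub_of_ae_hasDerivAt
    (F := fun x => P x * Q x + tan (x - π / 4) * (Q x * Q x))
    (a := 0) (b := π / 2)
    (k := fun x => (g x * Q x + P x * P x) +
      ((1 + tan (x - π / 4) ^ 2) * (Q x * Q x) + tan (x - π / 4) * (P x * Q x + Q x * P x)))
    hac
    (by
      filter_upwards [hPd] with x hx hm
      rw [uIcc_of_le (by linarith)] at hm hx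
      have hc : cos (x - π / 4) ≠ 0 :=
        (cos_pos_of_mem_Ioo ⟨by linarith [hm.1], by linarith [hm.2]⟩).ne'
      have ht : HasDerivAt (fun y => tan (y - π / 4)) (1 + tan (x - π / 4) ^ 2) x := by
        have h := (hasDerivAt_tan hc).comp_sub_const x (π / 4)
        rwa [one_div, ← inv_one_add_tan_sq hc, inv_inv] at h
      exact ((hx hm).fun_mul (hQd x)).fun_add (ht.fun_mul ((hQd x).fun_mul (hQd x))))
  have hle := intervalIntegral.integral_mono_on (by linarith) hi
    ((hg2.const_mul 9).add (hki.const_mul 24)) fun x _ => by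
      nlinarith [sq_nonneg (g x + Q x), sq_nonneg (P x + tan (x - π / 4) * Q x)]
  rw [intervalIntegral.integral_add (hg2.const_mul 9) (hki.const_mul 24),
    intervalIntegral.integral_const_mul, intervalIntegral.integral_const_mul, hk] at hle
  simpa [hQ0, hQ1] using hle

/-- The Hardy inequality for a twice-integrated function `Q` with globally integrable second
derivative `g`. -/
lemma hardy_second_order_of_integrable {g P Q : ℝ → ℝ} (hg : Integrable g)
    (hg2 : Integrable fun x => g x ^ 2)
    (hP : ∀ x, P x = P 0 + ∫ t in (0 : ℝ)..x, g t)
    (hQ : ∀ x, Q x = ∫ t in (0 : ℝ)..x, P t) (hQ1 : Q (π / 2) = 0) :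
    ∫ θ in (0 : ℝ)..(π / 2),
        ((sin (2 * θ) * P θ - 2 * cos (2 * θ) * Q θ) / sin (2 * θ) ^ 2) ^ 2 ≤
      10 * ∫ θ in (0 : ℝ)..(π / 2), g θ ^ 2 := by
  have hg2nn : 0 ≤ ∫ θ in (0 : ℝ)..(π / 2), g θ ^ 2 :=
    intervalIntegral.integral_nonneg (by linarith [pi_pos]) fun t _ => sq_nonneg _
  by_cases hint : IntervalIntegrable
      (fun θ => ((sin (2 * θ) * P θ - 2 * cos (2 * θ) * Q θ) / sin (2 * θ) ^ 2) ^ 2)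
      volume 0 (π / 2)
  swap
  · rw [intervalIntegral.integral_undef hint]
    positivity
  have hQ0 : Q 0 = 0 := by simp [hQ 0]
  have hPac : ∀ a b, AbsolutelyContinuousOnInterval P a b := fun a b => by
    rw [funext hP]
    exact absolutelyContinuousOnInterval_const_add_integral hg _ a b
  have hPd : ∀ᵐ x, HasDerivAt P (g x) x := by
    filter_upwards [LocallyIntegrable.ae_hasDerivAt_integral hg.locallyIntegrable] with x hx
    rw [funext hP]
    exact (hx 0).const_add _
  have hPc : Continuous P := by
    rw [funext hP]
    exact continuous_const.add (hg.continuous_primitive 0)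
  have hQd : ∀ x, HasDerivAt Q (P x) x := fun x => by
    rw [funext hQ]
    exact hPc.integral_hasStrictDerivAt 0 x |>.hasDerivAt
  have hQc : Continuous Q := continuous_iff_continuousAt.2 fun x => (hQd x).continuousAt
  have hQac : ∀ a b, AbsolutelyContinuousOnInterval Q a b := fun a b => by
    refine ContDiffOn.absolutelyContinuousOnInterval (ContDiff.contDiffOn ?_)
    rw [contDiff_one_iff_deriv]
    exact ⟨fun x => (hQd x).differentiableAt, by rwa [funext fun x => (hQd x).deriv]⟩
  have hu : ∀ x, ∫ t in (0 : ℝ)..x, sin (2 * t) * (g t + 4 * Q t) =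
      sin (2 * x) * P x - 2 * cos (2 * x) * Q x := fun x => by
    have hs : AbsolutelyContinuousOnInterval (fun y => sin (2 * y)) 0 x :=
      ContDiffOn.absolutelyContinuousOnInterval (by fun_prop)
    have hc : AbsolutelyContinuousOnInterval (fun y => 2 * cos (2 * y)) 0 x :=
      ContDiffOn.absolutelyContinuousOnInterval (by fun_prop)
    rw [(intervalIntegrable_and_integral_eq_sub_of_ae_hasDerivAt
      (F := fun y => sin (2 * y) * P y - 2 * cos (2 * y) * Q y)
      ((hs.mul (hPac 0 x)).sub (hc.mul (hQac 0 x))) ?_).2]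
    · simp [hQ0]
    · filter_upwards [hPd] with y hy _
      refine (((hasDerivAt_sin_two_mul y).fun_mul hy).fun_sub
        (((hasDerivAt_cos_two_mul y).const_mul 2).fun_mul (hQd y))).congr_deriv ?_
      ring
  obtain ⟨hw2, hle⟩ := integral_sq_add_four_mul_le hg.intervalIntegrable hg2.intervalIntegrable
    (hPac _ _) (hPd.mono fun x hx _ => hx) hQd (hQac _ _) hQ0 hQ1
  have hw : IntervalIntegrable (fun x => g x + 4 * Q x) volume 0 (π / 2) :=
    hg.intervalIntegrable.add (Continuous.intervalIntegrable (by fun_prop) _ _)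
  have hmain := weighted_hardy_pi_div_two hw hw2
    (by simp [hu, hQ1, show 2 * (π / 2) = π by ring]) (by simpa only [hu] using hint)
  simp only [hu] at hmain
  linarith

/-- Second-order Hardy-type inequality: if `f ∈ H²([0,π/2])` (i.e. `f` is `C¹` with an
absolutely continuous first derivative `f'` whose derivative `g = f''` is in `L²`) and
`f(0) = f(π/2) = 0`, then
`∫_0^{π/2} (d/dθ (f(θ)/sin(2θ)))² dθ ≤ 10 ∫_0^{π/2} f''(θ)² dθ`. -/
theorem hardy_second_order (f f' g : ℝ → ℝ)
    (hf'cont : ContinuousOn f' (Icc 0 (π / 2)))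
    (hgm : Measurable g)
    (hg1 : IntegrableOn g (Icc 0 (π / 2)))
    (hg2 : IntegrableOn (fun θ => g θ ^ 2) (Icc 0 (π / 2)))
    (hf : ∀ x ∈ Icc (0 : ℝ) (π / 2), f x = f 0 + ∫ t in (0 : ℝ)..x, f' t)
    (hf' : ∀ x ∈ Icc (0 : ℝ) (π / 2), f' x = f' 0 + ∫ t in (0 : ℝ)..x, g t)
    (h0 : f 0 = 0) (h1 : f (π / 2) = 0) :
    ∫ θ in Icc 0 (π / 2), (deriv (fun t => f t / Real.sin (2 * t)) θ) ^ 2 ≤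
      10 * ∫ θ in Icc 0 (π / 2), g θ ^ 2 := by
  have hπ : 0 ≤ π / 2 := by linarith [pi_pos]
  set G : ℝ → ℝ := (Icc 0 (π / 2)).indicator g with hG
  set P : ℝ → ℝ := fun x => f' 0 + ∫ t in (0 : ℝ)..x, G t with hP
  set Q : ℝ → ℝ := fun x => ∫ t in (0 : ℝ)..x, P t with hQ
  have hGi : Integrable G := hg1.integrable_indicator measurableSet_Icc
  have hG2 : Integrable fun x => G x ^ 2 := by
    have e : (fun x => G x ^ 2) = (Icc 0 (π / 2)).indicator fun x => g x ^ 2 := by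
      funext x
      by_cases hx : x ∈ Icc 0 (π / 2) <;> simp [hG, hx]
    rw [e]
    exact hg2.integrable_indicator measurableSet_Icc
  have hsub : ∀ x ∈ Icc (0 : ℝ) (π / 2), uIcc 0 x ⊆ Icc 0 (π / 2) := fun x hx => by
    rw [uIcc_of_le hx.1]
    exact Icc_subset_Icc_right hx.2
  have hPf : ∀ x ∈ Icc (0 : ℝ) (π / 2), P x = f' x := fun x hx => by
    rw [hf' x hx]
    refine congrArg _ (intervalIntegral.integral_congr fun t ht => ?_)
    exact indicator_of_mem (hsub x hx ht) g
  have hQf : ∀ x ∈ Icc (0 : ℝ) (π / 2), Q x = f x := fun x hx => by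
    rw [hf x hx, h0, zero_add]
    exact intervalIntegral.integral_congr fun t ht => hPf t (hsub x hx ht)
  have hPc : Continuous P := continuous_const.add (hGi.continuous_primitive 0)
  have hmain := hardy_second_order_of_integrable (P := P) (Q := Q) hGi hG2
    (fun x => by simp [hP]) (fun _ => rfl) (by rw [hQf _ (right_mem_Icc.2 hπ), h1])
  have hL : ∫ θ in Icc 0 (π / 2), (deriv (fun t => f t / Real.sin (2 * t)) θ) ^ 2 =
      ∫ θ in (0 : ℝ)..(π / 2),
        ((sin (2 * θ) * P θ - 2 * cos (2 * θ) * Q θ) / sin (2 * θ) ^ 2) ^ 2 := by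
    rw [intervalIntegral.integral_of_le hπ, integral_Icc_eq_integral_Ioo,
      integral_Ioc_eq_integral_Ioo]
    refine setIntegral_congr_fun measurableSet_Ioo fun θ hθ => ?_
    have hfd : HasDerivAt f (P θ) θ := by
      refine (hPc.integral_hasStrictDerivAt 0 θ).hasDerivAt.congr_of_eventuallyEq ?_
      filter_upwards [Icc_mem_nhds hθ.1 hθ.2] with y hy using (hQf y hy).symm
    have hd := (hfd.fun_div (hasDerivAt_sin_two_mul θ) (sin_two_mul_pos hθ.1 hθ.2).ne').deriv
    simp only [hd, hQf θ (Ioo_subset_Icc_self hθ)]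
    ring
  have hR : ∫ θ in Icc 0 (π / 2), g θ ^ 2 = ∫ θ in (0 : ℝ)..(π / 2), G θ ^ 2 := by
    rw [intervalIntegral.integral_of_le hπ, ← integral_Icc_eq_integral_Ioc]
    refine setIntegral_congr_fun measurableSet_Icc fun θ hθ => ?_
    simp only [hG, indicator_of_mem hθ]
  rw [hL, hR]
  exact hmain
end
end

section
/- Pointwise bounds from weighted derivative integrals: there is a universal constant C > 0 such that for every γ ∈ (1, 5/4] and every g ∈ C_c^∞((0,∞)×(0,π/2)): (i) for every z > 0, sup_{θ∈[0,π/2]} |g(z,θ)|² ≤ (C/(γ−1)) ∫₀^{π/2} |∂_θ g(z,θ)|² sin(2θ)^{2−γ} dθ, and (ii) for every θ ∈ [0,π/2], sup_{z>0} |g(z,θ)|² ≤ C ∫₀^∞ |z∂_z g(z,θ)|² (1+z)⁴/z⁴ dz. -/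
open Real MeasureTheory Set

noncomputable section

/-- Cauchy-Schwarz for integrals: if `h ^ 2 ≤ A * B` almost everywhere with `A, B ≥ 0`, then
`(∫ h) ^ 2 ≤ (∫ A) * ∫ B`. -/
theorem sq_integral_le_mul_integral {α : Type*} [MeasurableSpace α] {μ : Measure α}
    {h A B : α → ℝ} (hh : Integrable h μ) (hA : Integrable A μ) (hB : Integrable B μ)
    (hle : ∀ᵐ x ∂μ, 0 ≤ A x ∧ 0 ≤ B x ∧ h x ^ 2 ≤ A x * B x) :
    (∫ x, h x ∂μ) ^ 2 ≤ (∫ x, A x ∂μ) * ∫ x, B x ∂μ := by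
  have key : ∀ l : ℝ, 0 ≤ (∫ x, A x ∂μ) * (l * l) + (2 * ∫ x, h x ∂μ) * l + ∫ x, B x ∂μ := by
    intro l
    have h1 : 0 ≤ ∫ x, (A x * (l * l) + h x * (2 * l) + B x) ∂μ := by
      refine integral_nonneg_of_ae ?_
      filter_upwards [hle] with x ⟨ha, hb, hab⟩
      change 0 ≤ A x * (l * l) + h x * (2 * l) + B x
      rcases ha.eq_or_lt with ha | ha
      · rw [← ha, zero_mul] at hab
        have : h x = 0 := by nlinarith
        rw [← ha, this]
        linarith
      · refine nonneg_of_mul_nonneg_right (a := A x) ?_ ha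
        nlinarith [sq_nonneg (A x * l + h x)]
    have hAh : Integrable (fun x => A x * (l * l) + h x * (2 * l)) μ :=
      (hA.mul_const _).add (hh.mul_const _)
    rw [integral_add hAh hB, integral_add (hA.mul_const _) (hh.mul_const _), integral_mul_const,
      integral_mul_const] at h1
    linarith
  have := discrim_le_zero key
  rw [discrim] at this
  linarith

/-- Weighted form of the fundamental theorem of calculus for functions vanishing at `a`. -/
theorem sq_le_mul_setIntegral_of_deriv_sq_le {f A B : ℝ → ℝ} (hf : ContDiff ℝ 1 f) {a x : ℝ}
    (hax : a ≤ x) (ha : f a = 0) (hA : IntegrableOn A (Ioo a x)) (hB : IntegrableOn B (Ioo a x))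
    (hle : ∀ t ∈ Ioo a x, 0 ≤ A t ∧ 0 ≤ B t ∧ deriv f t ^ 2 ≤ A t * B t) :
    f x ^ 2 ≤ (∫ t in Ioo a x, A t) * ∫ t in Ioo a x, B t := by
  have hc : Continuous (deriv f) := hf.continuous_deriv le_rfl
  have hfx : f x = ∫ t in Ioo a x, deriv f t := by
    rw [← integral_Ioc_eq_integral_Ioo, ← intervalIntegral.integral_of_le hax,
      intervalIntegral.integral_deriv_eq_sub
        (fun t _ => (hf.differentiable one_ne_zero).differentiableAt)
        (hc.intervalIntegrable _ _), ha, sub_zero]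
  rw [hfx]
  refine sq_integral_le_mul_integral ?_ hA hB (ae_restrict_of_forall_mem measurableSet_Ioo hle)
  exact (hc.integrableOn_Icc (a := a) (b := x)).mono_set Ioo_subset_Icc_self

theorem le_sin_two_mul {t : ℝ} (h0 : 0 ≤ t) (h1 : t ≤ π / 4) : t ≤ sin (2 * t) := by
  have h := mul_le_sin (x := 2 * t) (by linarith) (by linarith)
  refine le_trans ?_ h
  have : (1 : ℝ) / 2 ≤ 2 / π := by
    rw [div_le_div_iff₀ two_pos pi_pos]
    linarith [pi_le_four]
  nlinarith

theorem one_le_sin_two_mul_rpow_mul {t p : ℝ} (ht : t ∈ Ioo 0 (π / 2)) (hp : 0 ≤ p) :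
    1 ≤ sin (2 * t) ^ p * (t ^ (-p) + (π / 2 - t) ^ (-p)) := by
  obtain ⟨h0, h1⟩ := ht
  have aux : ∀ s : ℝ, 0 < s → s ≤ sin (2 * t) → 1 ≤ sin (2 * t) ^ p * s ^ (-p) := by
    intro s hs hst
    rw [rpow_neg hs.le, ← div_eq_mul_inv, one_le_div (rpow_pos_of_pos hs _)]
    exact rpow_le_rpow hs.le hst hp
  have hsin : 0 ≤ sin (2 * t) := sin_nonneg_of_nonneg_of_le_pi (by linarith) (by linarith)
  have e1 : 0 ≤ sin (2 * t) ^ p * t ^ (-p) :=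
    mul_nonneg (rpow_nonneg hsin _) (rpow_nonneg h0.le _)
  have e2 : 0 ≤ sin (2 * t) ^ p * (π / 2 - t) ^ (-p) :=
    mul_nonneg (rpow_nonneg hsin _) (rpow_nonneg (by linarith) _)
  rw [mul_add]
  rcases le_total t (π / 4) with h | h
  · linarith [aux t h0 (le_sin_two_mul h0.le h)]
  · have h2 := le_sin_two_mul (t := π / 2 - t) (by linarith) (by linarith)
    rw [show 2 * (π / 2 - t) = π - 2 * t by ring, sin_pi_sub] at h2
    linarith [aux _ (by linarith) h2]

theorem intervalIntegrable_rpow_neg_add_reflect {b p : ℝ} (hp : p < 1) :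
    IntervalIntegrable (fun t : ℝ => t ^ (-p) + (b - t) ^ (-p)) volume 0 b := by
  have h : IntervalIntegrable (fun t : ℝ => t ^ (-p)) volume 0 b :=
    intervalIntegral.intervalIntegrable_rpow' (by linarith)
  refine h.add ?_
  simpa using (h.comp_sub_left b).symm

theorem integral_rpow_neg_add_reflect {b p : ℝ} (hp : p < 1) :
    ∫ t in (0 : ℝ)..b, (t ^ (-p) + (b - t) ^ (-p)) = 2 * (b ^ (1 - p) / (1 - p)) := by
  have h : IntervalIntegrable (fun t : ℝ => t ^ (-p)) volume 0 b :=
    intervalIntegral.intervalIntegrable_rpow' (by linarith)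
  rw [intervalIntegral.integral_add h (by simpa using (h.comp_sub_left b).symm),
    intervalIntegral.integral_comp_sub_left (fun t : ℝ => t ^ (-p)) b, sub_self, sub_zero,
    integral_rpow (Or.inl (by linarith)), neg_add_eq_sub, zero_rpow (by linarith), sub_zero]
  ring

theorem sq_le_integral_deriv_sq_mul_sin_rpow {f : ℝ → ℝ} (hf : ContDiff ℝ 1 f) (h0 : f 0 = 0)
    {γ : ℝ} (hγ : γ ∈ Ioc (1 : ℝ) 2) {θ : ℝ} (hθ : θ ∈ Icc (0 : ℝ) (π / 2)) :
    f θ ^ 2 ≤ 4 / (γ - 1) * ∫ t in Icc 0 (π / 2), deriv f t ^ 2 * sin (2 * t) ^ (2 - γ) := by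
  obtain ⟨hγ1, hγ2⟩ := hγ
  have hpi : 0 ≤ π / 2 := by positivity
  have hsub : Ioo 0 θ ⊆ Icc 0 (π / 2) := fun t ht => ⟨ht.1.le, ht.2.le.trans hθ.2⟩
  have hAnn : ∀ t ∈ Icc 0 (π / 2), 0 ≤ deriv f t ^ 2 * sin (2 * t) ^ (2 - γ) := fun t ht =>
    mul_nonneg (sq_nonneg _) (rpow_nonneg
      (sin_nonneg_of_nonneg_of_le_pi (by linarith [ht.1]) (by linarith [ht.2])) _)
  have hBnn : ∀ t ∈ Icc 0 (π / 2), 0 ≤ t ^ (-(2 - γ)) + (π / 2 - t) ^ (-(2 - γ)) := fun t ht =>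
    add_nonneg (rpow_nonneg ht.1 _) (rpow_nonneg (by linarith [ht.2]) _)
  have hA : IntegrableOn (fun t => deriv f t ^ 2 * sin (2 * t) ^ (2 - γ)) (Icc 0 (π / 2)) := by
    refine Continuous.integrableOn_Icc (((hf.continuous_deriv le_rfl).pow 2).mul ?_)
    exact (by fun_prop : Continuous fun t : ℝ => sin (2 * t)).rpow_const
      fun _ => Or.inr (by linarith)
  have hB : IntegrableOn (fun t : ℝ => t ^ (-(2 - γ)) + (π / 2 - t) ^ (-(2 - γ)))
      (Icc 0 (π / 2)) := by
    rw [integrableOn_Icc_iff_integrableOn_Ioc, ← intervalIntegrable_iff_integrableOn_Ioc_of_le hpi]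
    exact intervalIntegrable_rpow_neg_add_reflect (by linarith)
  have key := sq_le_mul_setIntegral_of_deriv_sq_le hf hθ.1 h0 (hA.mono_set hsub)
    (hB.mono_set hsub) fun t ht => ⟨hAnn t (hsub ht), hBnn t (hsub ht), by
      have := one_le_sin_two_mul_rpow_mul (p := 2 - γ) ⟨ht.1, ht.2.trans_le hθ.2⟩ (by linarith)
      rw [mul_assoc]
      exact le_mul_of_one_le_right (sq_nonneg _) this⟩
  have hIA := setIntegral_mono_set hA (ae_restrict_of_forall_mem measurableSet_Icc hAnn)
    hsub.eventuallyLE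
  have hIB := setIntegral_mono_set hB (ae_restrict_of_forall_mem measurableSet_Icc hBnn)
    hsub.eventuallyLE
  have hBval : ∫ t in Icc 0 (π / 2), (t ^ (-(2 - γ)) + (π / 2 - t) ^ (-(2 - γ)))
      ≤ 4 / (γ - 1) := by
    rw [integral_Icc_eq_integral_Ioc, ← intervalIntegral.integral_of_le hpi,
      integral_rpow_neg_add_reflect (by linarith), show 1 - (2 - γ) = γ - 1 by ring,
      ← mul_div_assoc]
    refine div_le_div_of_nonneg_right ?_ (by linarith)
    have : (π / 2) ^ (γ - 1) ≤ (π / 2) ^ (1 : ℝ) :=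
      rpow_le_rpow_of_exponent_le (by linarith [two_le_pi]) (by linarith)
    rw [rpow_one] at this
    linarith [pi_le_four]
  rw [mul_comm]
  refine key.trans (mul_le_mul hIA (hIB.trans hBval)
    (setIntegral_nonneg measurableSet_Ioo fun t ht => hBnn t (hsub ht))
    (setIntegral_nonneg measurableSet_Icc hAnn))

theorem sq_le_integral_Ioi_mul_deriv_sq {f : ℝ → ℝ} (hf : ContDiff ℝ 1 f)
    {K : Set ℝ} (hK : IsCompact K) (hK0 : K ⊆ Ioi 0) (hfK : Function.support f ⊆ K) {z : ℝ}
    (hz : 0 < z) :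
    f z ^ 2 ≤ ∫ s in Ioi (0 : ℝ), (s * deriv f s) ^ 2 * (1 + s) ^ 4 / s ^ 4 := by
  have h0 : f 0 = 0 := by
    by_contra h
    exact lt_irrefl (0 : ℝ) (mem_Ioi.1 (hK0 (hfK h)))
  have hAnn : ∀ s ∈ Ioi (0 : ℝ), 0 ≤ (s * deriv f s) ^ 2 * (1 + s) ^ 4 / s ^ 4 := fun s _ => by
    positivity
  have hA : IntegrableOn (fun s => (s * deriv f s) ^ 2 * (1 + s) ^ 4 / s ^ 4) (Ioi 0) := by
    have hc : ContinuousOn (fun s => (s * deriv f s) ^ 2 * (1 + s) ^ 4 / s ^ 4) K := by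
      have := hf.continuous_deriv le_rfl
      exact ContinuousOn.div (by fun_prop) (by fun_prop) fun s hs => pow_ne_zero _ (hK0 hs).ne'
    refine (hc.integrableOn_compact hK).of_forall_sdiff_eq_zero measurableSet_Ioi fun s hs => ?_
    have : deriv f s = 0 := by
      by_contra h
      exact hs.2 (closure_minimal hfK hK.isClosed (support_deriv_subset h))
    simp [this]
  have hsub : Ioo 0 z ⊆ Ioi 0 := fun t ht => ht.1
  have hpos : ∀ s ∈ uIcc 0 z, 1 + s ≠ 0 := fun s hs => by
    rw [uIcc_of_le hz.le] at hs
    linarith [hs.1]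
  have hcB : ContinuousOn (fun s : ℝ => ((1 + s) ^ 2)⁻¹) (uIcc 0 z) :=
    ContinuousOn.inv₀ (by fun_prop) fun s hs => pow_ne_zero _ (hpos s hs)
  have hB : IntegrableOn (fun s : ℝ => ((1 + s) ^ 2)⁻¹) (Ioo 0 z) := by
    rw [uIcc_of_le hz.le] at hcB
    exact (hcB.integrableOn_compact isCompact_Icc).mono_set Ioo_subset_Icc_self
  have key := sq_le_mul_setIntegral_of_deriv_sq_le hf hz.le h0 (hA.mono_set hsub) hB
    fun s hs => ⟨hAnn s (hsub hs), by positivity, by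
      have hs0 : 0 < s := hs.1
      have e : (s * deriv f s) ^ 2 * (1 + s) ^ 4 / s ^ 4 * ((1 + s) ^ 2)⁻¹
          = deriv f s ^ 2 * ((1 + s) / s) ^ 2 := by
        field_simp
      rw [e]
      refine le_mul_of_one_le_right (sq_nonneg _) (one_le_pow₀ ?_)
      rw [one_le_div hs0]
      linarith⟩
  have hIA := setIntegral_mono_set hA (ae_restrict_of_forall_mem measurableSet_Ioi hAnn)
    hsub.eventuallyLE
  have hIB : ∫ s in Ioo 0 z, ((1 + s) ^ 2)⁻¹ ≤ 1 := by
    rw [← integral_Ioc_eq_integral_Ioo, ← intervalIntegral.integral_of_le hz.le,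
      intervalIntegral.integral_eq_sub_of_hasDerivAt (f := fun s : ℝ => -(1 + s)⁻¹) ?_
        hcB.intervalIntegrable]
    · norm_num
      positivity
    · intro s hs
      refine (((hasDerivAt_id' s).const_add 1).fun_inv (hpos s hs)).fun_neg.congr_deriv ?_
      simp [neg_div]
  rw [← mul_one (∫ s in Ioi (0 : ℝ), _)]
  exact key.trans (mul_le_mul hIA hIB
    (setIntegral_nonneg measurableSet_Ioo fun t _ => by positivity)
    (setIntegral_nonneg measurableSet_Ioi hAnn))

/-- Pointwise bounds from weighted derivative integrals: there is a universal constant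
`C > 0` such that for every `γ ∈ (1, 5/4]` and every `g ∈ C_c^∞((0,∞)×(0,π/2))`:
(i) for every `z > 0` and every `θ ∈ [0,π/2]`,
`|g(z,θ)|² ≤ (C/(γ−1)) ∫_0^{π/2} |∂_θ g(z,t)|² sin(2t)^{2−γ} dt`, and
(ii) for every `θ ∈ [0,π/2]` and every `z > 0`,
`|g(z,θ)|² ≤ C ∫_0^∞ |s ∂_z g(s,θ)|² (1+s)⁴/s⁴ ds`. -/
theorem pointwise_bounds_from_weighted_integrals :
    ∃ C : ℝ, 0 < C ∧ ∀ γ ∈ Ioc (1 : ℝ) (5 / 4), ∀ g : ℝ → ℝ → ℝ,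
      ContDiff ℝ (⊤ : ℕ∞) (Function.uncurry g) →
      HasCompactSupport (Function.uncurry g) →
      tsupport (Function.uncurry g) ⊆ Ioi 0 ×ˢ Ioo 0 (π / 2) →
      (∀ z : ℝ, 0 < z → ∀ θ ∈ Icc (0 : ℝ) (π / 2),
        g z θ ^ 2 ≤ C / (γ - 1) *
          ∫ t in Icc 0 (π / 2),
            (deriv (fun u => g z u) t) ^ 2 * Real.sin (2 * t) ^ (2 - γ)) ∧
      (∀ θ ∈ Icc (0 : ℝ) (π / 2), ∀ z : ℝ, 0 < z →
        g z θ ^ 2 ≤ C *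
          ∫ s in Ioi (0 : ℝ),
            (s * deriv (fun u => g u θ) s) ^ 2 * (1 + s) ^ 4 / s ^ 4) := by
  refine ⟨4, by norm_num, fun γ hγ g hg hc hs => ⟨fun z _ θ hθ => ?_, fun θ _ z hz => ?_⟩⟩
  · refine sq_le_integral_deriv_sq_mul_sin_rpow (f := fun u => g z u) ?_ ?_
      ⟨hγ.1, hγ.2.trans (by norm_num)⟩ hθ
    · exact (hg.comp (contDiff_const.prodMk contDiff_id)).of_le (by exact_mod_cast le_top)
    · by_contra h
      have hmem : ((z, 0) : ℝ × ℝ) ∈ tsupport (Function.uncurry g) := subset_tsupport _ h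
      exact lt_irrefl _ (hs hmem).2.1
  · have key := sq_le_integral_Ioi_mul_deriv_sq (f := fun u => g u θ)
      ((hg.comp (contDiff_id.prodMk contDiff_const)).of_le (by exact_mod_cast le_top))
      (hc.isCompact.image continuous_fst)
      (by rintro _ ⟨p, hp, rfl⟩; exact (hs hp).1)
      (fun u hu => ⟨(u, θ), subset_tsupport _ hu, rfl⟩) hz
    have hnn : 0 ≤ ∫ s in Ioi (0 : ℝ),
        (s * deriv (fun u => g u θ) s) ^ 2 * (1 + s) ^ 4 / s ^ 4 :=
      setIntegral_nonneg measurableSet_Ioi fun s _ => by positivity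
    linarith
end
end

section
/- L^∞ embedding of the weighted space 𝓗²: there is a universal constant C > 0 such that for every α ∈ (0,1], with γ = 1 + α/10 and η = 99/100, and every g ∈ C_c^∞((0,∞)×(0,π/2)), one has ‖g‖_{L^∞} ≤ (C/√(γ−1))·|g|_{𝓗²}, where |g|²_{𝓗²} := Σ_{k=0}^{2} ‖(D_z)^k g · w/sin(2θ)^{η/2}‖²_{L²} + ‖(D_θ g)·w/sin(2θ)^{γ/2}‖²_{L²} + ‖(D_θ D_z g)·w/sin(2θ)^{γ/2}‖²_{L²} + ‖(D_θ² g)·w/sin(2θ)^{γ/2}‖²_{L²}. -/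
open Real MeasureTheory Set Filter

noncomputable section

/-- The angular kernel `K(θ) = 3 sin θ cos² θ`. -/
def Kker (θ : ℝ) : ℝ := 3 * Real.sin θ * Real.cos θ ^ 2

/-- `L₁₂(f)(z) = ∫_z^∞ ∫_0^{π/2} f(r,θ) K(θ)/r dθ dr`. -/
def L12 (f : ℝ → ℝ → ℝ) (z : ℝ) : ℝ :=
  ∫ r in Ioi z, ∫ θ in Icc 0 (π / 2), f r θ * Kker θ / r

/-- The radial weight `w(z) = (1+z)²/z²`. -/
def wgt (z : ℝ) : ℝ := (1 + z) ^ 2 / z ^ 2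

/-- `D_θ f = sin(2θ) ∂_θ f`. -/
def Dth (f : ℝ → ℝ → ℝ) (z θ : ℝ) : ℝ := Real.sin (2 * θ) * deriv (fun t => f z t) θ

/-- `D_z f = z ∂_z f`. -/
def Dzr (f : ℝ → ℝ → ℝ) (z θ : ℝ) : ℝ := z * deriv (fun s => f s θ) z

/-- `Γ(θ) = (sin θ cos² θ)^{α/3}`. -/
def Gam (α θ : ℝ) : ℝ := (Real.sin θ * Real.cos θ ^ 2) ^ (α / 3)

/-- `c = ∫_0^{π/2} Γ(θ) K(θ) dθ`. -/
def cGam (α : ℝ) : ℝ := ∫ θ in Icc 0 (π / 2), Gam α θ * Kker θ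

/-- `𝓛(f) = f + z ∂_z f - 2 f/(1+z)`. -/
def Lop (f : ℝ → ℝ → ℝ) (z θ : ℝ) : ℝ :=
  f z θ + z * deriv (fun s => f s θ) z - 2 * f z θ / (1 + z)

/-- `𝓛_Γ(f) = 𝓛(f) - (2zΓ(θ)/(c(1+z)²)) L₁₂(f)`. -/
def LGam (α : ℝ) (f : ℝ → ℝ → ℝ) (z θ : ℝ) : ℝ :=
  Lop f z θ - 2 * z * Gam α θ / (cGam α * (1 + z) ^ 2) * L12 f z

/-- `ℙ(f)(z,θ) = f(z,θ) - (Γ(θ)/c)(2z²/(1+z)³) L₁₂(f)(0)`. -/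
def Pproj (α : ℝ) (f : ℝ → ℝ → ℝ) (z θ : ℝ) : ℝ :=
  f z θ - Gam α θ / cGam α * (2 * z ^ 2 / (1 + z) ^ 3) * L12 f 0

/-- `𝓛_Γ^T(f) = 𝓛_Γ(f) - ℙ((3/(1+z)) D_θ f)`. -/
def LGamT (α : ℝ) (f : ℝ → ℝ → ℝ) (z θ : ℝ) : ℝ :=
  LGam α f z θ - Pproj α (fun z2 θ2 => 3 / (1 + z2) * Dth f z2 θ2) z θ

/-- The `L²` inner product on `[0,∞) × [0,π/2]` with respect to `dz dθ`. -/
def ip (A B : ℝ → ℝ → ℝ) : ℝ :=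
  ∫ z in Ioi (0 : ℝ), ∫ θ in Icc 0 (π / 2), A z θ * B z θ

/-- `f` is admissible: smooth on `[0,∞) × [0,π/2]` and vanishing for `z` outside a
compact subset of `(0,∞)`. -/
def Admissible (f : ℝ → ℝ → ℝ) : Prop :=
  ContDiff ℝ (⊤ : ℕ∞) (Function.uncurry f) ∧
  ∃ a b : ℝ, 0 < a ∧ ∀ z θ : ℝ, z ∉ Icc a b → f z θ = 0


/-- The squared `L²` norm on `[0,∞)×[0,π/2]` with measure `dz dθ`. -/
def nsq (A : ℝ → ℝ → ℝ) : ℝ :=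
  ∫ z in Ioi (0 : ℝ), ∫ θ in Icc 0 (π / 2), (A z θ) ^ 2

/-- The squared `𝓗²` norm:
`|g|²_{𝓗²} = Σ_{k=0}^{2} ‖(D_z)^k g · w/sin(2θ)^{η/2}‖² + ‖(D_θ g)·w/sin(2θ)^{γ/2}‖²
  + ‖(D_θ D_z g)·w/sin(2θ)^{γ/2}‖² + ‖(D_θ² g)·w/sin(2θ)^{γ/2}‖²`. -/
def H2normSq (η γ : ℝ) (g : ℝ → ℝ → ℝ) : ℝ :=
  nsq (fun z θ => g z θ * wgt z / Real.sin (2 * θ) ^ (η / 2)) +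
    nsq (fun z θ => Dzr g z θ * wgt z / Real.sin (2 * θ) ^ (η / 2)) +
    nsq (fun z θ => Dzr (Dzr g) z θ * wgt z / Real.sin (2 * θ) ^ (η / 2)) +
    nsq (fun z θ => Dth g z θ * wgt z / Real.sin (2 * θ) ^ (γ / 2)) +
    nsq (fun z θ => Dth (Dzr g) z θ * wgt z / Real.sin (2 * θ) ^ (γ / 2)) +
    nsq (fun z θ => Dth (Dth g) z θ * wgt z / Real.sin (2 * θ) ^ (γ / 2))

lemma hasDerivAt_snd_of_differentiable {F : ℝ × ℝ → ℝ} (hF : Differentiable ℝ F) (z θ : ℝ) :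
    HasDerivAt (fun t => F (z, t)) (fderiv ℝ F (z, θ) (0, 1)) θ :=
  (hF (z, θ)).hasFDerivAt.comp_hasDerivAt θ ((hasDerivAt_const θ z).prodMk (hasDerivAt_id θ))

lemma hasDerivAt_fst_of_differentiable {F : ℝ × ℝ → ℝ} (hF : Differentiable ℝ F) (z θ : ℝ) :
    HasDerivAt (fun s => F (s, θ)) (fderiv ℝ F (z, θ) (1, 0)) z :=
  (hF (z, θ)).hasFDerivAt.comp_hasDerivAt z ((hasDerivAt_id z).prodMk (hasDerivAt_const z θ))

lemma contDiff_fderiv_apply_const {F : ℝ × ℝ → ℝ} (hF : ContDiff ℝ (⊤ : ℕ∞) F) (v : ℝ × ℝ) :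
    ContDiff ℝ (⊤ : ℕ∞) (fun p => fderiv ℝ F p v) :=
  (hF.fderiv_right (m := (⊤ : ℕ∞)) (by simp)).clm_apply contDiff_const

lemma fderiv_fderiv_apply_comm {F : ℝ × ℝ → ℝ} (hF : ContDiff ℝ (⊤ : ℕ∞) F) (u v p : ℝ × ℝ) :
    fderiv ℝ (fun q => fderiv ℝ F q u) p v = fderiv ℝ (fun q => fderiv ℝ F q v) p u := by
  have hd : DifferentiableAt ℝ (fderiv ℝ F) p :=
    (hF.fderiv_right (m := (⊤ : ℕ∞)) (by simp)).differentiable (by simp) p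
  have key : ∀ a b : ℝ × ℝ,
      fderiv ℝ (fun q => fderiv ℝ F q a) p b = fderiv ℝ (fderiv ℝ F) p b a := fun a b => by
    rw [fderiv_clm_apply hd (differentiableAt_const a)]
    simp
  rw [key, key]
  exact (hF.contDiffAt.isSymmSndFDerivAt
    (by simpa using WithTop.coe_le_coe.2 (le_top (a := (2 : ℕ∞))))) v u

lemma fderiv_apply_eq_zero_of_notMem_tsupport {F : ℝ × ℝ → ℝ} (v : ℝ × ℝ) {p : ℝ × ℝ}
    (hp : p ∉ tsupport F) : fderiv ℝ F p v = 0 := by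
  rw [image_eq_zero_of_notMem_tsupport fun h => hp (tsupport_fderiv_subset ℝ h)]
  rfl

lemma integrable_of_continuousOn_of_eq_zero {F : ℝ × ℝ → ℝ} {K : Set (ℝ × ℝ)}
    (hK : IsCompact K) (hF : ContinuousOn F K) (h0 : ∀ p ∉ K, F p = 0) : Integrable F :=
  (integrableOn_iff_integrable_of_support_subset
    (fun p hp => by_contra fun h => hp (h0 p h))).1 (hF.integrableOn_compact hK)

lemma nsq_nonneg (A : ℝ → ℝ → ℝ) : 0 ≤ nsq A :=
  integral_nonneg fun _ => integral_nonneg fun _ => sq_nonneg _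

lemma one_le_mul_wgt_sq {s : ℝ} (hs : 0 < s) : 1 ≤ s * wgt s ^ 2 := by
  have h : s * wgt s ^ 2 = (1 + s) ^ 4 / s ^ 3 := by
    unfold wgt
    field_simp
  rw [h, le_div_iff₀ (by positivity)]
  nlinarith [pow_pos hs 2, pow_pos hs 3, pow_pos hs 4]

/-- An integrable majorant of `sin (2θ) ^ (γ - 2)` on `(0, π/2)`. -/
def angularMajorant (γ θ : ℝ) : ℝ := θ ^ (γ - 2) + (π / 2 - θ) ^ (γ - 2)

lemma angularMajorant_nonneg {γ θ : ℝ} (hθ : θ ∈ Icc 0 (π / 2)) : 0 ≤ angularMajorant γ θ :=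
  add_nonneg (rpow_nonneg hθ.1 _) (rpow_nonneg (by linarith [hθ.2]) _)

lemma sin_two_mul_pos_s17 {θ : ℝ} (hθ : θ ∈ Ioo 0 (π / 2)) : 0 < Real.sin (2 * θ) :=
  sin_pos_of_pos_of_lt_pi (by linarith [hθ.1]) (by linarith [hθ.2])

lemma le_sin_two_mul_or_sub_le {θ : ℝ} (hθ : θ ∈ Ioo 0 (π / 2)) :
    θ ≤ Real.sin (2 * θ) ∨ π / 2 - θ ≤ Real.sin (2 * θ) := by
  have key : ∀ x : ℝ, 0 < x → x ≤ π / 4 → x ≤ Real.sin (2 * x) := fun x h0 h1 => by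
    refine le_trans ?_ (Real.mul_le_sin (by linarith : 0 ≤ 2 * x) (by linarith))
    have : 1 ≤ 2 / π * 2 := by
      rw [div_mul_eq_mul_div, le_div_iff₀ pi_pos]
      linarith [pi_le_four]
    nlinarith
  rcases le_total θ (π / 4) with h | h
  · exact Or.inl (key θ hθ.1 h)
  · right
    have := key (π / 2 - θ) (by linarith [hθ.2]) (by linarith)
    rwa [show 2 * (π / 2 - θ) = π - 2 * θ by ring, sin_pi_sub] at this

lemma one_le_angularMajorant_mul {γ θ : ℝ} (hγ : γ ≤ 2) (hθ : θ ∈ Ioo 0 (π / 2)) :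
    1 ≤ angularMajorant γ θ * (Real.sin (2 * θ) / Real.sin (2 * θ) ^ (γ / 2)) ^ 2 := by
  have hs := sin_two_mul_pos_s17 hθ
  have hr : (Real.sin (2 * θ) / Real.sin (2 * θ) ^ (γ / 2)) ^ 2
      = (Real.sin (2 * θ) ^ (γ - 2))⁻¹ := by
    rw [← rpow_neg hs.le, div_pow, ← rpow_natCast (_ ^ (γ / 2)), ← rpow_mul hs.le,
      ← rpow_natCast, ← rpow_sub hs]
    congr 1
    push_cast
    ring
  rw [hr, ← div_eq_mul_inv, one_le_div (by positivity)]
  have h1 := rpow_nonneg hθ.1.le (γ - 2)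
  have h2 := rpow_nonneg (show 0 ≤ π / 2 - θ by linarith [hθ.2]) (γ - 2)
  unfold angularMajorant
  rcases le_sin_two_mul_or_sub_le hθ with h | h
  · linarith [rpow_le_rpow_of_nonpos hθ.1 h (by linarith : γ - 2 ≤ 0)]
  · linarith [rpow_le_rpow_of_nonpos (show 0 < π / 2 - θ by linarith [hθ.2]) h
      (by linarith : γ - 2 ≤ 0)]

lemma intervalIntegrable_angularMajorant {γ : ℝ} (hγ : 1 < γ) :
    IntervalIntegrable (angularMajorant γ) volume 0 (π / 2) := by
  have h : IntervalIntegrable (fun x : ℝ => x ^ (γ - 2)) volume 0 (π / 2) :=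
    intervalIntegral.intervalIntegrable_rpow' (by linarith)
  refine h.add ?_
  simpa using (h.comp_sub_left (π / 2)).symm

lemma integral_angularMajorant_le {γ : ℝ} (hγ : 1 < γ) (hγ2 : γ ≤ 2) :
    ∫ θ in (0 : ℝ)..(π / 2), angularMajorant γ θ ≤ 4 / (γ - 1) := by
  have h : IntervalIntegrable (fun x : ℝ => x ^ (γ - 2)) volume 0 (π / 2) :=
    intervalIntegral.intervalIntegrable_rpow' (by linarith)
  have h' : IntervalIntegrable (fun x : ℝ => (π / 2 - x) ^ (γ - 2)) volume 0 (π / 2) := by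
    simpa using (h.comp_sub_left (π / 2)).symm
  have e : ∫ x in (0 : ℝ)..(π / 2), (π / 2 - x) ^ (γ - 2)
      = ∫ x in (0 : ℝ)..(π / 2), x ^ (γ - 2) := by
    simpa using intervalIntegral.integral_comp_sub_left (fun x : ℝ => x ^ (γ - 2)) (π / 2)
      (a := 0) (b := π / 2)
  unfold angularMajorant
  rw [intervalIntegral.integral_add h h', e, integral_rpow (Or.inl (by linarith)),
    show γ - 2 + 1 = γ - 1 by ring, zero_rpow (by linarith), sub_zero, ← two_mul,
    ← mul_div_assoc]
  have hb : (π / 2) ^ (γ - 1) ≤ (π / 2) ^ (1 : ℝ) :=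
    rpow_le_rpow_of_exponent_le (by linarith [pi_gt_three]) (by linarith)
  rw [rpow_one] at hb
  exact div_le_div_of_nonneg_right (by linarith [pi_le_four]) (by linarith)

/-- One-dimensional weighted trace inequality in the radial variable. -/
lemma sq_le_setIntegral_Ioi {h k : ℝ → ℝ} (hk : Continuous k)
    (hd : ∀ s, HasDerivAt h (k s) s) (h0 : h 0 = 0) {c z : ℝ} (hc : 0 ≤ c) (hz : 0 < z)
    (hint : IntegrableOn (fun s => c * ((h s ^ 2 + (s * k s) ^ 2) * wgt s ^ 2)) (Ioi 0)) :
    c * h z ^ 2 ≤ ∫ s in Ioi 0, c * ((h s ^ 2 + (s * k s) ^ 2) * wgt s ^ 2) := by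
  have hh : Continuous h := continuous_iff_continuousAt.2 fun s => (hd s).continuousAt
  have hcont : Continuous fun s => c * (2 * h s * k s) := by fun_prop
  have ftc : ∫ s in (0 : ℝ)..z, c * (2 * h s * k s) = c * h z ^ 2 := by
    rw [intervalIntegral.integral_eq_sub_of_hasDerivAt (f := fun s => c * h s ^ 2)
      (fun s _ => by simpa using ((hd s).pow 2).const_mul c) (hcont.intervalIntegrable _ _)]
    simp [h0]
  rw [← ftc, intervalIntegral.integral_of_le hz.le]
  refine (setIntegral_mono_on (hcont.integrableOn_Ioc) (hint.mono_set Ioc_subset_Ioi_self)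
    measurableSet_Ioc fun s hs => ?_).trans
    (setIntegral_mono_set hint (ae_of_all _ fun s => by positivity)
      Ioc_subset_Ioi_self.eventuallyLE)
  refine mul_le_mul_of_nonneg_left ?_ hc
  have hs0 : 0 < s := hs.1
  have hw := one_le_mul_wgt_sq hs0
  have h1 : 2 * s * (h s * k s) ≤ h s ^ 2 + (s * k s) ^ 2 := by
    nlinarith [sq_nonneg (h s - s * k s)]
  have h2 : 2 * h s * k s ≤ (h s ^ 2 + (s * k s) ^ 2) / s := by
    rw [le_div_iff₀ hs0]
    linarith
  refine h2.trans ?_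
  rw [div_eq_mul_inv]
  refine mul_le_mul_of_nonneg_left ?_ (by positivity)
  rw [inv_le_iff_one_le_mul₀ hs0]
  linarith

/-- One-dimensional weighted bound in the angular variable. -/
lemma sq_le_mul_setIntegral_of_angular {γ : ℝ} (hγ : 1 < γ) (hγ2 : γ ≤ 2) {f h Φ : ℝ → ℝ}
    (hh : Continuous h) (hd : ∀ t, HasDerivAt f (h t) t) (h0 : f 0 = 0)
    (hΦ : IntegrableOn Φ (Icc 0 (π / 2)))
    (hle : ∀ᵐ t, t ∈ Ioo 0 (π / 2) →
      (Real.sin (2 * t) / Real.sin (2 * t) ^ (γ / 2)) ^ 2 * h t ^ 2 ≤ Φ t)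
    {θ : ℝ} (hθ : θ ∈ Icc 0 (π / 2)) :
    f θ ^ 2 ≤ 4 / (γ - 1) * ∫ t in Icc 0 (π / 2), Φ t := by
  have hpi : (0 : ℝ) ≤ π / 2 := by positivity
  set A := 4 / (γ - 1) with hA
  set B := ∫ t in Icc 0 (π / 2), Φ t with hB
  have hApos : 0 < A := div_pos (by norm_num) (by linarith)
  have hΦi : IntervalIntegrable Φ volume 0 (π / 2) := by
    rw [intervalIntegrable_iff_integrableOn_Icc_of_le hpi]
    exact hΦ
  have hB' : ∫ t in (0 : ℝ)..(π / 2), Φ t = B := by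
    rw [intervalIntegral.integral_of_le hpi, ← integral_Icc_eq_integral_Ioc]
  have habs : |f θ| ≤ ∫ t in (0 : ℝ)..(π / 2), |h t| := by
    have ftc : ∫ t in (0 : ℝ)..θ, h t = f θ := by
      rw [intervalIntegral.integral_eq_sub_of_hasDerivAt (fun s _ => hd s)
        (hh.intervalIntegrable _ _), h0, sub_zero]
    rw [← ftc]
    refine (intervalIntegral.abs_integral_le_integral_abs hθ.1).trans ?_
    exact intervalIntegral.integral_mono_interval le_rfl hθ.1 hθ.2
      (ae_of_all _ fun t => abs_nonneg _) (hh.abs.intervalIntegrable _ _)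
  have young : ∀ t : ℝ, 0 < t → 2 * |f θ| ≤ t * A + B / t := fun t ht => by
    have hmi := intervalIntegrable_angularMajorant hγ
    have hle' : ∫ x in (0 : ℝ)..(π / 2), 2 * |h x|
        ≤ ∫ x in (0 : ℝ)..(π / 2), (t * angularMajorant γ x + Φ x / t) := by
      rw [intervalIntegral.integral_of_le hpi, intervalIntegral.integral_of_le hpi,
        integral_Ioc_eq_integral_Ioo, integral_Ioc_eq_integral_Ioo]
      have hsub : Ioo (0 : ℝ) (π / 2) ⊆ Ioc 0 (π / 2) := Ioo_subset_Ioc_self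
      refine setIntegral_mono_on_ae ?_ ?_ measurableSet_Ioo ?_
      · exact (((hh.abs.const_mul 2).intervalIntegrable 0 (π / 2)).1).mono_set hsub
      · exact (((hmi.const_mul t).add (hΦi.div_const t)).1).mono_set hsub
      · filter_upwards [hle] with x hx hxm
        have hm := angularMajorant_nonneg (γ := γ) (Ioo_subset_Icc_self hxm)
        have h1 := one_le_angularMajorant_mul hγ2 hxm
        have h2 := hx hxm
        set m := angularMajorant γ x
        set r := (Real.sin (2 * x) / Real.sin (2 * x) ^ (γ / 2)) ^ 2
        have h3 : h x ^ 2 ≤ m * Φ x := by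
          nlinarith [mul_le_mul_of_nonneg_left h2 hm, sq_nonneg (h x)]
        have hΦ0 : 0 ≤ Φ x := le_trans (by positivity) h2
        have h4 : (t * m) * (Φ x / t) = m * Φ x := by field_simp
        have ha : 0 ≤ t * m := by positivity
        have hb : 0 ≤ Φ x / t := by positivity
        refine abs_le_of_sq_le_sq' ?_ (by positivity) |>.2
        rw [mul_pow, sq_abs]
        nlinarith [sq_nonneg (t * m - Φ x / t)]
    rw [intervalIntegral.integral_const_mul, intervalIntegral.integral_add (hmi.const_mul t)
      (hΦi.div_const t), intervalIntegral.integral_const_mul, intervalIntegral.integral_div,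
      hB'] at hle'
    have := mul_le_mul_of_nonneg_left (integral_angularMajorant_le hγ hγ2) ht.le
    linarith
  rcases (abs_nonneg (f θ)).eq_or_lt with hz | hpos
  · have hB0 : 0 ≤ B := by
      rw [← hB', intervalIntegral.integral_of_le hpi, integral_Ioc_eq_integral_Ioo]
      refine setIntegral_nonneg_of_ae_restrict ?_
      refine (ae_restrict_iff' measurableSet_Ioo).2 ?_
      filter_upwards [hle] with x hx hxm
      exact le_trans (by positivity) (hx hxm)
    rw [← sq_abs, ← hz, zero_pow two_ne_zero]
    exact mul_nonneg hApos.le hB0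
  · have := young (|f θ| / A) (by positivity)
    rw [div_mul_cancel₀ _ hApos.ne', div_div_eq_mul_div] at this
    have h2 : |f θ| ≤ B * A / |f θ| := by linarith
    rw [le_div_iff₀ hpos] at h2
    rw [← sq_abs]
    nlinarith

lemma Dth_eq_fderiv {g : ℝ → ℝ → ℝ} (hg : ContDiff ℝ (⊤ : ℕ∞) (Function.uncurry g)) (z θ : ℝ) :
    Dth g z θ = Real.sin (2 * θ) * fderiv ℝ (Function.uncurry g) (z, θ) (0, 1) :=
  congrArg _ (hasDerivAt_snd_of_differentiable (hg.differentiable (by simp)) z θ).deriv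

lemma Dth_Dzr_eq_fderiv {g : ℝ → ℝ → ℝ} (hg : ContDiff ℝ (⊤ : ℕ∞) (Function.uncurry g))
    (z θ : ℝ) :
    Dth (Dzr g) z θ = Real.sin (2 * θ) * (z *
      fderiv ℝ (fun p => fderiv ℝ (Function.uncurry g) p (0, 1)) (z, θ) (1, 0)) := by
  rw [fderiv_fderiv_apply_comm hg]
  have h : (fun t => Dzr g z t)
      = fun t => z * fderiv ℝ (Function.uncurry g) (z, t) (1, 0) := funext fun t =>
    congrArg _ (hasDerivAt_fst_of_differentiable (hg.differentiable (by simp)) z t).deriv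
  unfold Dth
  rw [h]
  exact congrArg _ ((hasDerivAt_snd_of_differentiable
    ((contDiff_fderiv_apply_const hg _).differentiable (by simp)) z θ).const_mul z).deriv

/-- The product measure underlying `nsq`. -/
def stripMeasure : Measure (ℝ × ℝ) :=
  (volume.restrict (Ioi 0)).prod (volume.restrict (Icc 0 (π / 2)))

lemma integrable_weighted_sq {K : Set (ℝ × ℝ)} (hK : IsCompact K)
    (hsub : K ⊆ Ioi 0 ×ˢ Ioo 0 (π / 2)) {u : ℝ × ℝ → ℝ} (hu : Continuous u)
    (h0 : ∀ p ∉ K, u p = 0) (γ : ℝ) :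
    Integrable (fun p : ℝ × ℝ =>
      (Real.sin (2 * p.2) * u p * wgt p.1 / Real.sin (2 * p.2) ^ (γ / 2)) ^ 2) stripMeasure := by
  have hint : Integrable (fun p : ℝ × ℝ =>
      (Real.sin (2 * p.2) * u p * wgt p.1 / Real.sin (2 * p.2) ^ (γ / 2)) ^ 2) := by
    refine integrable_of_continuousOn_of_eq_zero hK ?_ fun p hp => by simp [h0 p hp]
    have hs : ContinuousOn (fun p : ℝ × ℝ => Real.sin (2 * p.2)) K :=
      Continuous.continuousOn (by fun_prop)
    have hpos : ∀ p ∈ K, 0 < Real.sin (2 * p.2) := fun p hp => sin_two_mul_pos_s17 (hsub hp).2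
    have hw : ContinuousOn (fun p : ℝ × ℝ => wgt p.1) K := by
      unfold wgt
      exact ContinuousOn.div (Continuous.continuousOn (by fun_prop))
        (Continuous.continuousOn (by fun_prop)) fun p hp => (pow_pos (hsub hp).1 2).ne'
    exact (((hs.mul hu.continuousOn).mul hw).div
      (hs.rpow_const fun p hp => Or.inl (hpos p hp).ne')
      fun p hp => (rpow_pos_of_pos (hpos p hp) _).ne').pow 2
  unfold stripMeasure
  rw [Measure.prod_restrict]
  exact hint.restrict

lemma sq_le_mul_nsq_add_nsq {γ : ℝ} (hγ : 1 < γ) (hγ2 : γ ≤ 2) {g : ℝ → ℝ → ℝ}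
    (hg : ContDiff ℝ (⊤ : ℕ∞) (Function.uncurry g))
    (hcs : HasCompactSupport (Function.uncurry g))
    (hsub : tsupport (Function.uncurry g) ⊆ Ioi 0 ×ˢ Ioo 0 (π / 2))
    {z θ : ℝ} (hz : 0 < z) (hθ : θ ∈ Icc 0 (π / 2)) :
    g z θ ^ 2 ≤ 4 / (γ - 1) *
      (nsq (fun z θ => Dth g z θ * wgt z / Real.sin (2 * θ) ^ (γ / 2)) +
        nsq (fun z θ => Dth (Dzr g) z θ * wgt z / Real.sin (2 * θ) ^ (γ / 2))) := by
  set G := Function.uncurry g with hG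
  set K := tsupport G with hKdef
  set Gt : ℝ × ℝ → ℝ := fun p => fderiv ℝ G p (0, 1) with hGt
  set Gzt : ℝ × ℝ → ℝ := fun p => fderiv ℝ Gt p (1, 0) with hGzt
  have hGtc : ContDiff ℝ (⊤ : ℕ∞) Gt := contDiff_fderiv_apply_const hg _
  have hGztc : ContDiff ℝ (⊤ : ℕ∞) Gzt := contDiff_fderiv_apply_const hGtc _
  have hGt0 : ∀ p ∉ K, Gt p = 0 := fun p hp => fderiv_apply_eq_zero_of_notMem_tsupport _ hp
  have hGzt0 : ∀ p ∉ K, Gzt p = 0 := fun p hp =>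
    fderiv_apply_eq_zero_of_notMem_tsupport _ fun h =>
      hp (tsupport_fderiv_apply_subset ℝ (0, 1) h)
  have e1 : ∀ z θ, Dth g z θ = Real.sin (2 * θ) * Gt (z, θ) := Dth_eq_fderiv hg
  have e2 : ∀ z θ, Dth (Dzr g) z θ = Real.sin (2 * θ) * (z * Gzt (z, θ)) := Dth_Dzr_eq_fderiv hg
  have i1 := integrable_weighted_sq hcs hsub hGtc.continuous hGt0 γ
  have i2 := integrable_weighted_sq hcs hsub (u := fun p => p.1 * Gzt p)
    (continuous_fst.mul hGztc.continuous) (fun p hp => by simp [hGzt0 p hp]) γ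
  set F : ℝ → ℝ → ℝ := fun θ s => (Real.sin (2 * θ) / Real.sin (2 * θ) ^ (γ / 2)) ^ 2 *
    ((Gt (s, θ) ^ 2 + (s * Gzt (s, θ)) ^ 2) * wgt s ^ 2) with hF
  have hsum : (fun p : ℝ × ℝ =>
      (Real.sin (2 * p.2) * Gt p * wgt p.1 / Real.sin (2 * p.2) ^ (γ / 2)) ^ 2 +
      (Real.sin (2 * p.2) * (p.1 * Gzt p) * wgt p.1 / Real.sin (2 * p.2) ^ (γ / 2)) ^ 2)
      = fun p => F p.2 p.1 := by
    funext p
    simp only [hF, Prod.mk.eta]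
    ring
  have iF : Integrable (fun p : ℝ × ℝ => F p.2 p.1) stripMeasure := by
    rw [← hsum]
    exact i1.add i2
  have hN : nsq (fun z θ => Dth g z θ * wgt z / Real.sin (2 * θ) ^ (γ / 2)) +
      nsq (fun z θ => Dth (Dzr g) z θ * wgt z / Real.sin (2 * θ) ^ (γ / 2))
      = ∫ t in Icc 0 (π / 2), ∫ s in Ioi 0, F t s := by
    have n1 := integral_prod _ i1
    have n2 := integral_prod _ i2
    have n3 := integral_prod_symm _ iF
    simp only [nsq, e1, e2]
    rw [← n3, ← hsum]
    refine Eq.trans ?_ (integral_add i1 i2).symm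
    exact congrArg₂ (· + ·) n1.symm n2.symm
  rw [hN]
  refine sq_le_mul_setIntegral_of_angular (f := fun t => G (z, t)) (h := fun t => Gt (z, t))
    hγ hγ2 (hGtc.continuous.comp (by fun_prop))
    (hasDerivAt_snd_of_differentiable (hg.differentiable (by simp)) z)
    (image_eq_zero_of_notMem_tsupport fun h => lt_irrefl _ (hsub h).2.1)
    iF.integral_prod_right ?_ hθ
  have hslice := (ae_restrict_iff' measurableSet_Icc).1 iF.prod_left_ae
  filter_upwards [hslice] with t ht hmem
  exact sq_le_setIntegral_Ioi (h := fun s => Gt (s, t)) (k := fun s => Gzt (s, t))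
    (hGztc.continuous.comp (by fun_prop))
    (fun s => hasDerivAt_fst_of_differentiable (hGtc.differentiable (by simp)) s t)
    (hGt0 _ fun h => lt_irrefl (0 : ℝ) (hsub h).1) (sq_nonneg _) hz (ht (Ioo_subset_Icc_self hmem))

/-- `L^∞` embedding of the weighted space `𝓗²`: there is a universal constant `C > 0`
such that for every `α ∈ (0,1]`, with `γ = 1 + α/10` and `η = 99/100`, and every
`g ∈ C_c^∞((0,∞)×(0,π/2))`, one has `‖g‖_{L^∞} ≤ (C/√(γ−1)) |g|_{𝓗²}`. -/
theorem H2_Linfty_embedding :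
    ∃ C : ℝ, 0 < C ∧ ∀ α ∈ Ioc (0 : ℝ) 1, ∀ η γ : ℝ, η = 99 / 100 → γ = 1 + α / 10 →
      ∀ g : ℝ → ℝ → ℝ,
        ContDiff ℝ (⊤ : ℕ∞) (Function.uncurry g) →
        HasCompactSupport (Function.uncurry g) →
        tsupport (Function.uncurry g) ⊆ Ioi 0 ×ˢ Ioo 0 (π / 2) →
        ∀ z θ : ℝ, |g z θ| ≤ C / Real.sqrt (γ - 1) * Real.sqrt (H2normSq η γ g) := by
  refine ⟨2, two_pos, ?_⟩
  rintro α ⟨hα0, hα1⟩ η γ - hγ g hg hcs hsub z θ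
  by_cases hp : (z, θ) ∈ tsupport (Function.uncurry g)
  · have hγ1 : 0 < γ - 1 := by linarith
    have hmain := sq_le_mul_nsq_add_nsq (γ := γ) (by linarith) (by linarith) hg hcs hsub
      (hsub hp).1 (Ioo_subset_Icc_self (hsub hp).2)
    have hle : nsq (fun z θ => Dth g z θ * wgt z / Real.sin (2 * θ) ^ (γ / 2)) +
        nsq (fun z θ => Dth (Dzr g) z θ * wgt z / Real.sin (2 * θ) ^ (γ / 2))
        ≤ H2normSq η γ g := by
      unfold H2normSq
      linarith [nsq_nonneg (fun z θ => g z θ * wgt z / Real.sin (2 * θ) ^ (η / 2)),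
        nsq_nonneg (fun z θ => Dzr g z θ * wgt z / Real.sin (2 * θ) ^ (η / 2)),
        nsq_nonneg (fun z θ => Dzr (Dzr g) z θ * wgt z / Real.sin (2 * θ) ^ (η / 2)),
        nsq_nonneg (fun z θ => Dth (Dth g) z θ * wgt z / Real.sin (2 * θ) ^ (γ / 2))]
    have hH : 0 ≤ H2normSq η γ g := le_trans (add_nonneg (nsq_nonneg _) (nsq_nonneg _)) hle
    refine abs_le_of_sq_le_sq ?_ (by positivity)
    rw [mul_pow, div_pow, sq_sqrt hγ1.le, sq_sqrt hH]
    norm_num only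
    exact hmain.trans (mul_le_mul_of_nonneg_left hle (by positivity))
  · have h0 : g z θ = 0 :=
      image_eq_zero_of_notMem_tsupport (f := Function.uncurry g) hp
    rw [h0, abs_zero]
    positivity
end
end
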